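/- Let 0<Δ<1 and let C₂ be the constant from the upper-bound estimate. For each h in a sequence tending to 0, let y_h ∈ C²(cl(B₁); ℝ³) satisfy I_{h,Δ}(y_h) ≤ 2πΔ²h²(log(1/h) + C₂). Then there exist R_h ∈ O(3) and b_h ∈ ℝ³ such that, setting ỹ_h = R_h·y_h + b_h, for every ρ ∈ (0,1): (a) limsup_{h→0} ∫_{B₁∖B_ρ} |D²ỹ_h|² dL² < ∞, (b) ∫_{B₁∖B_ρ} |ỹ_h − y^Δ|² dL² → 0, and (c) ∫_{B₁∖B_ρ} |Dỹ_h − Dy^Δ|² dL² → 0 as h → 0; i.e. up to Euclidean motions y_h converges weakly to the cone y^Δ in W^{2,2}(B₁∖B_ρ; ℝ³) for every ρ. -/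

import Mathlib

open MeasureTheory Metric Real Filter Matrix
open scoped ENNReal Topology

noncomputable section

/-- The plane `ℝ²` with the Euclidean norm. -/
abbrev E2 : Type := EuclideanSpace ℝ (Fin 2)
/-- The space `ℝ³` with the Euclidean norm. -/
abbrev E3 : Type := EuclideanSpace ℝ (Fin 3)

/-- The `i`-th standard basis vector of `ℝ²`. -/
def e2 (i : Fin 2) : E2 := EuclideanSpace.single i 1

/-- Partial derivative in the direction of the `i`-th coordinate. -/
def pd (i : Fin 2) (f : E2 → ℝ) (x : E2) : ℝ := fderiv ℝ f x (e2 i)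

/-- Hessian matrix of a scalar function on `ℝ²`. -/
def hess (f : E2 → ℝ) (x : E2) : Matrix (Fin 2) (Fin 2) ℝ :=
  Matrix.of fun i j => pd i (pd j f) x

/-- Derivative matrix `Dy ∈ ℝ^{3×2}` of a map `y : ℝ² → ℝ³`. -/
def Dmat (y : E2 → E3) (x : E2) : Matrix (Fin 3) (Fin 2) ℝ :=
  Matrix.of fun i j => pd j (fun z => y z i) x

/-- Induced metric `g_y = (Dy)ᵀ Dy`. -/
def gmet (y : E2 → E3) (x : E2) : Matrix (Fin 2) (Fin 2) ℝ :=
  (Dmat y x)ᵀ * Dmat y x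

/-- The rotated vector `x⊥ = (-x₂, x₁)`. -/
def perpVec (x : E2) : Fin 2 → ℝ := ![-(x 1), x 0]

/-- The unit tangent `x̂⊥ = (-x₂, x₁)/|x|`. -/
def xperpUnit (x : E2) : Fin 2 → ℝ := fun i => perpVec x i / ‖x‖

/-- The reference (cone) metric `g_Δ = Id - Δ² x̂⊥ ⊗ x̂⊥`. -/
def gDelta (Δ : ℝ) (x : E2) : Matrix (Fin 2) (Fin 2) ℝ :=
  1 - Matrix.of fun i j => (Δ ^ 2 / ‖x‖ ^ 2) * perpVec x i * perpVec x j

/-- Squared Frobenius norm of a matrix. -/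
def frob2 {m n : Type*} [Fintype m] [Fintype n] (A : Matrix m n ℝ) : ℝ :=
  ∑ i, ∑ j, (A i j) ^ 2

/-- `|D²y|²`: the sum of the squared Frobenius norms of the Hessians of the components. -/
def hessNormSq (y : E2 → E3) (x : E2) : ℝ :=
  ∑ i : Fin 3, frob2 (hess (fun z => y z i) x)

/-- The free elastic energy `I_{h,Δ}(y)`. -/
def energy (h Δ : ℝ) (y : E2 → E3) : ℝ :=
  ∫ x in ball (0 : E2) 1, (frob2 (gmet y x - gDelta Δ x) + h ^ 2 * hessNormSq y x)

/-- The singular cone `y^Δ(x) = √(1-Δ²)·(x,0) + Δ|x| e₃`. -/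
def coneMap (Δ : ℝ) (x : E2) : E3 :=
  (WithLp.equiv 2 (Fin 3 → ℝ)).symm
    ![Real.sqrt (1 - Δ ^ 2) * x 0, Real.sqrt (1 - Δ ^ 2) * x 1, Δ * ‖x‖]

/- Notation for frequently used expressions; the letters in them refer to the local variables. -/
set_option hygiene false
notation "Lm" => Lim Δ y e q z er qr k
notation "CDy" => ContDiff ℝ 2 y
notation "Fe" => ℝ × ℝ → E3
notation "Fs" => ℝ × ℝ → ℝ
notation "Q2" => ℝ × ℝ
notation "YY" => E2 → E3
notation "fp" => (by fun_prop)
notation "X3" => (e p, q p, z p)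
notation "dD" => (1-Δ^2)
notation "rh" => (r^2+h^2)
notation "aG" => ((1 / (1 + (((m:ℝ)+1) * G (X0 p))^2)) * (p.1^2 * fderiv ℝ G (X0 p) (D0 p)))
notation "hE" => (4*p.1*η p + p.1^2*ηr p)
notation "T3" => (Xt0 e q qr k p)
notation "R3" => (Xr0 er qr p)
notation "eQ" => (fun p => ‖erf y p‖^2 + ‖qrf y p‖^2)
notation "qK" => (fun p => ‖qrf y p‖^2 + ‖kf y p‖^2)
notation "oM" => (Om_meas _ _)
notation "pv" => (by positivity)
notation "la" => (by linarith)
notation "nrm0" => (by norm_num)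
notation "epY" => (eps (ef y) (qf y) (etf y) (qtf y))
notation "sS" => (2*σ)
notation "eq2" => (‖erf y p‖^2 + ‖qrf y p‖^2)
notation "cN" => (crs (e p) (q p) i * Nt e q qr k p j)
notation "mFS" => ((ContinuousLinearMap.fst ℝ E3 E3).comp (.snd ℝ E3 (E3 × E3)))
notation "eqk" => (fun p => ‖erf y p‖^2 + ‖qrf y p‖^2 + ‖kf y p‖^2)
notation "eqz" => (fun p => ‖ef y p‖^2 + ‖qf y p‖^2 + ‖zf y p‖^2)
notation "d4" => (deriv (Pf σ) p.1 - 4*p.1^3)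
notation "nX" => (n2 (X p - XF f p.2) + n2 (T p - TF f p.2))
notation "X30" => ((X p).1, (X p).2.1, (0:E3))
notation "zR" => (0:ℝ)
notation "hh4" => (4*h^2)
notation "hR3" => (4*p.1^3*η p + p.1^4*ηr p)
notation "RE" => (R.toContinuousLinearEquiv : E3 →L[ℝ] E3)
notation "m1R" => ((m:ℝ)+1)
notation "RS" => (‖R (ef y p) - e0 Δ p.2‖^2 + ‖R (qf y p) - q0 Δ p.2‖^2 + ‖zf y p‖^2)
notation "FD" => (f n p - f0 p)
notation "no" => (norm_nonneg _)
notation "h1s" => (1+h^2)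
notation "cf2" => (ii_cont fp)
notation "c1f" => (c1 fp)
notation "cof" => (cont_Om fp _ _)
notation "ii_add" => intervalIntegral.integral_add
notation "ii_sub" => intervalIntegral.integral_sub
notation "ii_ftc" => intervalIntegral.integral_eq_sub_of_hasDerivAt
notation "ii_cm" => intervalIntegral.integral_const_mul
notation "mln" => mul_le_mul_of_nonneg_left
notation "rnn" => Real.norm_of_nonneg
notation "ris" => real_inner_self_eq_norm_sq
notation "cic" => continuous_iff_continuousAt
notation "ii_nn" => intervalIntegral.integral_nonneg
notation "iSg" f:60 => ∫ p in Om σ sS, f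
notation "iT" f:60 => ∫ t in (-π)..π, f
notation "iH" f:60 => ∫ θ in (-π)..π, f
notation "iR" f:60 => ∫ r in zR..1, f
set_option hygiene true

section
theorem wirt_scalar (f f' : ℝ → ℝ) (hf : ∀ t, HasDerivAt f (f' t) t) (hf' : Continuous f')
    (hper : f π = f (-π)) (hm : iT f t = 0) :
    iT (f t)^2 ≤ iT (f' t)^2 := by
  have hpi := Real.pi_pos
  have hab : -π < π := by linarith
  have hfc : Continuous f := continuous_iff_continuousAt.2 fun t => (hf t).continuousAt
  let F : ℝ → ℂ := fun t => (f t : ℂ)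
  let F' : ℝ → ℂ := fun t => (f' t : ℂ)
  have hF : Continuous F := Complex.continuous_ofReal.comp hfc
  have hF' : Continuous F' := Complex.continuous_ofReal.comp hf'
  have mem : ∀ G : ℝ → ℂ, Continuous G → MemLp G 2 (volume.restrict (Set.Ioc (-π) π)) := by
    intro G hG
    have := (hG.memLp_top_of_hasCompactSupport)
    obtain ⟨C, hC⟩ := (isCompact_Icc (a := -π) (b := π)).exists_bound_of_continuousOn hG.continuousOn
    refine MemLp.of_bound hG.aestronglyMeasurable C ?_
    refine (ae_restrict_iff' measurableSet_Ioc).2 (Eventually.of_forall fun x hx => hC x ⟨hx.1.le, hx.2⟩)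
  have h1 := hasSum_sq_fourierCoeffOn hab (mem F hF)
  have h2 := hasSum_sq_fourierCoeffOn hab (mem F' hF')
  have hle : ∀ i : ℤ, ‖fourierCoeffOn hab F i‖^2 ≤ ‖fourierCoeffOn hab F' i‖^2 := by
    intro i
    by_cases hi : i = 0
    · subst hi
      have : fourierCoeffOn hab F 0 = 0 := by
        rw [fourierCoeffOn_eq_integral]
        simp [F, intervalIntegral.integral_ofReal, hm]
      rw [this]; simp
    · have hh := fourierCoeffOn_of_hasDerivAt hab hi (f := F) (f' := F')
        (fun x _ => (hf x).ofReal_comp) (hF'.intervalIntegrable _ _)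
      have e0 : F π - F (-π) = 0 := by simp [F, hper]
      rw [hh, e0]
      have : ‖(1 / (-2 * ↑π * Complex.I * ↑i) : ℂ) * ((fourier (-i)) ((-π : ℝ) : AddCircle (π - -π)) * 0 - (↑π - ↑(-π)) * fourierCoeffOn hab F' i)‖ = ‖fourierCoeffOn hab F' i‖ / |(i:ℝ)| := by
        rw [mul_zero, zero_sub, norm_mul, norm_neg, norm_mul]
        have : ((π:ℂ) - ((-π : ℝ):ℂ)) = ((2*π : ℝ) : ℂ) := by push_cast; ring
        rw [this]
        simp [abs_of_pos hpi]
        field_simp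
      rw [this]
      have hi1 : (1:ℝ) ≤ |(i:ℝ)| := by
        exact_mod_cast Int.one_le_abs hi
      gcongr
      exact div_le_self no hi1
  have h3 := hasSum_le hle h1 h2
  have hc : 0 < (1 / (π - -π)) := by apply one_div_pos.2; linarith
  simp only [smul_eq_mul, inv_eq_one_div] at h3
  have h4 := le_of_mul_le_mul_left h3 hc
  simpa [F, F'] using h4

theorem ii_cont {E : Type*} [NormedAddCommGroup E] {f : ℝ → E} (hf : Continuous f) {a b : ℝ} :
    IntervalIntegrable f volume a b := hf.intervalIntegrable _ _

/-- coordinate functional -/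
def pr (i : Fin 3) : E3 →L[ℝ] ℝ := EuclideanSpace.proj i

@[simp] theorem pr_apply (i : Fin 3) (v : E3) : pr i v = v i := rfl

theorem int_coord (f : ℝ → E3) (hf : Continuous f) (a b : ℝ) (i : Fin 3) :
    (∫ t in a..b, f t) i = ∫ t in a..b, f t i := by
  have := (pr i).intervalIntegral_comp_comm (ii_cont hf (a := a) (b := b))
  simpa using this.symm

theorem nsq3 (v : E3) : ‖v‖^2 = ∑ i, (v i)^2 := by
  simp [EuclideanSpace.norm_sq_eq]

theorem wirt (f f' : ℝ → E3) (hf : ∀ t, HasDerivAt f (f' t) t) (hf' : Continuous f')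
    (hper : f π = f (-π)) (hm : iT f t = 0) :
    iT ‖f t‖^2 ≤ iT ‖f' t‖^2 := by
  have hfc : Continuous f := continuous_iff_continuousAt.2 fun t => (hf t).continuousAt
  simp only [nsq3]
  rw [intervalIntegral.integral_finsetSum (fun i _ => by apply ii_cont; fun_prop),
    intervalIntegral.integral_finsetSum (fun i _ => by apply ii_cont; fun_prop)]
  refine Finset.sum_le_sum fun i _ => wirt_scalar _ _ (fun t => ?_) fp (by rw [hper]) ?_
  · exact (pr i).hasFDerivAt.comp_hasDerivAt t (hf t)
  · rw [← int_coord f hfc, hm]; rfl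

theorem int_inner_parts (f f' g g' : ℝ → E3) (hf : ∀ t, HasDerivAt f (f' t) t) (hf' : Continuous f')
    (hg : ∀ t, HasDerivAt g (g' t) t) (hg' : Continuous g')
    (hpf : f π = f (-π)) (hpg : g π = g (-π)) :
    iT inner ℝ (f t) (g' t) = - iT inner ℝ (f' t) (g t) := by
  have hfc : Continuous f := continuous_iff_continuousAt.2 fun t => (hf t).continuousAt
  have hgc : Continuous g := continuous_iff_continuousAt.2 fun t => (hg t).continuousAt
  have := intervalIntegral.integral_eq_sub_of_hasDerivAt (a := -π) (b := π)
    (fun t _ => (hf t).inner ℝ (hg t)) cf2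
  rw [ii_add cf2 cf2, hpf, hpg] at this
  linarith

/-- Circle lemma in Cartesian frame. -/
theorem circ_AB (A A' B B' : ℝ → E3) (a b : E3) (hA : ∀ t, HasDerivAt A (A' t) t) (hA' : Continuous A')
    (hB : ∀ t, HasDerivAt B (B' t) t) (hB' : Continuous B')
    (hpA : A π = A (-π)) (hpB : B π = B (-π))
    (ha : iT A t = (2*π) • a) (hb : iT B t = (2*π) • b) :
    (iT (inner ℝ (A t) (B' t) - inner ℝ (B t) (A' t)))
      + 1/2 * (iT (‖A' t + B t - b‖^2 + ‖B' t - A t + a‖^2))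
     ≤ iT (‖A' t‖^2 + ‖B' t‖^2) := by
  have hAc : Continuous A := continuous_iff_continuousAt.2 fun t => (hA t).continuousAt
  have hBc : Continuous B := continuous_iff_continuousAt.2 fun t => (hB t).continuousAt
  have w1 := wirt (fun t => A t - a) A' (fun t => (hA t).sub_const a) hA' (by simp [hpA]) (by
    rw [ii_sub (ii_cont hAc) (ii_cont continuous_const), ha]
    simp; rw [← sub_smul]; ring_nf; simp)
  have w2 := wirt (fun t => B t - b) B' (fun t => (hB t).sub_const b) hB' (by simp [hpB]) (by
    rw [ii_sub (ii_cont hBc) (ii_cont continuous_const), hb]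
    simp; rw [← sub_smul]; ring_nf; simp)
  have p1 := int_inner_parts (fun t => A t - a) A' (fun t => B t - b) B' (fun t => (hA t).sub_const a) hA'
    (fun t => (hB t).sub_const b) hB' (by simp [hpA]) (by simp [hpB])
  have p2 : iT inner ℝ a (B' t) = 0 := by
    have := int_inner_parts (fun t => a) (fun _ => 0) B B' (fun t => hasDerivAt_const _ _) continuous_const
      hB hB' (by simp) hpB
    simpa using this
  have p3 : iT inner ℝ b (A' t) = 0 := by
    have := int_inner_parts (fun t => b) (fun _ => 0) A A' (fun t => hasDerivAt_const _ _) continuous_const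
      hA hA' (by simp) hpA
    simpa using this
  have key : ∀ t, ‖A' t + B t - b‖^2 + ‖B' t - A t + a‖^2 =
      ‖A' t‖^2 + ‖B' t‖^2 + ‖A t - a‖^2 + ‖B t - b‖^2 + 2 * inner ℝ (A' t) (B t - b)
       - 2 * inner ℝ (A t - a) (B' t) := by
    intro t
    rw [show A' t + B t - b = A' t + (B t - b) by abel, show B' t - A t + a = B' t - (A t - a) by abel,
      norm_add_sq_real, norm_sub_sq_real (B' t) (A t - a), real_inner_comm (A t - a) (B' t)]
    ring
  have k2 : ∀ t, inner ℝ (A t) (B' t) - inner ℝ (B t) (A' t) =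
     inner ℝ (A t - a) (B' t) - inner ℝ (A' t) (B t - b) + inner ℝ a (B' t) - inner ℝ b (A' t) := by
    intro t
    rw [inner_sub_left, inner_sub_right, real_inner_comm (B t) (A' t), real_inner_comm b (A' t)]; ring
  simp only [key, k2]
  have c1 : ∀ {f : ℝ → ℝ}, Continuous f → IntervalIntegrable f volume (-π) π := fun h => ii_cont h
  rw [ii_sub c1f c1f,
    ii_add c1f c1f,
    ii_sub c1f c1f,
    ii_sub c1f c1f,
    ii_add c1f c1f,
    ii_add c1f c1f,
    ii_add c1f c1f,
    ii_add c1f c1f, p2, p3]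
  simp only [ii_cm]
  linarith

theorem rot_norm (c s : ℝ) (h : c^2 + s^2 = 1) (X Y : E3) :
    ‖c • X - s • Y‖^2 + ‖s • X + c • Y‖^2 = ‖X‖^2 + ‖Y‖^2 := by
  simp only [nsq3, ← Finset.sum_add_distrib]
  refine Finset.sum_congr rfl fun i _ => ?_
  simp
  linear_combination ((X i)^2 + (Y i)^2) * h

theorem rot_inner (c s : ℝ) (h : c^2 + s^2 = 1) (e q U W : E3) :
    inner ℝ (c • e - s • q) (s • U + c • W) - inner ℝ (s • e + c • q) (c • U - s • W)
     = inner ℝ e W - inner ℝ q U := by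
  simp only [inner_sub_left, inner_add_left, inner_add_right, inner_sub_right, real_inner_smul_left,
    real_inner_smul_right]
  linear_combination (inner ℝ e W - inner ℝ q U) * h

/-- Circle lemma in the polar frame. -/
theorem circ_eq (e e' q q' : ℝ → E3) (a b m : E3) (he : ∀ t, HasDerivAt e (e' t) t) (he' : Continuous e')
    (hq : ∀ t, HasDerivAt q (q' t) t) (hq' : Continuous q')
    (hpe : e π = e (-π)) (hpq : q π = q (-π))
    (ha : iT (cos t • e t - sin t • q t) = (2*π) • a)
    (hb : iT (sin t • e t + cos t • q t) = (2*π) • b)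
    (hm : iT e t = (2*π) • m) (hq0 : iT q t = 0) :
    (iT (‖e t‖^2 - ‖q t‖^2 - 2 * inner ℝ (q t) (e' t - q t)))
      + 1/2 * (iT (‖e' t + sin t • a - cos t • b‖^2 + ‖q' t + cos t • a + sin t • b‖^2))
     ≤ (iT (‖e' t - q t‖^2 + ‖q' t + e t‖^2)) ∧
    (iT (‖e t - m - cos t • a - sin t • b‖^2 + ‖q t + sin t • a - cos t • b‖^2)) ≤
     iT (‖e' t + sin t • a - cos t • b‖^2 + ‖q' t + cos t • a + sin t • b‖^2) := by
  have hec : Continuous e := continuous_iff_continuousAt.2 fun t => (he t).continuousAt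
  have hqc : Continuous q := continuous_iff_continuousAt.2 fun t => (hq t).continuousAt
  have c1 : ∀ {f : ℝ → ℝ}, Continuous f → IntervalIntegrable f volume (-π) π := fun h => ii_cont h
  have c3 : ∀ {f : ℝ → E3}, Continuous f → IntervalIntegrable f volume (-π) π := fun h => ii_cont h
  have hcs : ∀ t : ℝ, cos t ^2 + sin t ^2 = 1 := fun t => by rw [add_comm]; exact sin_sq_add_cos_sq t
  constructor
  · have M := circ_AB (fun t => cos t • e t - sin t • q t)
      (fun t => cos t • (e' t - q t) - sin t • (q' t + e t))
      (fun t => sin t • e t + cos t • q t)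
      (fun t => sin t • (e' t - q t) + cos t • (q' t + e t)) a b
      (fun t => by
        exact HasDerivAt.congr_deriv (((hasDerivAt_cos t).smul (he t)).sub ((hasDerivAt_sin t).smul (hq t))) (by module)) fp
      (fun t => by
        exact HasDerivAt.congr_deriv (((hasDerivAt_sin t).smul (he t)).add ((hasDerivAt_cos t).smul (hq t))) (by module)) fp (by simp [hpe]) (by simp [hpq]) ha hb
    have i1 : ∀ t, ‖cos t • (e' t - q t) - sin t • (q' t + e t) + (sin t • e t + cos t • q t) - b‖^2
       + ‖sin t • (e' t - q t) + cos t • (q' t + e t) - (cos t • e t - sin t • q t) + a‖^2 =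
       ‖e' t + sin t • a - cos t • b‖^2 + ‖q' t + cos t • a + sin t • b‖^2 := by
      intro t
      rw [← rot_norm (cos t) (sin t) (hcs t) (e' t + sin t • a - cos t • b) (q' t + cos t • a + sin t • b)]
      congr 3
      · ext i; simp; linear_combination (b i) * hcs t
      · ext i; simp; linear_combination -(a i) * hcs t
    simp only [i1, rot_norm _ _ (hcs _), rot_inner _ _ (hcs _)] at M
    have p := int_inner_parts e e' q q' he he' hq hq' hpe hpq
    have E1 : iT (inner ℝ (e t) (q' t + e t) - inner ℝ (q t) (e' t - q t)) =
      iT (‖e t‖^2 - ‖q t‖^2 - 2 * inner ℝ (q t) (e' t - q t)) := by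
      have k1 : ∀ t, inner ℝ (e t) (q' t + e t) - inner ℝ (q t) (e' t - q t) =
        (‖e t‖^2 - ‖q t‖^2 - 2 * inner ℝ (q t) (e' t - q t)) + (inner ℝ (e t) (q' t) + inner ℝ (e' t) (q t)) := by
        intro t
        rw [inner_add_right, inner_sub_right, ris, ris,
          real_inner_comm (q t) (e' t)]; ring
      simp only [k1]
      rw [ii_add c1f c1f,
        ii_add c1f c1f, p]
      simp
    rw [E1] at M
    exact M
  · have ic : iT cos t = 0 := by simp
    have is : iT sin t = 0 := by simp
    have iv : ∀ (f : ℝ → ℝ) (v : E3), iT f t • v = (iT f t) • v :=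
      fun f v => intervalIntegral.integral_smul_const f v
    have w1 := wirt (fun t => e t - m - cos t • a - sin t • b) (fun t => e' t + sin t • a - cos t • b)
      (fun t => by
        exact HasDerivAt.congr_deriv ((((he t).sub_const m).sub ((hasDerivAt_cos t).smul_const a)).sub ((hasDerivAt_sin t).smul_const b)) (by module)) fp (by simp [hpe]) (by
        rw [ii_sub (c3 fp) (c3 fp),
          ii_sub (c3 fp) (c3 fp),
          ii_sub (c3 fp) (c3 fp), hm, iv, iv, ic, is]
        simp; rw [← sub_smul]; ring_nf; simp)
    have w2 := wirt (fun t => q t + sin t • a - cos t • b) (fun t => q' t + cos t • a + sin t • b)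
      (fun t => by
        exact HasDerivAt.congr_deriv (((hq t).add ((hasDerivAt_sin t).smul_const a)).sub ((hasDerivAt_cos t).smul_const b)) (by module)) fp (by simp [hpq]) (by
        rw [ii_sub (c3 fp) (c3 fp),
          ii_add (c3 fp) (c3 fp), hq0, iv, iv, ic, is]
        simp)
    rw [ii_add c1f c1f,
        ii_add c1f c1f]
    linarith
end

section
/-- C¹ function of polar coordinates with given partials. -/
structure PC1 {V : Type*} [NormedAddCommGroup V] [NormedSpace ℝ V] (f fr ft : Q2 → V) : Prop where
  hr : ∀ r θ, HasDerivAt (fun s => f (s, θ)) (fr (r, θ)) r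
  ht : ∀ r θ, HasDerivAt (fun s => f (r, s)) (ft (r, θ)) θ
  c : Continuous f
  cr : Continuous fr
  ct : Continuous ft
  per : ∀ r θ, f (r, θ + 2 * π) = f (r, θ)

theorem PC1.pi {V : Type*} [NormedAddCommGroup V] [NormedSpace ℝ V] {f fr ft : Q2 → V}
    (h : PC1 f fr ft) (r : ℝ) : f (r, π) = f (r, -π) := by
  rw [← h.per r (-π)]; ring_nf

def PP (p : Q2) : E2 := !₂[p.1 * cos p.2, p.1 * sin p.2]
def ur (t : ℝ) : E2 := !₂[cos t, sin t]
def ut (t : ℝ) : E2 := !₂[-sin t, cos t]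

theorem ur_eq (t : ℝ) : ur t = cos t • e2 0 + sin t • e2 1 := by
  ext i; fin_cases i <;> simp [ur, e2]
theorem ut_eq (t : ℝ) : ut t = (-sin t) • e2 0 + cos t • e2 1 := by
  ext i; fin_cases i <;> simp [ut, e2]
theorem PP_eq (p : Q2) : PP p = p.1 • ur p.2 := by
  ext i; fin_cases i <;> simp [ur, PP]

theorem ur_deriv (t : ℝ) : HasDerivAt ur (ut t) t := by
  have : ur = fun t => cos t • e2 0 + sin t • e2 1 := funext ur_eq
  rw [this, ut_eq]
  exact ((hasDerivAt_cos t).smul_const _).add ((hasDerivAt_sin t).smul_const _)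
theorem ut_deriv (t : ℝ) : HasDerivAt ut (-ur t) t := by
  have : ut = fun t => (-sin t) • e2 0 + cos t • e2 1 := funext ut_eq
  rw [this, ur_eq]
  refine HasDerivAt.congr_deriv (((hasDerivAt_sin t).neg.smul_const _).add ((hasDerivAt_cos t).smul_const _)) (by module)

theorem ur_cont : Continuous ur := continuous_iff_continuousAt.2 fun t => (ur_deriv t).continuousAt
theorem ut_cont : Continuous ut := continuous_iff_continuousAt.2 fun t => (ut_deriv t).continuousAt
theorem PP_cont : Continuous PP := by
  have : PP = fun p => p.1 • ur p.2 := funext PP_eq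
  rw [this]; have := ur_cont; fun_prop

theorem PP_dr (r θ : ℝ) : HasDerivAt (fun s => PP (s, θ)) (ur θ) r := by
  simp only [PP_eq]
  simpa using (hasDerivAt_id r).smul_const (ur θ)
theorem PP_dt (r θ : ℝ) : HasDerivAt (fun s => PP (r, s)) (r • ut θ) θ := by
  simp only [PP_eq]
  exact (ur_deriv θ).const_smul r

theorem ur_per (t : ℝ) : ur (t + 2 * π) = ur t := by simp [ur]
theorem ut_per (t : ℝ) : ut (t + 2 * π) = ut t := by simp [ut]
theorem PP_per (r t : ℝ) : PP (r, t + 2 * π) = PP (r, t) := by simp [PP]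

theorem ur_norm (t : ℝ) : ‖ur t‖ = 1 := by
  simp [ur, EuclideanSpace.norm_eq]

theorem PP_norm {p : Q2} (hp : 0 ≤ p.1) : ‖PP p‖ = p.1 := by
  rw [PP_eq, norm_smul, ur_norm]; simp [abs_of_nonneg hp]

section fields
variable (y : YY)
def Yf (p : Q2) : E3 := y (PP p)
def ef (p : Q2) : E3 := fderiv ℝ y (PP p) (ur p.2)
def qf (p : Q2) : E3 := fderiv ℝ y (PP p) (ut p.2)
def erf (p : Q2) : E3 := fderiv ℝ (fderiv ℝ y) (PP p) (ur p.2) (ur p.2)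
def qrf (p : Q2) : E3 := fderiv ℝ (fderiv ℝ y) (PP p) (ur p.2) (ut p.2)
def kf (p : Q2) : E3 := fderiv ℝ (fderiv ℝ y) (PP p) (ut p.2) (ut p.2)
def etf (p : Q2) : E3 := qf y p + p.1 • qrf y p
def qtf (p : Q2) : E3 := p.1 • kf y p - ef y p
def zf (p : Q2) : E3 := Yf y p - p.1 • ef y p
def zrf (p : Q2) : E3 := - (p.1 • erf y p)
def ztf (p : Q2) : E3 := - (p.1^2 • qrf y p)
end fields

theorem y_d {y : YY} (hy : CDy) : Differentiable ℝ y := hy.differentiable nrm0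
theorem y_d1 {y : YY} (hy : CDy) : ContDiff ℝ 1 (fderiv ℝ y) := hy.fderiv_right nrm0
theorem y_dd {y : YY} (hy : CDy) : Differentiable ℝ (fderiv ℝ y) := (y_d1 hy).differentiable nrm0
theorem y_c2 {y : YY} (hy : CDy) : Continuous (fderiv ℝ (fderiv ℝ y)) := (y_d1 hy).continuous_fderiv nrm0
theorem y_sym {y : YY} (hy : CDy) (x u v : E2) :
    fderiv ℝ (fderiv ℝ y) x u v = fderiv ℝ (fderiv ℝ y) x v u :=
  second_derivative_symmetric (fun x => (y_d hy x).hasFDerivAt) ((y_dd hy x).hasFDerivAt) u v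

theorem cont_fields {y : YY} (hy : CDy) : Continuous (Yf y) ∧ Continuous (ef y) ∧ Continuous (qf y) ∧
    Continuous (erf y) ∧ Continuous (qrf y) ∧ Continuous (kf y) := by
  have h1 := ur_cont
  have h2 := ut_cont
  have h3 := PP_cont
  have h4 := (y_d hy).continuous
  have h5 := (y_d1 hy).continuous
  have h6 := y_c2 hy
  unfold Yf ef qf erf qrf kf
  refine ⟨by fun_prop, ?_, ?_, ?_, ?_, ?_⟩ <;>
    (try refine Continuous.clm_apply (Continuous.clm_apply ?_ ?_) ?_) <;>
    (try refine Continuous.clm_apply ?_ ?_) <;> fun_prop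

theorem Y_pc1 {y : YY} (hy : CDy) : PC1 (Yf y) (ef y) (fun p => p.1 • qf y p) where
  hr r θ := (y_d hy _).hasFDerivAt.comp_hasDerivAt r (PP_dr r θ)
  ht r θ := by
    refine ((y_d hy _).hasFDerivAt.comp_hasDerivAt θ (PP_dt r θ)).congr_deriv ?_
    simp [qf]
  c := (cont_fields hy).1
  cr := (cont_fields hy).2.1
  ct := continuous_fst.smul (cont_fields hy).2.2.1
  per r θ := by simp [Yf, PP_per]

theorem e_pc1 {y : YY} (hy : CDy) : PC1 (ef y) (erf y) (etf y) where
  hr r θ := by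
    have := (y_dd hy (PP (r,θ))).hasFDerivAt.comp_hasDerivAt r (PP_dr r θ)
    exact (this.clm_apply (hasDerivAt_const r (ur θ))).congr_deriv (by simp [erf])
  ht r θ := by
    have := (y_dd hy (PP (r,θ))).hasFDerivAt.comp_hasDerivAt θ (PP_dt r θ)
    exact (this.clm_apply (ur_deriv θ)).congr_deriv (by
      simp [etf, qrf, qf]; rw [y_sym hy _ (ut θ) (ur θ)]; abel)
  c := (cont_fields hy).2.1
  cr := (cont_fields hy).2.2.2.1
  ct := (cont_fields hy).2.2.1.add (continuous_fst.smul (cont_fields hy).2.2.2.2.1)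
  per r θ := by simp [ef, PP_per, ur_per]

theorem q_pc1 {y : YY} (hy : CDy) : PC1 (qf y) (qrf y) (qtf y) where
  hr r θ := by
    have := (y_dd hy (PP (r,θ))).hasFDerivAt.comp_hasDerivAt r (PP_dr r θ)
    exact (this.clm_apply (hasDerivAt_const r (ut θ))).congr_deriv (by simp [qrf])
  ht r θ := by
    have := (y_dd hy (PP (r,θ))).hasFDerivAt.comp_hasDerivAt θ (PP_dt r θ)
    exact (this.clm_apply (ut_deriv θ)).congr_deriv (by
      simp [qtf, kf, ef]; abel)
  c := (cont_fields hy).2.2.1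
  cr := (cont_fields hy).2.2.2.2.1
  ct := (continuous_fst.smul (cont_fields hy).2.2.2.2.2).sub (cont_fields hy).2.1
  per r θ := by simp [qf, PP_per, ut_per]

theorem z_pc1 {y : YY} (hy : CDy) : PC1 (zf y) (zrf y) (ztf y) where
  hr r θ := by
    exact (((Y_pc1 hy).hr r θ).sub ((hasDerivAt_id r).smul ((e_pc1 hy).hr r θ))).congr_deriv (by
      simp [zrf])
  ht r θ := by
    exact (((Y_pc1 hy).ht r θ).sub (((e_pc1 hy).ht r θ).const_smul r)).congr_deriv (by
      simp [ztf, etf, smul_smul, pow_two])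
  c := (Y_pc1 hy).c.sub (continuous_fst.smul (e_pc1 hy).c)
  cr := (continuous_fst.smul (e_pc1 hy).cr).neg
  ct := ((continuous_fst.pow 2).smul (q_pc1 hy).cr).neg
  per r θ := by simp only [zf, (Y_pc1 hy).per, (e_pc1 hy).per]

theorem alg3 (c s a b d : ℝ) (h : c^2+s^2=1) :
    (c^2*a+2*c*s*b+s^2*d)^2+2*(-c*s*a+(c^2-s^2)*b+c*s*d)^2+(s^2*a-2*c*s*b+c^2*d)^2 = a^2+2*b^2+d^2 := by
  linear_combination (a^2+2*b^2+d^2)*(c^2+s^2+1)*h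

theorem pd_comp {y : YY} {x : E2} (hy : DifferentiableAt ℝ y x) (i : Fin 2) (j : Fin 3) :
    pd i (fun z => y z j) x = fderiv ℝ y x (e2 i) j := by
  have := ((pr j).hasFDerivAt (x := y x)).comp x hy.hasFDerivAt
  unfold pd
  have h2 : (fun z => y z j) = (pr j) ∘ y := rfl
  rw [h2, this.fderiv]; rfl

theorem pd_pd_comp {y : YY} (hy : CDy) (x : E2) (i k : Fin 2) (j : Fin 3) :
    pd i (pd k (fun z => y z j)) x = fderiv ℝ (fderiv ℝ y) x (e2 i) (e2 k) j := by
  have : pd k (fun z => y z j) = fun x => (fun x => fderiv ℝ y x (e2 k)) x j := by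
    ext x; exact pd_comp (y_d hy x) k j
  have h2 := ((y_dd hy x).hasFDerivAt.clm_apply (hasFDerivAt_const (e2 k) x))
  rw [this, pd_comp h2.differentiableAt, h2.fderiv]
  simp

theorem hcs (t : ℝ) : cos t ^2 + sin t ^2 = 1 := cos_sq_add_sin_sq t

theorem hess_polar {y : YY} (hy : CDy) (p : Q2) :
    hessNormSq y (PP p) = ‖erf y p‖^2 + 2*‖qrf y p‖^2 + ‖kf y p‖^2 := by
  simp only [nsq3, Finset.mul_sum, ← Finset.sum_add_distrib, hessNormSq]
  refine Finset.sum_congr rfl fun i _ => ?_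
  simp only [frob2, hess, Fin.sum_univ_two, Matrix.of_apply, pd_pd_comp hy]
  simp only [erf, qrf, kf, ur_eq, ut_eq, y_sym hy (PP p) (e2 1) (e2 0)]
  have := alg3 (cos p.2) (sin p.2) (fderiv ℝ (fderiv ℝ y) (PP p) (e2 0) (e2 0) i) (fderiv ℝ (fderiv ℝ y) (PP p) (e2 0) (e2 1) i) (fderiv ℝ (fderiv ℝ y) (PP p) (e2 1) (e2 1) i) (hcs p.2)
  simp [y_sym hy (PP p) (e2 1) (e2 0)]
  linear_combination -this

/-- metric defect -/
def G2 (Δ : ℝ) (y : YY) (p : Q2) : ℝ :=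
  (‖ef y p‖^2 - 1)^2 + 2 * (inner ℝ (ef y p) (qf y p))^2 + (‖qf y p‖^2 - (1 - Δ^2))^2

theorem inn3 (v w : E3) : inner ℝ v w = ∑ i, v i * w i := by
  simp [PiLp.inner_apply, mul_comm]

theorem metric_polar {y : YY} (hy : CDy) (Δ : ℝ) (p : Q2) (hp : 0 < p.1) :
    frob2 (gmet y (PP p) - gDelta Δ (PP p)) = G2 Δ y p := by
  have hn := PP_norm hp.le
  have hd := y_d hy (PP p)
  obtain ⟨u, hu⟩ : ∃ u, u = fderiv ℝ y (PP p) (e2 0) := ⟨_, rfl⟩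
  obtain ⟨v, hv⟩ : ∃ u, u = fderiv ℝ y (PP p) (e2 1) := ⟨_, rfl⟩
  have h1 : ef y p = cos p.2 • u + sin p.2 • v := by simp [ef, ur_eq, hu, hv]
  have h2 : qf y p = -sin p.2 • u + cos p.2 • v := by simp [qf, ut_eq, hu, hv]
  have g : ∀ i j, gmet y (PP p) i j = inner ℝ (fderiv ℝ y (PP p) (e2 i)) (fderiv ℝ y (PP p) (e2 j)) := by
    intro i j
    simp [gmet, Matrix.mul_apply, Dmat, pd_comp hd, inn3]
  have hc := hcs p.2
  simp only [frob2, Fin.sum_univ_two, Matrix.sub_apply, g, ← hu, ← hv, gDelta, hn, G2, h1, h2, ← ris]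
  have a3 := alg3 (cos p.2) (sin p.2) (inner ℝ u u - 1 + Δ^2 * sin p.2^2) (inner ℝ u v - Δ^2 * (sin p.2 * cos p.2)) (inner ℝ v v - 1 + Δ^2 * cos p.2^2) hc
  simp only [inner_add_left, inner_add_right, real_inner_smul_left, real_inner_smul_right, real_inner_comm u v]
  have hp' := hp.ne'
  have t1 : Δ^2 / p.1^2 * (p.1 * sin p.2) * (p.1 * sin p.2) = Δ^2 * sin p.2 ^2 := by field_simp
  have t2 : Δ^2 / p.1^2 * (p.1 * sin p.2) * (p.1 * cos p.2) = Δ^2 * (sin p.2 * cos p.2) := by field_simp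
  have t3 : Δ^2 / p.1^2 * (p.1 * cos p.2) * (p.1 * cos p.2) = Δ^2 * cos p.2 ^2 := by field_simp
  have t4 : Δ^2 / p.1^2 * (p.1 * cos p.2) * (p.1 * sin p.2) = Δ^2 * (sin p.2 * cos p.2) := by field_simp
  generalize inner ℝ u u = a at *
  generalize inner ℝ u v = b at *
  generalize inner ℝ v v = d at *
  simp [perpVec, PP, t1, t2, t3, t4]
  generalize cos p.2 = c at *
  generalize sin p.2 = s at *
  have j1 : c * (c * a + s * b) + s * (c * b + s * d) - 1 = c^2*(a - 1 + Δ^2*s^2) + 2*c*s*(b - Δ^2*(s*c)) + s^2*(d - 1 + Δ^2*c^2) := by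
    linear_combination hc
  have j3 : s^2*a - 2*c*s*b + c^2*d - dD = s^2*(a - 1 + Δ^2*s^2) - 2*c*s*(b - Δ^2*(s*c)) + c^2*(d - 1 + Δ^2*c^2) := by
    linear_combination (1 - Δ^2*(c^2+s^2+1)) * hc
  have j2 : -c*s*a + (c^2-s^2)*b+c*s*d = -c*s*(a - 1 + Δ^2*s^2) + (c^2-s^2)*(b - Δ^2*(s*c)) + c*s*(d - 1 + Δ^2*c^2) := by
    ring
  rw [← j1, ← j2, ← j3] at a3
  linear_combination -a3
end

section
/-- polar rectangle -/
def Om (a b : ℝ) : Set (Q2) := Set.Ioo a b ×ˢ Set.Ioo (-π) π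

theorem Om_meas (a b : ℝ) : MeasurableSet (Om a b) := measurableSet_Ioo.prod measurableSet_Ioo

theorem Om_sub (a b : ℝ) : Om a b ⊆ Set.Icc a b ×ˢ Set.Icc (-π) π :=
  Set.prod_mono Set.Ioo_subset_Icc_self Set.Ioo_subset_Icc_self

theorem Om_mono {a b a' b' : ℝ} (h1 : a' ≤ a) (h2 : b ≤ b') : Om a b ⊆ Om a' b' :=
  Set.prod_mono (Set.Ioo_subset_Ioo h1 h2) le_rfl

theorem Om_fin (a b : ℝ) : volume (Om a b) < ⊤ := by
  refine lt_of_le_of_lt (measure_mono (Om_sub a b)) ?_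
  exact (isCompact_Icc.prod isCompact_Icc).measure_lt_top

instance Om_finite (a b : ℝ) : IsFiniteMeasure (volume.restrict (Om a b)) :=
  ⟨by simpa using Om_fin a b⟩

theorem cont_Om {V : Type*} [NormedAddCommGroup V] {F : Q2 → V} (hF : Continuous F) (a b : ℝ) :
    IntegrableOn F (Om a b) :=
  (hF.continuousOn.integrableOn_compact (isCompact_Icc.prod isCompact_Icc)).mono_set (Om_sub a b)

theorem Om_iter {V : Type*} [NormedAddCommGroup V] [NormedSpace ℝ V] {F : Q2 → V} (hF : Continuous F) {a b : ℝ} (hab : a ≤ b) :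
    ∫ p in Om a b, F p = ∫ r in a..b, iH F (r, θ) := by
  have hpi := Real.pi_pos
  rw [intervalIntegral.integral_of_le hab, integral_Ioc_eq_integral_Ioo]
  simp_rw [intervalIntegral.integral_of_le (show -π ≤ π by linarith), integral_Ioc_eq_integral_Ioo]
  exact setIntegral_prod _ (cont_Om hF a b)

theorem polar_int (F : E2 → ℝ) {a b : ℝ} (ha : 0 ≤ a) :
    ∫ x in ball (0 : E2) b \ ball 0 a, F x = ∫ p in Om a b, p.1 * F (PP p) := by
  have hm : MeasurableSet (ball (0 : E2) b \ ball 0 a) := measurableSet_ball.diff measurableSet_ball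
  let S := ball (0 : E2) b \ ball 0 a
  let L : (Q2) ≃ᵐ E2 := MeasurableEquiv.finTwoArrow.symm.trans (MeasurableEquiv.toLp 2 (Fin 2 → ℝ))
  have hL : MeasurePreserving L volume volume :=
    ((volume_preserving_finTwoArrow ℝ).symm).trans
     ((EuclideanSpace.volume_preserving_symm_measurableEquiv_toLp (Fin 2)).symm)
  have hLP : ∀ p, L (polarCoord.symm p) = PP p := by
    intro p
    ext i
    fin_cases i <;> simp [L, PP, polarCoord, MeasurableEquiv.finTwoArrow]
  rw [← integral_indicator hm, ← hL.integral_comp L.measurableEmbedding, ← integral_comp_polarCoord_symm]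
  simp_rw [hLP]
  have e1 : ∀ p : Q2, p ∈ polarCoord.target → p.1 • (S.indicator F (PP p)) =
      (Set.Ico a b ×ˢ (Set.univ : Set ℝ)).indicator (fun p => p.1 * F (PP p)) p := by
    intro p hp
    have hp0 : 0 < p.1 := by
      have := hp.1; simpa using this
    by_cases h : p.1 ∈ Set.Ico a b
    · have h1 : PP p ∈ S := by
        simp only [S, Set.mem_sdiff, mem_ball_zero_iff, PP_norm hp0.le, not_lt]; exact ⟨h.2, h.1⟩
      rw [Set.indicator_of_mem h1, Set.indicator_of_mem (by simpa using h)]; rfl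
    · have h1 : PP p ∉ S := by
        simp only [S, Set.mem_sdiff, mem_ball_zero_iff, PP_norm hp0.le, not_lt]; exact fun hh => h ⟨hh.2, hh.1⟩
      rw [Set.indicator_of_notMem h1, Set.indicator_of_notMem (by simpa using h)]; simp
  rw [setIntegral_congr_fun (polarCoord.open_target.measurableSet) (g := (Set.Ico a b ×ˢ (Set.univ : Set ℝ)).indicator (fun p => p.1 * F (PP p))) e1,
    setIntegral_indicator (measurableSet_Ico.prod MeasurableSet.univ)]
  refine setIntegral_congr_set ?_
  have : polarCoord.target = Set.Ioi 0 ×ˢ Set.Ioo (-π) π := rfl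
  rw [this, Set.prod_inter_prod, Set.inter_univ]
  refine Measure.set_prod_ae_eq ?_ ae_eq_rfl
  have hsub : Set.Ioo a b ⊆ Set.Ioi 0 ∩ Set.Ico a b := fun x hx => ⟨lt_of_le_of_lt ha hx.1, hx.1.le, hx.2⟩
  have hsup : Set.Ioi 0 ∩ Set.Ico a b ⊆ Set.Ico a b := Set.inter_subset_right
  exact (ae_eq_of_subset_of_measure_ge hsub ((measure_mono hsup).trans (by simp)) measurableSet_Ioo.nullMeasurableSet (by simpa using ((measure_mono hsup).trans_lt (by simp)).ne)).symm

/-- curvature density -/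
def HH (y : YY) (p : Q2) : ℝ := ‖erf y p‖^2 + 2*‖qrf y p‖^2 + ‖kf y p‖^2

theorem HH_cont {y : YY} (hy : CDy) : Continuous (HH y) := by
  obtain ⟨h1,h2,h3,h4,h5,h6⟩ := cont_fields hy
  unfold HH; fun_prop
theorem G2_cont {y : YY} (hy : CDy) (Δ : ℝ) : Continuous (G2 Δ y) := by
  obtain ⟨h1,h2,h3,h4,h5,h6⟩ := cont_fields hy
  unfold G2; fun_prop

theorem Om_pos {a b : ℝ} (ha : 0 ≤ a) {p : Q2} (hp : p ∈ Om a b) : 0 < p.1 := lt_of_le_of_lt ha hp.1.1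

theorem energy_polar {y : YY} (hy : CDy) (h Δ : ℝ) :
    energy h Δ y = iR iH (r * (G2 Δ y (r,θ) + h^2 * HH y (r,θ))) := by
  have : energy h Δ y = ∫ x in ball (0 : E2) 1 \ ball 0 0, (frob2 (gmet y x - gDelta Δ x) + h ^ 2 * hessNormSq y x) := by
    simp [energy]
  rw [this, polar_int _ le_rfl]
  have h1 := HH_cont hy
  have h2 := G2_cont hy Δ
  rw [← Om_iter (F := fun p => p.1 * (G2 Δ y p + h^2 * HH y p)) fp zero_le_one]
  refine setIntegral_congr_fun oM fun p hp => ?_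
  rw [metric_polar hy _ _ (Om_pos le_rfl hp), hess_polar hy]; rfl

theorem hess_int_polar {y : YY} (hy : CDy) {ρ : ℝ} (h0 : 0 ≤ ρ) :
    ∫ x in ball (0 : E2) 1 \ ball 0 ρ, hessNormSq y x = ∫ p in Om ρ 1, p.1 * HH y p := by
  rw [polar_int _ h0]
  refine setIntegral_congr_fun oM fun p hp => ?_
  rw [hess_polar hy]; rfl

/- rigid motions -/
section rigid
variable {y : YY} (hy : CDy) (R : E3 ≃ₗᵢ[ℝ] E3) (b : E3)
def Ry (y : YY) (R : E3 ≃ₗᵢ[ℝ] E3) (b : E3) : YY := fun z => R (y z) + b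
include hy
theorem Ry_cd : ContDiff ℝ 2 (Ry y R b) := by
  unfold Ry
  exact (R.toContinuousLinearEquiv.contDiff.comp hy).add contDiff_const
theorem Ry_fd : fderiv ℝ (Ry y R b) = fun x => RE ∘L fderiv ℝ y x := by
  ext1 x
  have h := (((R.toContinuousLinearEquiv : E3 →L[ℝ] E3).hasFDerivAt (x := y x)).comp x (y_d hy x).hasFDerivAt).add_const b
  exact h.fderiv
theorem Ry_fd2 (x u v : E2) : fderiv ℝ (fderiv ℝ (Ry y R b)) x u v = R (fderiv ℝ (fderiv ℝ y) x u v) := by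
  rw [Ry_fd hy]
  have h := ((ContinuousLinearMap.compL ℝ E2 E3 E3 RE).hasFDerivAt (x := fderiv ℝ y x)).comp x (y_dd hy x).hasFDerivAt
  have h2 : fderiv ℝ (fun x => RE ∘L fderiv ℝ y x) x = _ := h.fderiv
  rw [h2]; rfl
theorem Ry_e (p : Q2) : ef (Ry y R b) p = R (ef y p) := by
  unfold ef; rw [Ry_fd hy]; rfl
theorem Ry_q (p : Q2) : qf (Ry y R b) p = R (qf y p) := by
  unfold qf; rw [Ry_fd hy]; rfl
theorem Ry_er (p : Q2) : erf (Ry y R b) p = R (erf y p) := Ry_fd2 hy R b _ _ _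
theorem Ry_qr (p : Q2) : qrf (Ry y R b) p = R (qrf y p) := Ry_fd2 hy R b _ _ _
theorem Ry_k (p : Q2) : kf (Ry y R b) p = R (kf y p) := Ry_fd2 hy R b _ _ _
theorem Ry_HH (p : Q2) : HH (Ry y R b) p = HH y p := by
  simp [HH, Ry_er hy, Ry_qr hy, Ry_k hy]
theorem Ry_G2 (Δ : ℝ) (p : Q2) : G2 Δ (Ry y R b) p = G2 Δ y p := by
  simp [G2, Ry_e hy, Ry_q hy]
end rigid

/- the cone -/
def e0 (Δ t : ℝ) : E3 := !₂[Real.sqrt dD * cos t, Real.sqrt dD * sin t, Δ]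
def q0 (Δ t : ℝ) : E3 := !₂[-Real.sqrt dD * sin t, Real.sqrt dD * cos t, 0]

theorem cone_polar (Δ : ℝ) {p : Q2} (hp : 0 ≤ p.1) : coneMap Δ (PP p) = p.1 • e0 Δ p.2 := by
  ext i
  fin_cases i
  · simp [coneMap, e0, PP]; ring
  · simp [coneMap, e0, PP]; ring
  · simp [coneMap, e0, PP_norm hp]; ring

theorem cone_diff (Δ : ℝ) {x : E2} (hx : x ≠ 0) : DifferentiableAt ℝ (coneMap Δ) x := by
  rw [differentiableAt_euclidean]
  intro i
  have h0 := differentiableAt_id (𝕜 := ℝ) (x := x) 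
  rw [differentiableAt_euclidean] at h0
  have hn : DifferentiableAt ℝ (fun x : E2 => ‖x‖) x := (contDiffAt_norm ℝ hx).differentiableAt one_ne_zero
  fin_cases i
  · exact (h0 0).const_mul _
  · exact (h0 1).const_mul _
  · exact hn.const_mul _

theorem e0_deriv (Δ t : ℝ) : HasDerivAt (e0 Δ) (q0 Δ t) t := by
  have h : e0 Δ = fun t => (Real.sqrt dD * cos t) • (EuclideanSpace.single 0 1 : E3) +
      (Real.sqrt dD * sin t) • (EuclideanSpace.single 1 1 : E3) + Δ • (EuclideanSpace.single 2 1 : E3) := by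
    ext t i; fin_cases i <;> simp [e0]
  have hs := (hasDerivAt_sin t).const_mul (Real.sqrt dD)
  have hc := (hasDerivAt_cos t).const_mul (Real.sqrt dD)
  rw [h]
  refine (((hc.smul_const _).add (hs.smul_const _)).add_const _).congr_deriv ?_
  ext i; fin_cases i <;> simp [q0]

theorem cone_e (Δ : ℝ) {p : Q2} (hp : 0 < p.1) : ef (coneMap Δ) p = e0 Δ p.2 := by
  have hx : PP p ≠ 0 := by rw [← norm_ne_zero_iff, PP_norm hp.le]; exact hp.ne'
  have h := (cone_diff Δ hx).hasFDerivAt.comp_hasDerivAt p.1 (PP_dr p.1 p.2)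
  have h2 : HasDerivAt (fun s : ℝ => s • e0 Δ p.2) (e0 Δ p.2) p.1 := by
    simpa using (hasDerivAt_id p.1).smul_const (e0 Δ p.2)
  refine h.unique (h2.congr_of_eventuallyEq ?_)
  filter_upwards [lt_mem_nhds hp] with s hs
  exact cone_polar Δ (p := (s,p.2)) hs.le

theorem cone_q (Δ : ℝ) {p : Q2} (hp : 0 < p.1) : qf (coneMap Δ) p = q0 Δ p.2 := by
  have hx : PP p ≠ 0 := by rw [← norm_ne_zero_iff, PP_norm hp.le]; exact hp.ne'
  have h := (cone_diff Δ hx).hasFDerivAt.comp_hasDerivAt p.2 (PP_dt p.1 p.2)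
  have h2 := (e0_deriv Δ p.2).const_smul p.1
  have := h.unique (h2.congr_of_eventuallyEq (Eventually.of_forall fun s => cone_polar Δ (p := (p.1,s)) hp.le))
  rw [map_smul] at this
  exact smul_right_injective _ hp.ne' this

theorem Dmat_polar {y w : YY} (p : Q2) (hy : DifferentiableAt ℝ y (PP p)) (hw : DifferentiableAt ℝ w (PP p)) :
    frob2 (Dmat y (PP p) - Dmat w (PP p)) = ‖ef y p - ef w p‖^2 + ‖qf y p - qf w p‖^2 := by
  simp only [nsq3, ← Finset.sum_add_distrib, frob2, Fin.sum_univ_two]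
  refine Finset.sum_congr rfl fun i _ => ?_
  simp [Dmat, pd_comp hy, pd_comp hw, ef, qf, ur_eq, ut_eq]
  linear_combination -(((fderiv ℝ y (PP p) (e2 0) i - fderiv ℝ w (PP p) (e2 0) i)^2 + (fderiv ℝ y (PP p) (e2 1) i - fderiv ℝ w (PP p) (e2 1) i)^2)) * hcs p.2

theorem D_int_polar {y : YY} (hy : CDy) (Δ : ℝ) {ρ : ℝ} (h0 : 0 ≤ ρ) :
    ∫ x in ball (0 : E2) 1 \ ball 0 ρ, frob2 (Dmat y x - Dmat (coneMap Δ) x) =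
     ∫ p in Om ρ 1, p.1 * (‖ef y p - e0 Δ p.2‖^2 + ‖qf y p - q0 Δ p.2‖^2) := by
  rw [polar_int _ h0]
  refine setIntegral_congr_fun oM fun p hp => ?_
  have hp := Om_pos h0 hp
  have hx : PP p ≠ 0 := by rw [← norm_ne_zero_iff, PP_norm hp.le]; exact hp.ne'
  rw [Dmat_polar p (y_d hy _) (cone_diff Δ hx), cone_e Δ hp, cone_q Δ hp]

theorem y_int_polar (y : YY) (Δ : ℝ) {ρ : ℝ} (h0 : 0 ≤ ρ) :
    ∫ x in ball (0 : E2) 1 \ ball 0 ρ, ‖y x - coneMap Δ x‖^2 =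
     ∫ p in Om ρ 1, p.1 * ‖Yf y p - p.1 • e0 Δ p.2‖^2 := by
  rw [polar_int _ h0]
  refine setIntegral_congr_fun oM fun p hp => ?_
  rw [cone_polar Δ (Om_pos h0 hp).le]; rfl
end

section
/-- circle integral -/
def JJ {V : Type*} [NormedAddCommGroup V] [NormedSpace ℝ V] (F : Q2 → V) (r : ℝ) : V :=
  iH F (r, θ)

theorem J_cont {V : Type*} [NormedAddCommGroup V] [NormedSpace ℝ V] {F : Q2 → V} (hF : Continuous F) :
    Continuous (JJ F) := by
  unfold JJ
  exact intervalIntegral.continuous_parametric_intervalIntegral_of_continuous (f := fun r θ => F (r, θ)) (by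
    exact hF) continuous_const

theorem J_deriv {V : Type*} [NormedAddCommGroup V] [NormedSpace ℝ V] [CompleteSpace V] {F Fr : Q2 → V} (hF : Continuous F)
    (hFr : Continuous Fr) (hd : ∀ r θ, HasDerivAt (fun s => F (s, θ)) (Fr (r, θ)) r) (r : ℝ) :
    HasDerivAt (JJ F) (JJ Fr r) r := by
  obtain ⟨C, hC⟩ := ((isCompact_Icc (a := r-1) (b := r+1)).prod (isCompact_Icc (a := -π) (b := π))).exists_bound_of_continuousOn hFr.continuousOn
  have hpi := Real.pi_pos
  refine (intervalIntegral.hasDerivAt_integral_of_dominated_loc_of_deriv_le (F := fun r θ => F (r,θ)) (F' := fun r θ => Fr (r, θ)) (bound := fun _ => C)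
    (s := Set.Icc (r-1) (r+1)) (Icc_mem_nhds la la) ?_ ?_ ?_ ?_ ?_ ?_).2
  · exact Eventually.of_forall fun x => (by fun_prop : Continuous fun θ => F (x,θ)).aestronglyMeasurable
  · exact ii_cont fp
  · exact (by fun_prop : Continuous fun θ => Fr (r,θ)).aestronglyMeasurable
  · refine Eventually.of_forall fun t ht x hx => hC (x,t) ⟨hx, ?_⟩
    rw [Set.uIoc_of_le la] at ht
    exact ⟨ht.1.le, ht.2⟩
  · exact ii_cont continuous_const
  · exact Eventually.of_forall fun t ht x hx => hd x t

theorem J_mono {F G : Fs} (hF : Continuous F) (hG : Continuous G) (r : ℝ) (h : ∀ θ, F (r,θ) ≤ G (r,θ)) :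
    JJ F r ≤ JJ G r := by
  have hpi := Real.pi_pos
  exact intervalIntegral.integral_mono_on la cf2 cf2 fun t _ => h t

theorem J_add {V : Type*} [NormedAddCommGroup V] [NormedSpace ℝ V] {F G : Q2 → V} (hF : Continuous F) (hG : Continuous G) (r : ℝ) :
    JJ (fun p => F p + G p) r = JJ F r + JJ G r :=
  ii_add cf2 cf2
theorem J_sub {V : Type*} [NormedAddCommGroup V] [NormedSpace ℝ V] {F G : Q2 → V} (hF : Continuous F) (hG : Continuous G) (r : ℝ) :
    JJ (fun p => F p - G p) r = JJ F r - JJ G r :=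
  ii_sub cf2 cf2
theorem J_mul (w : ℝ → ℝ) (F : Fs) (r : ℝ) : JJ (fun p => w p.1 * F p) r = w r * JJ F r := by
  simp [JJ]
theorem J_const {V : Type*} [NormedAddCommGroup V] [NormedSpace ℝ V] [CompleteSpace V] (v : V) (r : ℝ) :
    JJ (fun _ => v) r = (2*π) • v := by
  simp [JJ]; ring_nf
theorem J_nonneg {F : Fs} (r : ℝ) (h : ∀ θ, 0 ≤ F (r,θ)) : 0 ≤ JJ F r :=
  ii_nn (by linarith [Real.pi_pos]) fun t _ => h t

/-- cutoff function -/
def fh (h r : ℝ) : ℝ := r / rh - r / h1s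
def fh' (h r : ℝ) : ℝ := (h^2-r^2) / rh^2 - 1 / h1s

theorem fh_deriv {h : ℝ} (hh : 0 < h) (r : ℝ) : HasDerivAt (fh h) (fh' h r) r := by
  have h1 : r^2+h^2 ≠ 0 := by positivity
  have := ((hasDerivAt_id r).div (((hasDerivAt_id r).pow 2).add_const (h^2)) h1).sub ((hasDerivAt_id r).div_const h1s)
  refine this.congr_deriv ?_
  simp [fh']; ring
theorem fh_cont {h : ℝ} (hh : 0 < h) : Continuous (fh h) :=
  continuous_iff_continuousAt.2 fun t => (fh_deriv hh t).continuousAt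
theorem fh'_cont {h : ℝ} (hh : 0 < h) : Continuous (fh' h) := by
  unfold fh'
  have : ∀ r : ℝ, rh^2 ≠ 0 := fun r => by positivity
  exact (Continuous.div fp fp this).sub continuous_const
theorem fh_nonneg {h r : ℝ} (hh : 0 < h) (h0 : 0 ≤ r) (h1 : r ≤ 1) : 0 ≤ fh h r := by
  unfold fh
  rw [sub_nonneg]
  gcongr; nlinarith
theorem fh_le {h r : ℝ} (hh : 0 < h) (h0 : 0 ≤ r) : fh h r ≤ r / rh := by
  unfold fh; have : 0 ≤ r / h1s := by positivity
  linarith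
theorem fh_one {h r : ℝ} (hh : 0 < h) (h0 : 0 ≤ r) (h1 : r ≤ 1) : r^2 ≤ 1 - r * fh h r := by
  have hk : 1 - r * fh h r = h^2/rh + r^2/h1s := by unfold fh; field_simp; ring
  rw [hk]
  have h3 : h^2/h1s ≤ h^2/rh := by gcongr; nlinarith
  have h4 : r^2 ≤ h^2/h1s + r^2/h1s := by
    rw [← add_div, le_div_iff₀ pv]; nlinarith [sq_nonneg h, mul_nonneg (sq_nonneg h) (show 0 ≤ 1 - r^2 by nlinarith)]
  linarith
theorem fh_low {h r : ℝ} (hh : 0 < h) (hr : h ≤ r) (h1 : r ≤ 1) : (1-r^2)/(4*r) ≤ fh h r := by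
  have hr0 : 0 < r := by linarith
  have hk : fh h r = r*(1-r^2)/(rh*h1s) := by unfold fh; field_simp; ring
  have h5 : (1-r^2)/(4*r) = r*(1-r^2)/((2*r^2)*2) := by field_simp; ring
  rw [hk, h5]
  have : 0 ≤ 1 - r^2 := by nlinarith
  gcongr <;> nlinarith
theorem fh'_bd {h r : ℝ} (hh : 0 < h) (h0 : 0 ≤ r) (h1 : r ≤ 1) : |r * fh' h r| ≤ 2*r/rh := by
  rw [abs_mul, abs_of_nonneg h0]
  have a1 : |fh' h r| ≤ 1/rh + 1/h1s := by
    unfold fh'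
    refine (abs_sub _ _).trans (add_le_add ?_ (le_of_eq (abs_of_nonneg pv)))
    rw [abs_div, abs_of_nonneg (by positivity : 0 ≤ rh^2), div_le_div_iff₀ pv pv]
    have : |h^2-r^2| ≤ r^2+h^2 := by rw [abs_le]; constructor <;> nlinarith
    nlinarith [sq_nonneg r, sq_nonneg h]
  have a2 : 1/h1s ≤ 1/rh := by gcongr; nlinarith
  calc r * |fh' h r| ≤ r * (1/rh + 1/rh) := by gcongr; linarith
    _ = _ := by ring
theorem fh_int {h : ℝ} (hh : 0 < h) : Real.log (1/h) - 1/2 ≤ iR fh h r := by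
  have hd : ∀ r ∈ Set.uIcc zR 1, HasDerivAt (fun r => Real.log rh/2 - r^2/(2*h1s)) (fh h r) r := by
    intro r _
    have h1 : r^2+h^2 ≠ 0 := by positivity
    have := (((((hasDerivAt_id r).pow 2).add_const (h^2)).log h1).div_const 2).sub (((hasDerivAt_id r).pow 2).div_const (2*h1s))
    refine this.congr_deriv ?_
    simp [fh]; field_simp
  rw [ii_ftc hd (ii_cont (fh_cont hh))]
  have l1 : Real.log (1/h) = -Real.log h := by rw [one_div, Real.log_inv]
  have l2 : Real.log (h^2) = 2*Real.log h := by rw [Real.log_pow]; norm_num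
  have l3 : 0 ≤ Real.log h1s := Real.log_nonneg (by nlinarith)
  have l4 : 1/(2*h1s) ≤ 1/2 := by
    rw [div_le_div_iff₀ pv nrm0]; nlinarith
  norm_num [l1, l2]
  norm_num at l4
  linarith
theorem kk_int {h : ℝ} (hh : 0 < h) : iR r * (h^2/rh^2) ≤ 1/2 := by
  have hd : ∀ r ∈ Set.uIcc zR 1, HasDerivAt (fun r => -(h^2/2) * rh⁻¹) (r * (h^2/rh^2)) r := by
    intro r _
    have h1 : r^2+h^2 ≠ 0 := by positivity
    have := ((((hasDerivAt_id r).pow 2).add_const (h^2)).inv h1).const_mul (-(h^2/2))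
    refine this.congr_deriv ?_
    simp; field_simp
  have hc : Continuous fun r : ℝ => r * (h^2/rh^2) := by
    have : ∀ r : ℝ, rh^2 ≠ 0 := fun r => by positivity
    exact continuous_id.mul (Continuous.div fp fp this)
  rw [ii_ftc hd (ii_cont hc)]
  have : 0 ≤ h^2/2 * h1s⁻¹ := by positivity
  have h0 : h^2/2*(h^2)⁻¹ = 1/2 := by field_simp
  norm_num
  norm_num at h0 this
  linarith
end

section
/-- circle means of the Cartesian frame -/
def Am (e q : Fe) (r : ℝ) : E3 := (2*π)⁻¹ • JJ (fun p => cos p.2 • e p - sin p.2 • q p) r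
def Bm (e q : Fe) (r : ℝ) : E3 := (2*π)⁻¹ • JJ (fun p => sin p.2 • e p + cos p.2 • q p) r
def Em (e : Fe) (r : ℝ) : E3 := (2*π)⁻¹ • JJ e r
/-- ε² density -/
def eps (e q et qt : Fe) (p : Q2) : ℝ :=
  ‖et p + sin p.2 • Am e q p.1 - cos p.2 • Bm e q p.1‖^2 + ‖qt p + cos p.2 • Am e q p.1 + sin p.2 • Bm e q p.1‖^2
def dl0 (e q : Fe) (p : Q2) : ℝ :=
  ‖e p - Em e p.1 - cos p.2 • Am e q p.1 - sin p.2 • Bm e q p.1‖^2 + ‖q p + sin p.2 • Am e q p.1 - cos p.2 • Bm e q p.1‖^2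

theorem Am_cont {e q : Fe} (he : Continuous e) (hq : Continuous q) : Continuous (Am e q) := by
  unfold Am; exact (J_cont (F := fun p => cos p.2 • e p - sin p.2 • q p) fp).const_smul ((2*π)⁻¹ : ℝ)
theorem Bm_cont {e q : Fe} (he : Continuous e) (hq : Continuous q) : Continuous (Bm e q) := by
  unfold Bm; exact (J_cont (F := fun p => sin p.2 • e p + cos p.2 • q p) fp).const_smul ((2*π)⁻¹ : ℝ)
theorem Em_cont {e : Fe} (he : Continuous e) : Continuous (Em e) := by
  unfold Em; exact (J_cont he).const_smul ((2*π)⁻¹ : ℝ)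
theorem eps_cont {e q et qt : Fe} (he : Continuous e) (hq : Continuous q) (het : Continuous et) (hqt : Continuous qt) :
    Continuous (eps e q et qt) := by
  have h1 := Am_cont he hq
  have h2 := Bm_cont he hq
  unfold eps; fun_prop
theorem dl0_cont {e q : Fe} (he : Continuous e) (hq : Continuous q) :
    Continuous (dl0 e q) := by
  have h1 := Am_cont he hq
  have h2 := Bm_cont he hq
  have h3 := Em_cont he
  unfold dl0; fun_prop

theorem J_zero_of_theta {f fr ft : Fe} (h : PC1 f fr ft) (r : ℝ) : JJ ft r = 0 := by
  have := intervalIntegral.integral_eq_sub_of_hasDerivAt (a := -π) (b := π) (fun t _ => h.ht r t)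
    (ii_cont (by have := h.ct; fun_prop))
  unfold JJ; rw [this, h.pi r]; simp

theorem Jq_zero {y : YY} (hy : CDy) (r : ℝ) : JJ (qf y) r = 0 := by
  have hne : ∀ r, r ≠ 0 → JJ (qf y) r = 0 := by
    intro r hr
    have := J_zero_of_theta (Y_pc1 hy) r
    unfold JJ at this
    rw [intervalIntegral.integral_smul] at this
    exact (smul_eq_zero.1 this).resolve_left hr
  have hc := J_cont (cont_fields hy).2.2.1
  have h2 : JJ (qf y) = fun _ => 0 := by
    refine Continuous.ext_on (s := {0}ᶜ) (dense_compl_singleton 0) hc continuous_const fun x hx => hne x hx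
  rw [h2]

theorem two_pi_smul (v : E3) : (2*π) • ((2*π)⁻¹ • v) = v := by
  rw [smul_smul, mul_inv_cancel₀ pv, one_smul]

theorem circ_y {y : YY} (hy : CDy) (r : ℝ) :
    JJ (fun p => ‖ef y p‖^2) r - JJ (fun p => ‖qf y p‖^2) r - r * JJ (fun p => 2 * inner ℝ (qf y p) (qrf y p)) r
      + 1/2 * JJ epY r ≤ r^2 * JJ qK r ∧
    JJ (dl0 (ef y) (qf y)) r ≤ JJ epY r := by
  obtain ⟨h1,h2,h3,h4,h5,h6⟩ := cont_fields hy
  have E := e_pc1 hy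
  have Q := q_pc1 hy
  have ct := E.ct
  have cq := Q.ct
  have := circ_eq (fun t => ef y (r,t)) (fun t => etf y (r,t)) (fun t => qf y (r,t)) (fun t => qtf y (r,t))
    (Am (ef y) (qf y) r) (Bm (ef y) (qf y) r) (Em (ef y) r) (E.ht r) fp (Q.ht r) fp (E.pi r) (Q.pi r)
    (by unfold Am; rw [two_pi_smul]; rfl) (by unfold Bm; rw [two_pi_smul]; rfl) (by unfold Em; rw [two_pi_smul]; rfl) (Jq_zero hy r)
  refine ⟨?_, this.2⟩
  have t1 := this.1
  have s1 : iT (‖ef y (r,t)‖^2 - ‖qf y (r,t)‖^2 - 2 * inner ℝ (qf y (r,t)) (etf y (r,t) - qf y (r,t))) =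
     JJ (fun p => ‖ef y p‖^2) r - JJ (fun p => ‖qf y p‖^2) r - r * JJ (fun p => 2 * inner ℝ (qf y p) (qrf y p)) r := by
    rw [← J_mul (fun r => r), ← J_sub fp fp, ← J_sub fp fp]
    unfold JJ
    congr 1; ext t
    simp [etf, real_inner_smul_right]; ring
  have s2 : iT (‖etf y (r,t) - qf y (r,t)‖^2 + ‖qtf y (r,t) + ef y (r,t)‖^2) = r^2 * JJ qK r := by
    rw [← J_mul (fun r => r^2)]
    unfold JJ
    congr 1; ext t
    simp [etf, qtf, norm_smul, mul_pow]; ring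
  rw [s1, s2] at t1
  exact t1

theorem fa_parts {b b' : ℝ → ℝ} (hb : ∀ r, HasDerivAt b (b' r) r) (hb' : Continuous b') {h : ℝ} (hh : 0 < h) :
    iR (fh' h r * r * b r + fh h r * b r + fh h r * r * b' r) = 0 := by
  have hbc : Continuous b := continuous_iff_continuousAt.2 fun t => (hb t).continuousAt
  have := fh_cont hh
  have := fh'_cont hh
  rw [intervalIntegral.integral_eq_sub_of_hasDerivAt (f := fun r => fh h r * r * b r) (fun r _ => by
    exact (((fh_deriv hh r).mul (hasDerivAt_id r)).mul (hb r)).congr_deriv (by simp; ring)) cf2]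
  simp [fh]

/-- the basic constant -/
def CC (Δ C₂ : ℝ) : ℝ := 5 * π + 2 * π * Δ^2 * (C₂ + 1/2)

theorem ii_mono {f g : ℝ → ℝ} (hf : Continuous f) (hg : Continuous g) {a b : ℝ} (hab : a ≤ b) (h : ∀ r, a ≤ r → r ≤ b → f r ≤ g r) :
    ∫ r in a..b, f r ≤ ∫ r in a..b, g r :=
  intervalIntegral.integral_mono_on hab (ii_cont hf) (ii_cont hg) fun t ht => h t ht.1 ht.2

theorem young1 {h r x : ℝ} (hh : 0 < h) (h0 : 0 ≤ r) (s : ℝ) (f : ℝ) (hf : |f| ≤ s * r / rh) :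
    -(r * (x^2/hh4 + s^2 * (h^2/rh^2))) ≤ f * x := by
  have a1 : |f * x| ≤ s * r/rh * |x| := by rw [abs_mul]; gcongr
  have a2 : s * r/rh * |x| ≤ r * (x^2/hh4 + s^2*(h^2/rh^2)) := by
    have : 0 ≤ r * (|x|/(2*h) - s * (h/rh))^2 := by positivity
    have e : r * (|x|/(2*h) - s * (h/rh))^2 = r * (|x|^2/hh4 + s^2*(h^2/rh^2)) - s * r/rh*|x| := by
      field_simp; ring
    rw [e, sq_abs] at this
    linarith
  linarith [neg_abs_le (f*x)]

theorem energy_bd {y : YY} (hy : CDy) {h Δ C₂ : ℝ} (hh : 0 < h)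
    (hb : energy h Δ y ≤ 2 * π * Δ ^ 2 * h ^ 2 * (Real.log (1 / h) + C₂)) :
    3/hh4 * (iR r * JJ (G2 Δ y) r) + (iR r * JJ eQ r)
    + (iR r^3 * JJ qK r)
    + 1/2 * (iR fh h r * JJ epY r) ≤ CC Δ C₂ := by
  obtain ⟨h1,h2,h3,h4,h5,h6⟩ := cont_fields hy
  have c1 : ∀ {f : ℝ → ℝ}, Continuous f → IntervalIntegrable f volume 0 1 := fun h => ii_cont h
  have E := e_pc1 hy
  have Q := q_pc1 hy
  have ct := E.ct
  have cq := Q.ct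
  have hG := G2_cont hy Δ
  have heps := eps_cont h2 h3 ct cq
  have cf := fh_cont hh
  have cf' := fh'_cont hh
  rw [energy_polar hy] at hb
  obtain ⟨g, hg⟩ : ∃ g, g = JJ (G2 Δ y) := ⟨_, rfl⟩
  obtain ⟨W, hW⟩ : ∃ g, g = JJ eQ := ⟨_, rfl⟩
  obtain ⟨X, hX⟩ : ∃ g, g = JJ qK := ⟨_, rfl⟩
  obtain ⟨ep, hep⟩ : ∃ g, g = JJ epY := ⟨_, rfl⟩
  obtain ⟨a, ha⟩ : ∃ g, g = JJ (fun p => ‖ef y p‖^2) := ⟨_, rfl⟩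
  obtain ⟨b, hbb⟩ : ∃ g, g = JJ (fun p => ‖qf y p‖^2) := ⟨_, rfl⟩
  obtain ⟨b', hb'⟩ : ∃ g, g = JJ (fun p => 2 * inner ℝ (qf y p) (qrf y p)) := ⟨_, rfl⟩
  have cg : Continuous g := hg ▸ J_cont hG
  have cW : Continuous W := hW ▸ J_cont fp
  have cX : Continuous X := hX ▸ J_cont fp
  have cep : Continuous ep := hep ▸ J_cont heps
  have ca : Continuous a := ha ▸ J_cont fp
  have cb : Continuous b := hbb ▸ J_cont fp
  have cb' : Continuous b' := hb' ▸ J_cont fp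
  have db : ∀ r, HasDerivAt b (b' r) r := by
    intro r; rw [hbb, hb']
    refine J_deriv fp fp (fun r θ => ?_) r
    exact ((Q.hr r θ).norm_sq)
  have en : ∀ r, iH (r * (G2 Δ y (r,θ) + h^2 * HH y (r,θ))) = r * g r + h^2 * (r * (W r + X r)) := by
    intro r
    have cH := HH_cont hy
    have : JJ (HH y) r = W r + X r := by
      rw [hW, hX, ← J_add fp fp]; congr 1; ext p; unfold HH; ring
    rw [hg, ← this]
    have := J_mul (fun r => r) (fun p => G2 Δ y p + h^2 * HH y p) r
    rw [J_add fp fp, J_mul (fun _ => h^2)] at this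
    unfold JJ at this ⊢
    simp only at this
    rw [this]; ring
  simp only [en] at hb
  -- circle lemma
  have circ : ∀ r, a r - b r - r * b' r + 1/2 * ep r ≤ r^2 * X r := by
    intro r; rw [ha, hbb, hb', hep, hX]; exact (circ_y hy r).1
  have X0 : ∀ r, 0 ≤ X r := fun r => by rw [hX]; exact J_nonneg r fun θ => by positivity
  -- metric lower bounds
  have al : ∀ r, 0 ≤ r → r ≤ 1 → -(r * (g r /hh4)) - 10 * π * (r * (h^2/rh^2)) ≤ fh h r * (a r - 2*π) + (r * fh' h r) * (b r - 2*π*dD) := by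
    intro r r0 r1
    have e1 : fh h r * (a r - 2*π) + (r * fh' h r) * (b r - 2*π*dD) = JJ (fun p => fh h p.1 * (‖ef y p‖^2-1) + (p.1 * fh' h p.1) * (‖qf y p‖^2 - dD)) r := by
      rw [J_add fp fp, J_mul (fh h), J_mul (fun r => r * fh' h r), J_sub fp fp, J_sub fp fp, J_const, J_const, ha, hbb]
      simp
    have e2 : -(r * (g r /hh4)) - 10 * π * (r * (h^2/rh^2)) = JJ (fun p => (-(r / hh4)) * G2 Δ y p - 5 * (r * (h^2/rh^2))) r := by
      rw [J_sub fp fp, J_mul (fun _ => -(r/hh4)), J_const, hg]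
      simp; ring
    rw [e1, e2]
    refine J_mono fp fp r fun θ => ?_
    have y1 := young1 (x := ‖ef y (r,θ)‖^2-1) hh r0 1 (fh h r) (by
      rw [abs_of_nonneg (fh_nonneg hh r0 r1), one_mul]; exact fh_le hh r0)
    have y2 := young1 (x := ‖qf y (r,θ)‖^2-dD) hh r0 2 (r * fh' h r) (fh'_bd hh r0 r1)
    have y3 : 0 ≤ r / hh4 * (2 * (inner ℝ (ef y (r,θ)) (qf y (r,θ)))^2) := by positivity
    have : -(r / hh4) * G2 Δ y (r,θ) = - (r * ((‖ef y (r,θ)‖^2-1)^2/hh4)) - (r * ((‖qf y (r,θ)‖^2-dD)^2/hh4)) - r / hh4 * (2 * (inner ℝ (ef y (r,θ)) (qf y (r,θ)))^2) := by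
      unfold G2; ring
    simp only
    rw [this]
    linarith
  have hkc : Continuous fun r : ℝ => r * (h^2/rh^2) := by
    have : ∀ r : ℝ, rh^2 ≠ 0 := fun r => by positivity
    exact continuous_id.mul (Continuous.div fp fp this)
  -- pointwise lower bound of the energy
  have pw : ∀ r, 0 ≤ r → r ≤ 1 → r * W r + r^3 * X r + 1/2 * (fh h r * ep r) + 2*π*Δ^2 * fh h r
      - (fh' h r * r * b r + fh h r * b r + fh h r * r * b' r)
      + 2*π*dD * (fh' h r * r * 1 + fh h r * 1 + fh h r * r * 0)
      - (r * (g r /hh4)) - 10 * π * (r * (h^2/rh^2)) ≤ r * (W r + X r) := by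
    intro r r0 r1
    have u1 := al r r0 r1
    have u2 := mln (circ r) (fh_nonneg hh r0 r1)
    have u3 := mul_nonneg (mul_nonneg r0 (X0 r)) (sub_nonneg.2 (fh_one hh r0 r1))
    nlinarith
  have I := ii_mono fp fp (zero_le_one (α := ℝ)) pw
  have P1 := fa_parts db cb' hh
  have P2 := fa_parts (b := fun _ => 1) (b' := fun _ => 0) (fun r => hasDerivAt_const _ _) continuous_const hh
  rw [ii_sub c1f c1f,
    ii_sub c1f c1f,
    ii_add c1f c1f,
    ii_sub c1f c1f,
    ii_add c1f c1f,
    ii_add c1f c1f,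
    ii_add c1f c1f, P1,
    ii_cm (2*π*dD), P2, ii_cm (10*π), ii_cm (2*π*Δ^2), ii_cm (1/2)] at I
  rw [ii_add c1f c1f, ii_cm (h^2)] at hb
  have v1 := fh_int hh
  have v2 := kk_int hh
  have v3 : iR r * (g r /hh4) = 1/hh4 * iR r * g r := by
    rw [← ii_cm]; congr 1; ext r; ring
  rw [v3] at I
  have hb2 : 1/h^2 * (iR r * g r) + (iR r * (W r + X r)) ≤ 2*π*Δ^2 * (Real.log (1/h) + C₂) := by
    have h2 : 0 < h^2 := by positivity
    have := div_le_div_of_nonneg_right hb h2.le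
    have e1 : 2 * π * Δ ^ 2 * h ^ 2 * (Real.log (1 / h) + C₂) / h^2 = 2*π*Δ^2 * (Real.log (1/h) + C₂) := by field_simp
    rw [e1, add_div, mul_div_cancel_left₀ _ h2.ne'] at this
    rw [one_div_mul_eq_div]; exact this
  have v4 : 3/hh4 * (iR r * g r) = 1/h^2 * (iR r * g r) - 1/hh4 * (iR r * g r) := by
    field_simp; ring
  rw [← hg, ← hW, ← hX, ← hep, v4]
  have v5 := mln v1 (show 0 ≤ 2*π*Δ^2 by positivity)
  have v6 := mln v2 (show 0 ≤ 10*π by positivity)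
  unfold CC
  linarith
end

section
theorem Om_J {F : Fs} (hF : Continuous F) (w : ℝ → ℝ) (hw : Continuous w) {a b : ℝ} (hab : a ≤ b) :
    ∫ p in Om a b, w p.1 * F p = ∫ r in a..b, w r * JJ F r := by
  rw [Om_iter fp hab]
  simp [JJ]

theorem ii_swap {V : Type*} [NormedAddCommGroup V] [NormedSpace ℝ V] {F : ℝ → ℝ → V} (hF : Continuous F.uncurry) (a b c d : ℝ) :
    ∫ x in a..b, ∫ y in c..d, F x y = ∫ y in c..d, ∫ x in a..b, F x y := by
  refine intervalIntegral_intervalIntegral_swap ?_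
  refine (hF.continuousOn.integrableOn_compact (isCompact_uIcc.prod isCompact_uIcc)).mono_set
    (Set.prod_mono Set.uIoc_subset_uIcc Set.uIoc_subset_uIcc)

theorem z_bd {y : YY} (hy : CDy) (h0 : y 0 = 0) {r : ℝ} (hr : 0 ≤ r) (hr1 : r ≤ 1) :
    JJ (fun p => ‖zf y p‖^2) r ≤ r^2 * ∫ s in zR..1, s * JJ (fun p => ‖erf y p‖^2) s := by
  obtain ⟨h1,h2,h3,h4,h5,h6⟩ := cont_fields hy
  have hz := z_pc1 hy
  have hpi := Real.pi_pos
  have key : ∀ θ, ‖zf y (r,θ)‖^2 ≤ r^2 * ∫ s in zR..1, s * ‖erf y (s,θ)‖^2 := by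
    intro θ
    have c := hz.cr
    have e1 : zf y (r,θ) = ∫ s in zR..r, zrf y (s,θ) := by
      rw [ii_ftc (fun s _ => hz.hr s θ) cf2]
      have : zf y (0,θ) = 0 := by
        have : PP (0,θ) = 0 := by ext i; fin_cases i <;> simp [PP]
        simp [zf, Yf, this, h0]
      rw [this, sub_zero]
    have e2 : ‖zf y (r,θ)‖ ≤ ∫ s in zR..r, s * ‖erf y (s,θ)‖ := by
      rw [e1]
      refine (intervalIntegral.norm_integral_le_integral_norm hr).trans ?_
      refine ii_mono fp fp hr fun s hs _ => ?_
      simp [zrf, norm_smul, abs_of_nonneg hs]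
    -- Young: s a ≤ (t s + s a²/t)/2
    set I := ∫ s in zR..r, s * ‖erf y (s,θ)‖^2 with hI
    set K := ∫ s in zR..r, s * ‖erf y (s,θ)‖ with hK
    have q : ∀ t : ℝ, 0 ≤ I - 2 * t * K + t^2 * (r^2/2) := by
      intro t
      have : ∫ s in zR..r, s * (‖erf y (s,θ)‖ - t)^2 = I - 2*t*K + t^2*(r^2/2) := by
        have : ∀ s : ℝ, s * (‖erf y (s,θ)‖ - t)^2 = s * ‖erf y (s,θ)‖^2 - 2*t*(s * ‖erf y (s,θ)‖) + t^2 * s := fun s => by ring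
        simp_rw [this]
        rw [ii_add cf2 cf2, ii_sub cf2 cf2,
          ii_cm, ii_cm, integral_id]
        ring
      rw [← this]
      exact ii_nn hr fun s hs => mul_nonneg hs.1 (sq_nonneg _)
    have hI0 : 0 ≤ I := ii_nn hr fun s hs => mul_nonneg hs.1 (sq_nonneg _)
    have hIle : I ≤ ∫ s in zR..1, s * ‖erf y (s,θ)‖^2 := by
      refine intervalIntegral.integral_mono_interval le_rfl hr hr1 ?_ cf2
      exact (ae_restrict_iff' measurableSet_Ioc).2 (Eventually.of_forall fun s hs => mul_nonneg hs.1.le (sq_nonneg _))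
    have hK2 : K^2 ≤ r^2 * I := by
      rcases hr.eq_or_lt with h | h
      · have : K = 0 := by rw [hK, ← h]; simp
        rw [this, ← h]; simp
      · have := q (2*K/r^2)
        have e : I - 2 * (2*K/r^2) * K + (2*K/r^2)^2 * (r^2/2) = I - 2*K^2/r^2 := by field_simp; ring
        rw [e] at this
        have : 2*K^2/r^2 ≤ I := by linarith
        rw [div_le_iff₀ pv] at this
        nlinarith [sq_nonneg K]
    calc ‖zf y (r,θ)‖^2 ≤ K^2 := by gcongr
      _ ≤ r^2 * I := hK2
      _ ≤ _ := by gcongr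
  have hz1 := hz.c
  have := J_mono (F := fun p => ‖zf y p‖^2) (G := fun p => r^2 * ∫ s in zR..1, s * ‖erf y (s,p.2)‖^2) fp
    (continuous_const.mul (intervalIntegral.continuous_parametric_intervalIntegral_of_continuous (f := fun (p : Q2) s => s * ‖erf y (s,p.2)‖^2) fp continuous_const)) r key
  refine this.trans (le_of_eq ?_)
  unfold JJ
  simp only [ii_cm]
  congr 1
  rw [ii_swap (by unfold Function.uncurry; fun_prop)]
  simp

/-- the collected a priori bounds -/
structure Bd (Δ C h : ℝ) (y : YY) : Prop where
  g : ∫ p in Om 0 1, p.1 * G2 Δ y p ≤ C * h^2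
  d3 : ∫ p in Om 0 1, p.1^3 * (‖erf y p‖^2 + ‖qrf y p‖^2 + ‖kf y p‖^2) ≤ C
  f : ∫ p in Om 0 1, p.1^4 * (‖ef y p‖^2 + ‖qf y p‖^2 + ‖zf y p‖^2) ≤ C
  s : ∀ s, h ≤ s → 0 < s → s < 1/2 → ∫ p in Om s (1/2), (max p.1 s)⁻¹ * (eps (ef y) (qf y) (etf y) (qtf y) p + dl0 (ef y) (qf y) p
      + p.1^2 * eq2 + ‖zf y p‖^2) ≤ C

set_option maxHeartbeats 1000000 in
theorem Bd_mk (Δ C₂ : ℝ) (hC : 0 < C₂) : ∃ C, 0 < C ∧ ∀ (h : ℝ) (y : YY), 0 < h → h ≤ 1 → CDy → y 0 = 0 →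
    energy h Δ y ≤ 2 * π * Δ ^ 2 * h ^ 2 * (Real.log (1 / h) + C₂) → Bd Δ C h y := by
  have hpi := Real.pi_pos
  have hC0 : 0 < CC Δ C₂ := by unfold CC; positivity
  set D := CC Δ C₂ with hD
  refine ⟨100 * D + 10 * π, by positivity, fun h y hh h1' hy hy0 hb => ?_⟩
  obtain ⟨h1,h2,h3,h4,h5,h6⟩ := cont_fields hy
  have E := e_pc1 hy
  have Q := q_pc1 hy
  have Z := z_pc1 hy
  have ct := E.ct
  have cq := Q.ct
  have hz := Z.c
  have hG := G2_cont hy Δ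
  have heps := eps_cont h2 h3 ct cq
  have hdl := dl0_cont h2 h3
  have key := energy_bd hy hh hb
  rw [← hD] at key
  have nG : ∀ p, 0 ≤ G2 Δ y p := fun p => by unfold G2; positivity
  have neps : ∀ p, 0 ≤ eps (ef y) (qf y) (etf y) (qtf y) p := fun p => by unfold eps; positivity
  have ndl : ∀ p, 0 ≤ dl0 (ef y) (qf y) p := fun p => by unfold dl0; positivity
  have J1 : Continuous (JJ (G2 Δ y)) := J_cont hG
  have J2 : Continuous (JJ eQ) := J_cont fp
  have J2a : Continuous (JJ (fun p => ‖erf y p‖^2)) := J_cont fp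
  have J2b : Continuous (JJ (fun p => ‖qrf y p‖^2)) := J_cont fp
  have J3 : Continuous (JJ qK) := J_cont fp
  have J4 : Continuous (JJ epY) := J_cont heps
  have J5 : Continuous (JJ (dl0 (ef y) (qf y))) := J_cont hdl
  have J6 : Continuous (JJ (fun p => ‖zf y p‖^2)) := J_cont fp
  have cf := fh_cont hh
  have b1 : 0 ≤ 3/hh4 * iR r * JJ (G2 Δ y) r :=
    mul_nonneg pv (ii_nn zero_le_one fun s hs => mul_nonneg hs.1 (J_nonneg _ fun θ => nG _))
  have b2 : 0 ≤ iR r * JJ eQ r :=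
    ii_nn zero_le_one fun s hs => mul_nonneg hs.1 (J_nonneg _ fun θ => by positivity)
  have b3 : 0 ≤ iR r^3 * JJ qK r :=
    ii_nn zero_le_one fun s hs => mul_nonneg (pow_nonneg hs.1 3) (J_nonneg _ fun θ => by positivity)
  have b4 : 0 ≤ iR fh h r * JJ epY r :=
    ii_nn zero_le_one fun s hs => mul_nonneg (fh_nonneg hh hs.1 hs.2) (J_nonneg _ fun θ => neps _)
  have k1 : iR r * JJ (G2 Δ y) r ≤ 2 * D * h^2 := by
    have : 3/hh4 * (iR r * JJ (G2 Δ y) r) ≤ D := by linarith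
    have e : iR r * JJ (G2 Δ y) r = (4*h^2/3) * (3/hh4 * (iR r * JJ (G2 Δ y) r)) := by field_simp
    rw [e]
    have : (4*h^2/3) * (3/hh4 * (iR r * JJ (G2 Δ y) r)) ≤ (4*h^2/3) * D := by gcongr
    nlinarith [mul_pos (pow_pos hh 2) hC0]
  have ea : ∫ s in zR..1, s * JJ (fun p => ‖erf y p‖^2) s ≤ D := by
    refine (ii_mono fp fp zero_le_one fun r h0 _ => ?_).trans (by linarith : (iR r * JJ eQ r) ≤ D)
    exact mln (J_mono fp fp r fun θ => by nlinarith [sq_nonneg ‖qrf y (r,θ)‖]) h0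
  have zb : ∀ r, 0 ≤ r → r ≤ 1 → JJ (fun p => ‖zf y p‖^2) r ≤ r^2 * D := fun r h0 h1 =>
    (z_bd hy hy0 h0 h1).trans (by gcongr)
  have hG1 : ∫ p in Om 0 1, p.1 * G2 Δ y p ≤ 2 * D * h^2 := by rw [Om_J hG (fun r => r) fp zero_le_one]; exact k1
  refine ⟨?_, ?_, ?_, ?_⟩
  · nlinarith [pow_pos hh 2, mul_pos (pow_pos hh 2) hC0, mul_pos (pow_pos hh 2) hpi]
  · rw [Om_J (F := fun p => ‖erf y p‖^2 + ‖qrf y p‖^2 + ‖kf y p‖^2) fp (fun r => r^3) fp zero_le_one]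
    have J7 : Continuous (JJ eqk) := J_cont fp
    have : iR r^3 * JJ eqk r ≤
        iR (r * JJ (fun p => ‖erf y p‖^2) r + r^3 * JJ qK r) := by
      refine ii_mono fp fp zero_le_one fun r h0 h1 => ?_
      have e : JJ eqk r = JJ (fun p => ‖erf y p‖^2) r + JJ qK r := by
        rw [← J_add fp fp]; simp only [add_assoc]
      rw [e, mul_add]
      have : r^3 ≤ r := by simpa using pow_le_pow_of_le_one h0 h1 (show 1 ≤ 3 by norm_num)
      have := mul_le_mul_of_nonneg_right this (J_nonneg (F := fun p => ‖erf y p‖^2) r fun θ => by positivity)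
      linarith
    rw [ii_add cf2 cf2] at this
    linarith
  · rw [Om_J (F := fun p => ‖ef y p‖^2 + ‖qf y p‖^2 + ‖zf y p‖^2) fp (fun r => r^4) fp zero_le_one]
    have J7 : Continuous (JJ eqz) := J_cont fp
    have : iR r^4 * JJ eqz r ≤
        iR (r * JJ (G2 Δ y) r + (8 * π + D)) := by
      refine ii_mono fp fp zero_le_one fun r h0 h1 => ?_
      have e : JJ eqz r ≤ JJ (G2 Δ y) r + 8*π + D := by
        have e1 : JJ eqz r ≤ JJ (fun p => (G2 Δ y p + 4) + ‖zf y p‖^2) r := by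
          refine J_mono fp fp r fun θ => ?_
          unfold G2
          nlinarith [sq_nonneg (‖ef y (r,θ)‖^2 - 1 - 1), sq_nonneg (‖qf y (r,θ)‖^2 - dD - 1), sq_nonneg (inner ℝ (ef y (r,θ)) (qf y (r,θ))), sq_nonneg Δ,
            sq_nonneg (‖ef y (r,θ)‖^2 - 1), sq_nonneg (‖qf y (r,θ)‖^2 - dD)]
        rw [J_add (F := fun p => G2 Δ y p + 4) fp fp, J_add hG fp, J_const] at e1
        have := zb r h0 h1
        have : r^2 * D ≤ D := mul_le_of_le_one_left hC0.le (pow_le_one₀ h0 h1)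
        simp only [smul_eq_mul] at e1
        linarith
      have r4 : r^4 ≤ r := by simpa using pow_le_pow_of_le_one h0 h1 (show 1 ≤ 4 by norm_num)
      have r4' : r^4 ≤ 1 := pow_le_one₀ h0 h1
      have g0 : 0 ≤ JJ (G2 Δ y) r := J_nonneg r fun θ => nG _
      have := mln e (pow_nonneg h0 4)
      have := mul_le_mul_of_nonneg_right r4 g0
      have := mul_le_mul_of_nonneg_right r4' (show 0 ≤ 8*π+D by positivity)
      linarith
    rw [ii_add cf2 cf2] at this
    simp at this
    have : h^2 ≤ 1 := by nlinarith
    nlinarith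
  · intro s hs hs0 hs1
    have cm : Continuous fun r : ℝ => (max r s)⁻¹ := Continuous.inv₀ fp fun r => (lt_of_lt_of_le hs0 (le_max_right _ _)).ne'
    rw [Om_J (F := fun p => eps (ef y) (qf y) (etf y) (qtf y) p + dl0 (ef y) (qf y) p
      + p.1^2 * eq2 + ‖zf y p‖^2) fp (fun r => (max r s)⁻¹) cm la]
    have J7 : Continuous (JJ (fun p => eps (ef y) (qf y) (etf y) (qtf y) p + dl0 (ef y) (qf y) p
      + p.1^2 * eq2 + ‖zf y p‖^2)) := J_cont fp
    have m1 : ∫ r in s..(1/2), (max r s)⁻¹ * JJ (fun p => eps (ef y) (qf y) (etf y) (qtf y) p + dl0 (ef y) (qf y) p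
      + p.1^2 * eq2 + ‖zf y p‖^2) r ≤ ∫ r in s..(1/2), (12 * (fh h r * JJ epY r) + r * JJ eQ r + D) := by
      refine ii_mono fp fp hs1.le fun r h0 h1 => ?_
      have r0 : 0 < r := by linarith
      rw [max_eq_left h0, J_add fp fp, J_add fp fp, J_add heps hdl, J_mul (fun r => r^2)]
      have c1 := (circ_y hy r).2
      have c2 := zb r r0.le la
      have c3 : r⁻¹ ≤ 6 * fh h r := by
        have := fh_low hh (hs.trans h0) la
        have : r⁻¹ ≤ 6 * ((1-r^2)/(4*r)) := by
          rw [inv_eq_one_div, mul_div_assoc', div_le_div_iff₀ r0 pv]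
          nlinarith [mul_pos r0 r0]
        linarith
      have c4 : 0 ≤ JJ epY r := J_nonneg r fun θ => neps _
      have c5 := mul_le_mul_of_nonneg_right c3 c4
      have c6 := mln c1 (inv_pos.2 r0).le
      have c7 := mln c2 (inv_pos.2 r0).le
      have c8 : r⁻¹ * (r^2 * D) = r * D := by field_simp
      have c9 : r⁻¹ * (r^2 * JJ eQ r) = r * JJ eQ r := by field_simp
      have : r * D ≤ D := mul_le_of_le_one_left hC0.le la
      rw [mul_add, mul_add, mul_add, c9]
      linarith
    have m2 : ∫ r in s..(1/2), (12 * (fh h r * JJ epY r) + r * JJ eQ r + D) ≤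
       iR (12 * (fh h r * JJ epY r) + r * JJ eQ r + D) := by
      refine intervalIntegral.integral_mono_interval hs0.le hs1.le nrm0 ?_ cf2
      refine (ae_restrict_iff' measurableSet_Ioc).2 (Eventually.of_forall fun r hr => ?_)
      have u1 := mul_nonneg (fh_nonneg hh hr.1.le hr.2) (J_nonneg (F := eps (ef y) (qf y) (etf y) (qtf y)) r fun θ => neps _)
      have u2 := mul_nonneg hr.1.le (J_nonneg (F := fun p => ‖erf y p‖^2 + ‖qrf y p‖^2) r fun θ => by positivity)
      simp only [Pi.zero_apply]
      linarith
    refine (m1.trans m2).trans ?_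
    rw [ii_add cf2 cf2, ii_add cf2 cf2,
      ii_cm, intervalIntegral.integral_const, sub_zero, one_smul]
    linarith
end

section
abbrev nu : Measure (Q2) := volume.restrict (Om 0 1)

variable {α V V' : Type*} [MeasurableSpace α] [NormedAddCommGroup V] [NormedSpace ℝ V] [NormedAddCommGroup V'] [NormedSpace ℝ V']

theorem mlp2 {μ : Measure α} {f : α → V} (hf : AEStronglyMeasurable f μ) : MemLp f 2 μ ↔ Integrable (fun p => ‖f p‖^2) μ := by
  rw [← memLp_norm_iff hf, memLp_two_iff_integrable_sq hf.norm]

theorem cs_int {μ : Measure α} {f : α → V} {g : α → V'} (hf : MemLp f 2 μ) (hg : MemLp g 2 μ) :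
    (∫ p, ‖f p‖ * ‖g p‖ ∂μ)^2 ≤ (∫ p, ‖f p‖^2 ∂μ) * ∫ p, ‖g p‖^2 ∂μ := by
  have h := integral_mul_le_Lp_mul_Lq_of_nonneg (μ := μ) (p := 2) (q := 2) (f := fun p => ‖f p‖) (g := fun p => ‖g p‖)
    (by constructor <;> norm_num) (.of_forall fun _ => norm_nonneg _) (.of_forall fun _ => norm_nonneg _)
    (by simpa using hf.norm) (by simpa using hg.norm)
  have a : 0 ≤ ∫ p, ‖f p‖^2 ∂μ := integral_nonneg fun _ => by positivity
  have b : 0 ≤ ∫ p, ‖g p‖^2 ∂μ := integral_nonneg fun _ => by positivity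
  simp only [Real.rpow_two, ← Real.sqrt_eq_rpow] at h
  calc _ ≤ (√(∫ p, ‖f p‖^2 ∂μ) * √(∫ p, ‖g p‖^2 ∂μ))^2 :=
        pow_le_pow_left₀ (integral_nonneg fun _ => by positivity) h 2
    _ = _ := by rw [mul_pow, Real.sq_sqrt a, Real.sq_sqrt b]

theorem app_aesm {μ : Measure α} {Φ : α → V →L[ℝ] V'} {u : α → V} (hΦ : AEStronglyMeasurable Φ μ) (hu : AEStronglyMeasurable u μ) :
    AEStronglyMeasurable (fun p => Φ p (u p)) μ := isBoundedBilinearMap_apply.continuous.comp_aestronglyMeasurable (hΦ.prodMk hu)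

theorem app_int {μ : Measure α} {Φ : α → V →L[ℝ] V'} {u : α → V} (hΦ : MemLp Φ 2 μ) (hu : MemLp u 2 μ) :
    Integrable (fun p => Φ p (u p)) μ :=
  (hΦ.norm.integrable_mul hu.norm).mono (app_aesm hΦ.1 hu.1) (.of_forall fun p => by
    simpa using (Φ p).le_opNorm (u p))

theorem app_le {μ : Measure α} {Φ : α → V →L[ℝ] V'} {u : α → V} (hΦ : MemLp Φ 2 μ) (hu : MemLp u 2 μ) :
    ‖∫ p, Φ p (u p) ∂μ‖^2 ≤ (∫ p, ‖Φ p‖^2 ∂μ) * ∫ p, ‖u p‖^2 ∂μ := by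
  refine le_trans (pow_le_pow_left₀ no ?_ 2) (cs_int hΦ hu)
  exact norm_integral_le_of_norm_le (hΦ.norm.integrable_mul hu.norm) (.of_forall fun p => (Φ p).le_opNorm (u p))

theorem cont_mlp {f : Q2 → V} (hf : Continuous f) : MemLp f 2 nu :=
  (mlp2 hf.aestronglyMeasurable).2 cof

/-- weighted weak L² convergence on Om 0 1 -/
structure WK (v : ℕ → Q2 → V) (v0 : Q2 → V) : Prop where
  c : ∀ n, Continuous (v n)
  b : ∃ C, ∀ n, ∫ p, ‖p.1^2 • v n p‖^2 ∂nu ≤ C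
  m : MemLp (fun p => p.1^2 • v0 p) 2 nu
  w : ∀ Φ : Q2 → V →L[ℝ] ℝ, MemLp Φ 2 nu →
    Tendsto (fun n => ∫ p, Φ p (p.1^2 • v n p) ∂nu) atTop (𝓝 (∫ p, Φ p (p.1^2 • v0 p) ∂nu))

theorem WK.mn {v : ℕ → Q2 → V} {v0} (h : WK v v0) (n) : MemLp (fun p => p.1^2 • v n p) 2 nu := by
  have := h.c n
  exact cont_mlp fp

theorem WK.sub {v : ℕ → Q2 → V} {v0} (h : WK v v0) {φ : ℕ → ℕ} (hφ : StrictMono φ) : WK (fun n => v (φ n)) v0 :=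
  ⟨fun n => h.c _, h.b.imp fun _ hC n => hC _, h.m, fun Φ hΦ => (h.w Φ hΦ).comp hφ.tendsto_atTop⟩

theorem WK.add {v v' : ℕ → Q2 → V} {v0 v0'} (h : WK v v0) (h' : WK v' v0') : WK (fun n p => v n p + v' n p) (fun p => v0 p + v0' p) := by
  refine ⟨fun n => (h.c n).add (h'.c n), ?_, ?_, fun Φ hΦ => ?_⟩
  · obtain ⟨C, hC⟩ := h.b
    obtain ⟨C', hC'⟩ := h'.b
    refine ⟨2*C + 2*C', fun n => ?_⟩
    have := integral_mono (μ := nu) (f := fun p => ‖p.1^2 • (v n p + v' n p)‖^2) (g := fun p => 2 * ‖p.1^2 • v n p‖^2 + 2 * ‖p.1^2 • v' n p‖^2) ?_ ?_ fun p => ?_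
    · rw [integral_add, integral_const_mul, integral_const_mul] at this
      · linarith [hC n, hC' n]
      · exact ((mlp2 (h.mn n).1).1 (h.mn n)).const_mul _
      · exact ((mlp2 (h'.mn n).1).1 (h'.mn n)).const_mul _
    · simp_rw [smul_add]
      exact (mlp2 ((h.mn n).add (h'.mn n)).1).1 ((h.mn n).add (h'.mn n))
    · exact (((mlp2 (h.mn n).1).1 (h.mn n)).const_mul _).add (((mlp2 (h'.mn n).1).1 (h'.mn n)).const_mul _)
    · simp only [smul_add]
      have := norm_add_le (p.1^2 • v n p) (p.1^2 • v' n p)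
      nlinarith [norm_nonneg (p.1^2 • v n p + p.1^2 • v' n p), sq_nonneg (‖p.1^2 • v n p‖ - ‖p.1^2 • v' n p‖)]
  · simp_rw [smul_add]; exact h.m.add h'.m
  · simp_rw [smul_add, map_add]
    rw [integral_add (app_int hΦ h.m) (app_int hΦ h'.m)]
    simp_rw [fun n => integral_add (app_int hΦ (h.mn n)) (app_int hΦ (h'.mn n))]
    exact (h.w Φ hΦ).add (h'.w Φ hΦ)

theorem clm_mlp {Φ : Q2 → V' →L[ℝ] ℝ} (hΦ : MemLp Φ 2 nu) {L : Q2 → V →L[ℝ] V'} (hL : AEStronglyMeasurable L nu) {C : ℝ} (hC : 0 ≤ C)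
    (hb : ∀ᵐ p ∂nu, ‖L p‖ ≤ C) : MemLp (fun p => (Φ p).comp (L p)) 2 nu := by
  refine MemLp.of_le_mul (c := C) hΦ (isBoundedBilinearMap_comp.continuous.comp_aestronglyMeasurable (hΦ.1.prodMk hL)) ?_
  filter_upwards [hb] with p hp
  calc _ ≤ ‖Φ p‖ * ‖L p‖ := (Φ p).opNorm_comp_le (L p)
    _ ≤ ‖Φ p‖ * C := by gcongr
    _ = _ := mul_comm _ _

theorem WK.var {v : ℕ → Q2 → V} {v0} (h : WK v v0) {L : ℕ → Q2 → V →L[ℝ] V'} {L0 : Q2 → V →L[ℝ] V'} {C : ℝ} (hc : ∀ n, Continuous (L n))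
    (hb : ∀ n, ∀ p ∈ Om 0 1, ‖L n p‖ ≤ C) (hL : ∀ᵐ p ∂nu, Tendsto (fun n => L n p) atTop (𝓝 (L0 p))) :
    WK (fun n p => L n p (v n p)) (fun p => L0 p (v0 p)) := by
  have hC : 0 ≤ C := (norm_nonneg _).trans (hb 0 (1/2,0) ⟨by norm_num, by simp [Real.pi_pos]⟩)
  have hb' : ∀ n, ∀ᵐ p ∂nu, ‖L n p‖ ≤ C := fun n => (ae_restrict_iff' oM).2 (.of_forall (hb n))
  have m0 : AEStronglyMeasurable L0 nu := aestronglyMeasurable_of_tendsto_ae atTop (fun n => (hc n).aestronglyMeasurable) hL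
  have b0 : ∀ᵐ p ∂nu, ‖L0 p‖ ≤ C := by
    filter_upwards [hL, ae_all_iff.2 hb'] with p hp hq
    exact le_of_tendsto hp.norm (.of_forall hq)
  obtain ⟨K, hK⟩ := h.b
  have bd : ∀ n, ∫ p, ‖p.1^2 • L n p (v n p)‖^2 ∂nu ≤ C^2 * K := fun n => by
    have hcn := hc n
    have hvn := h.c n
    calc _ ≤ ∫ p, C^2 * ‖p.1^2 • v n p‖^2 ∂nu := by
          refine integral_mono_ae cof cof ?_
          filter_upwards [hb' n] with p hp
          rw [← map_smul, ← mul_pow]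
          gcongr
          exact (L n p).le_of_opNorm_le hp _
      _ ≤ _ := by rw [integral_const_mul]; gcongr; exact hK n
  refine ⟨fun n => (hc n).clm_apply (h.c n), ⟨_, bd⟩, ?_, fun Φ hΦ => ?_⟩
  · simp_rw [← map_smul]
    refine MemLp.of_le_mul (c := C) h.m (app_aesm m0 h.m.1) ?_
    filter_upwards [b0] with p hp
    exact (L0 p).le_of_opNorm_le hp _
  · have M0 := clm_mlp hΦ m0 hC b0
    have Mn := fun n => clm_mlp hΦ (hc n).aestronglyMeasurable hC (hb' n)
    have Ms : ∀ n, MemLp (fun p => (Φ p).comp (L n p) - (Φ p).comp (L0 p)) 2 nu := fun n => (Mn n).sub M0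
    have t1 := h.w _ M0
    have t2 : Tendsto (fun n => ∫ p, ((Φ p).comp (L n p) - (Φ p).comp (L0 p)) (p.1^2 • v n p) ∂nu) atTop (𝓝 0) := by
      have dc : Tendsto (fun n => (∫ p, ‖(Φ p).comp (L n p) - (Φ p).comp (L0 p)‖^2 ∂nu) * K) atTop (𝓝 0) := by
        rw [← zero_mul K]
        refine Tendsto.mul_const _ ?_
        rw [← integral_zero (ℝ×ℝ) ℝ (μ := nu)]
        refine tendsto_integral_of_dominated_convergence (fun p => (2*C)^2 * ‖Φ p‖^2) (fun n => ((Mn n).sub M0).1.norm.pow 2) (((mlp2 hΦ.1).1 hΦ).const_mul _) (fun n => ?_) ?_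
        · filter_upwards [hb' n, b0] with p h1 h2
          rw [← ContinuousLinearMap.comp_sub, norm_pow, norm_norm, ← mul_pow]
          have := (Φ p).opNorm_comp_le (L n p - L0 p)
          have := norm_sub_le (L n p) (L0 p)
          gcongr
          calc _ ≤ _ := (Φ p).opNorm_comp_le (L n p - L0 p)
            _ ≤ ‖Φ p‖ * (2*C) := by gcongr; linarith
            _ = _ := mul_comm _ _
        · filter_upwards [hL] with p hp
          have : Tendsto (fun n => ‖(Φ p).comp (L n p) - (Φ p).comp (L0 p)‖^2) atTop (𝓝 (‖(Φ p).comp (L0 p) - (Φ p).comp (L0 p)‖^2)) :=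
            (((((ContinuousLinearMap.compL ℝ V V' ℝ (Φ p)).continuous.tendsto _).comp hp).sub tendsto_const_nhds).norm.pow 2)
          simpa using this
      have sq : Tendsto (fun n => ‖∫ p, ((Φ p).comp (L n p) - (Φ p).comp (L0 p)) (p.1^2 • v n p) ∂nu‖^2) atTop (𝓝 0) :=
        squeeze_zero (fun _ => by positivity) (fun n => (app_le (Ms n) (h.mn n)).trans
          (mln (hK n) (integral_nonneg fun _ => by positivity))) dc
      have := sq.sqrt
      simp only [Real.sqrt_sq no, Real.sqrt_zero] at this
      exact tendsto_zero_iff_norm_tendsto_zero.2 this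
    have := t2.add t1
    rw [zero_add] at this
    refine (this.congr fun n => ?_).trans_eq (by simp)
    rw [← integral_add (app_int (Ms n) (h.mn n)) (app_int M0 (h.mn n))]
    congr 1; ext p; simp; ring

theorem wk_sub1 {v : ℕ → Fe} (hc : ∀ n, Continuous (v n)) {C : ℝ} (hb : ∀ n, ∫ p, ‖p.1^2 • v n p‖^2 ∂nu ≤ C) :
    ∃ φ : ℕ → ℕ, StrictMono φ ∧ ∃ v0, WK (fun n => v (φ n)) v0 := by
  have : Fact ((2:ℝ≥0∞) ≠ ∞) := ⟨by norm_num⟩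
  have hm : ∀ n, MemLp (fun p => p.1^2 • v n p) 2 nu := fun n => by have := hc n; exact cont_mlp fp
  let u : ℕ → Lp E3 2 nu := fun n => (hm n).toLp
  have hin : ∀ n (Φ : Fe), ∀ hΦ : MemLp Φ 2 nu, inner ℝ (u n) (hΦ.toLp) = ∫ p, inner ℝ (p.1^2 • v n p) (Φ p) ∂nu := fun n Φ hΦ => by
    rw [L2.inner_def]
    refine integral_congr_ae ?_
    filter_upwards [(hm n).coeFn_toLp, hΦ.coeFn_toLp] with p h1 h2
    rw [h1, h2]
  have hu : ∀ n, ‖u n‖^2 ≤ C := fun n => by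
    rw [← ris, hin]
    simp_rw [ris]
    exact hb n
  let w : ℕ → WeakDual ℝ (Lp E3 2 nu) := fun n => WeakDual.toStrongDual.symm (InnerProductSpace.toDual ℝ _ (u n))
  obtain ⟨f, -, φ, hφ, hf⟩ := WeakDual.isSeqCompact_closedBall ℝ (Lp E3 2 nu) 0 (√C) (x := w) fun n => by
    simp only [Set.mem_preimage, mem_closedBall, dist_zero_right, w]
    simpa using Real.le_sqrt_of_sq_le (hu n)
  let x0 : Lp E3 2 nu := (InnerProductSpace.toDual ℝ _).symm (WeakDual.toStrongDual f)
  have hx : ∀ y, Tendsto (fun n => inner ℝ (u (φ n)) y) atTop (𝓝 (inner ℝ x0 y)) := fun y => by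
    have := (WeakBilin.eval_continuous _ y).continuousAt.tendsto.comp hf
    have e : inner ℝ x0 y = f y := by
      rw [← InnerProductSpace.toDual_apply_apply (𝕜 := ℝ)]; simp [x0]
    rw [e]
    exact this
  have hx0 : (fun p => p.1^2 • ((p.1^2)⁻¹ • x0 p)) =ᵐ[nu] x0 := by
    refine (ae_restrict_iff' oM).2 (.of_forall fun p hp => ?_)
    have : p.1^2 ≠ 0 := pow_ne_zero 2 (ne_of_gt hp.1.1)
    simp [smul_smul, this]
  refine ⟨φ, hφ, fun p => (p.1^2)⁻¹ • x0 p, fun n => hc _, ⟨C, fun n => hb _⟩, (memLp_congr_ae hx0).2 (Lp.memLp x0), fun Φ hΦ => ?_⟩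
  have hΨ : MemLp (fun p => (InnerProductSpace.toDual ℝ E3).symm (Φ p)) 2 nu :=
    hΦ.of_le ((InnerProductSpace.toDual ℝ E3).symm.continuous.comp_aestronglyMeasurable hΦ.1) (.of_forall fun p => by simp)
  have e : ∀ (p) (a : E3), Φ p a = inner ℝ a ((InnerProductSpace.toDual ℝ E3).symm (Φ p)) := fun p a => by
    rw [real_inner_comm, InnerProductSpace.toDual_symm_apply]
  have := hx hΨ.toLp
  simp_rw [hin, ← e] at this
  convert this using 2
  rw [L2.inner_def]
  refine integral_congr_ae ?_
  filter_upwards [hx0, hΨ.coeFn_toLp] with p h1 h2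
  rw [h1, h2, e]

theorem wk_sub (m : ℕ) : ∀ {v : Fin m → ℕ → Fe}, (∀ i n, Continuous (v i n)) → ∀ {C : ℝ}, (∀ i n, ∫ p, ‖p.1^2 • v i n p‖^2 ∂nu ≤ C) →
    ∃ φ : ℕ → ℕ, StrictMono φ ∧ ∃ v0 : Fin m → Fe, ∀ i, WK (fun n => v i (φ n)) (v0 i) := by
  induction m with
  | zero => exact fun _ _ _ => ⟨id, strictMono_id, fun i => i.elim0, fun i => i.elim0⟩
  | succ m ih =>
    intro v hc C hb
    obtain ⟨φ, hφ, w, hw⟩ := ih (v := fun i => v i.succ) (fun i => hc _) (fun i => hb _)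
    obtain ⟨ψ, hψ, w0, hw0⟩ := wk_sub1 (v := fun n => v 0 (φ n)) (fun n => hc _ _) (fun n => hb _ _)
    exact ⟨φ ∘ ψ, hφ.comp hψ, Fin.cons w0 w, Fin.cases hw0 fun i => (hw i).sub hψ⟩
end

section
theorem cs_ii {u : ℝ → ℝ} (hu : Continuous u) {a b : ℝ} (h : a ≤ b) : (∫ t in a..b, u t)^2 ≤ (b-a) * ∫ t in a..b, u t^2 := by
  have : 0 ≤ ∫ t in a..b, ((b-a) * u t - ∫ t in a..b, u t)^2 := ii_nn h fun _ _ => sq_nonneg _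
  set K0 := ∫ t in a..b, u t
  have e : ∫ t in a..b, ((b-a) * u t - K0)^2 = ∫ t in a..b, (((b-a)^2 * u t^2 - 2*(b-a)*K0 * u t) + K0^2) := by congr 1; ext t; ring
  rw [e, ii_add cf2 cf2, ii_sub cf2 cf2,
    ii_cm, ii_cm, intervalIntegral.integral_const, smul_eq_mul] at this
  rcases h.eq_or_lt with h | h
  · simp [K0, h]
  · have : 0 ≤ (b-a) * ((b-a) * (∫ t in a..b, u t^2) - K0^2) := by nlinarith
    nlinarith [(mul_nonneg_iff_of_pos_left (sub_pos.2 h)).1 this]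

theorem avg_bd {d d' : ℝ → E3} (hd : ∀ t, HasDerivAt d (d' t) t) (hc : Continuous d') {a b θ : ℝ} (h1 : a ≤ θ) (h2 : θ ≤ b) (h : a < b) :
    ‖d θ‖^2 ≤ 2*((b-a)*∫ t in a..b, ‖d' t‖^2) + 2*‖(b-a)⁻¹ • ∫ t in a..b, d t‖^2 := by
  have hdc : Continuous d := continuous_iff_continuousAt.2 fun t => (hd t).continuousAt
  have hba : 0 < b - a := sub_pos.2 h
  set M := ∫ t in a..b, ‖d' t‖
  have m1 : ∀ t ∈ Set.Ioc a b, ‖d θ - d t‖ ≤ M := fun t ht => by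
    rw [← ii_ftc (fun s _ => hd s) (ii_cont hc)]
    refine (intervalIntegral.norm_integral_le_abs_integral_norm).trans ?_
    refine (intervalIntegral.abs_integral_mono_interval (c := a) (d := b) ?_ (.of_forall fun _ => norm_nonneg _) (ii_cont hc.norm)).trans_eq (abs_of_nonneg ?_)
    · rw [Set.uIoc_of_le h.le, Set.uIoc]
      exact Set.Ioc_subset_Ioc (le_inf ht.1.le h1) (sup_le ht.2 h2)
    · exact ii_nn h.le fun _ _ => norm_nonneg _
  have m2 : ‖d θ - (b-a)⁻¹ • ∫ t in a..b, d t‖ ≤ M := by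
    have e : d θ - (b-a)⁻¹ • ∫ t in a..b, d t = (b-a)⁻¹ • ∫ t in a..b, (d θ - d t) := by
      rw [ii_sub (ii_cont continuous_const) (ii_cont hdc), intervalIntegral.integral_const, smul_sub, smul_smul, inv_mul_cancel₀ hba.ne', one_smul]
    have := intervalIntegral.norm_integral_le_of_norm_le_const (a := a) (b := b) (f := fun t => d θ - d t) (C := M) (by rw [Set.uIoc_of_le h.le]; exact m1)
    rw [abs_of_pos hba] at this
    rw [e, norm_smul, norm_inv, Real.norm_eq_abs, abs_of_pos hba, inv_mul_le_iff₀ hba]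
    linarith
  have m3 := cs_ii hc.norm h.le
  have m4 := norm_add_le (d θ - (b-a)⁻¹ • ∫ t in a..b, d t) ((b-a)⁻¹ • ∫ t in a..b, d t)
  rw [sub_add_cancel] at m4
  set w := ‖(b-a)⁻¹ • ∫ t in a..b, d t‖
  have : ‖d θ‖^2 ≤ (M + w)^2 := pow_le_pow_left₀ no la 2
  nlinarith [sq_nonneg (M - w)]

def wa (δ t : ℝ) : ℝ := (1-δ)*t - δ*π
def wb (δ t : ℝ) : ℝ := (1-δ)*t + δ*π
def TT (δ : ℝ) (F : Fe) (p : Q2) : E3 := ∫ t in (wa δ p.2)..(wb δ p.2), p.1^3 • F (p.1, t)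

theorem TT_cont {δ : ℝ} {F : Fe} (hF : Continuous F) : Continuous (TT δ F) := by
  have e : TT δ F = fun p => (∫ t in zR..(wb δ p.2), p.1^3 • F (p.1, t)) - ∫ t in zR..(wa δ p.2), p.1^3 • F (p.1, t) := by
    ext1 p
    exact (intervalIntegral.integral_interval_sub_left cf2 cf2).symm
  rw [e]
  exact (intervalIntegral.continuous_parametric_intervalIntegral_of_continuous (f := fun (p : Q2) t => p.1^3 • F (p.1, t)) fp (by unfold wb; fun_prop)).sub
    (intervalIntegral.continuous_parametric_intervalIntegral_of_continuous (f := fun (p : Q2) t => p.1^3 • F (p.1, t)) fp (by unfold wa; fun_prop))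

def SS (δ : ℝ) (p : Q2) : Set (Q2) := Set.Ioo 0 p.1 ×ˢ Set.Ioo (wa δ p.2) (wb δ p.2)
theorem SS_meas (δ p) : MeasurableSet (SS δ p) := measurableSet_Ioo.prod measurableSet_Ioo
theorem SS_sub {δ p} (h0 : 0 < δ) (h1 : δ < 1) (hp : p ∈ Om 0 1) : SS δ p ⊆ Om 0 1 := by
  refine Set.prod_mono (Set.Ioo_subset_Ioo_right hp.1.2.le) (Set.Ioo_subset_Ioo ?_ ?_) <;> simp only [wa, wb] <;> nlinarith [hp.2.1, hp.2.2]

theorem TT_eq {δ : ℝ} (h0 : 0 < δ) {F Fr Ft : Fe} (hF : PC1 F Fr Ft) {p : Q2} (hp : p ∈ Om 0 1) :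
    TT δ F p = ∫ s in SS δ p, ((3:ℝ) • (s.1^2 • F s) + s.1 • (s.1^2 • Fr s)) := by
  have c1 := hF.c
  have c2 := hF.cr
  have hw : wa δ p.2 ≤ wb δ p.2 := by unfold wa wb; nlinarith [Real.pi_pos]
  have ci : IntegrableOn (fun s : Q2 => ((3:ℝ) • (s.1^2 • F s) + s.1 • (s.1^2 • Fr s))) (SS δ p) :=
    (Continuous.continuousOn fp).integrableOn_compact (isCompact_Icc.prod isCompact_Icc) |>.mono_set (Set.prod_mono Set.Ioo_subset_Icc_self Set.Ioo_subset_Icc_self)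
  unfold SS at ci ⊢
  rw [Measure.volume_eq_prod, setIntegral_prod _ ci, ← integral_Ioc_eq_integral_Ioo, ← intervalIntegral.integral_of_le hp.1.1.le]
  simp_rw [← integral_Ioc_eq_integral_Ioo (f := fun t => ((3:ℝ) • (_ • F (_,t)) + _ • (_ • Fr (_,t)))), ← intervalIntegral.integral_of_le hw]
  rw [ii_swap (by unfold Function.uncurry; fun_prop)]
  refine intervalIntegral.integral_congr fun t _ => ?_
  have hd : ∀ s, HasDerivAt (fun s => s^3 • F (s,t)) ((3:ℝ) • (s^2 • F (s,t)) + s • (s^2 • Fr (s,t))) s := fun s => by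
    have := ((hasDerivAt_id s).pow 3).smul (hF.hr s t)
    exact this.congr_deriv (by simp; module)
  beta_reduce
  rw [ii_ftc (fun s _ => hd s) cf2]
  simp

variable {f fr ft : ℕ → Fe} {f0 fr0 : Fe}

theorem ind_mlp {S : Set (ℝ×ℝ)} (hS : MeasurableSet S) (u : ℝ → ℝ) (hu : Continuous u) (i : Fin 3) : MemLp (S.indicator (fun s : Q2 => (u s.1 • pr i : E3 →L[ℝ] ℝ))) 2 nu := by
  have c : Continuous (fun s : Q2 => (u s.1 • pr i : E3 →L[ℝ] ℝ)) := by fun_prop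
  have := cont_mlp c
  exact MemLp.indicator hS this

theorem TT_lim {δ : ℝ} (h0 : 0 < δ) (h1 : δ < 1) (hp : ∀ n, PC1 (f n) (fr n) (ft n)) (hf : WK f f0) (hr : WK fr fr0) {p : Q2} (hpm : p ∈ Om 0 1) :
    ∃ L, Tendsto (fun n => TT δ (f n) p) atTop (𝓝 L) := by
  have hm : ∀ (u : ℝ → ℝ), Continuous u → ∀ i : Fin 3, MemLp ((SS δ p).indicator (fun s : Q2 => (u s.1 • pr i : E3 →L[ℝ] ℝ))) 2 nu := fun u hu i => ind_mlp (SS_meas δ p) u hu i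
  have : ∀ i, ∃ l, Tendsto (fun n => pr i (TT δ (f n) p)) atTop (𝓝 l) := fun i => by
    refine ⟨_, ((hf.w _ (hm (fun _ => 3) fp i)).add (hr.w _ (hm (fun s => s) fp i))).congr fun n => ?_⟩
    rw [← integral_add (app_int (hm (fun _ => 3) fp i) (hf.mn n)) (app_int (hm (fun s => s) fp i) (hr.mn n)), TT_eq h0 (hp n) hpm,
      ← ContinuousLinearMap.integral_comp_comm]
    · have e : ∀ g : Fs, ∫ s in SS δ p, g s = ∫ s, (SS δ p).indicator g s ∂nu := fun g => by
        rw [integral_indicator (SS_meas _ _), Measure.restrict_restrict (SS_meas _ _), Set.inter_eq_left.2 (SS_sub h0 h1 hpm)]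
      rw [e]
      congr 1; ext s
      by_cases hs : s ∈ SS δ p
      · simp [hs]; ring
      · simp [hs]
    · have := hf.c n
      have := hr.c n
      exact (cont_Om (F := fun s : Q2 => ((3:ℝ) • (s.1^2 • f n s) + s.1 • (s.1^2 • fr n s))) fp 0 1).mono_set (SS_sub h0 h1 hpm)
  choose l hl using this
  refine ⟨WithLp.toLp 2 l, ?_⟩
  have := (PiLp.continuous_toLp 2 (fun _ : Fin 3 => ℝ)).continuousAt.tendsto.comp (tendsto_pi_nhds.2 hl)
  exact this

theorem le_one_sq (x : ℝ) : x ≤ 1 + x^2 := by nlinarith [sq_nonneg (x-1)]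

theorem TT_bd {δ : ℝ} (h0 : 0 < δ) (h1 : δ < 1) (hp : ∀ n, PC1 (f n) (fr n) (ft n)) (hf : WK f f0) (hr : WK fr fr0) :
    ∃ C, ∀ n, ∀ p ∈ Om 0 1, ‖TT δ (f n) p‖ ≤ C := by
  obtain ⟨C, hC⟩ := hf.b
  obtain ⟨C', hC'⟩ := hr.b
  refine ⟨(∫ s, (4:ℝ) ∂nu) + 3*C+C', fun n p hpm => ?_⟩
  have c1 := hf.c n
  have c2 := hr.c n
  rw [TT_eq h0 (hp n) hpm]
  have ci := cont_Om (F := fun s : Q2 => ((3:ℝ) • (s.1^2 • f n s) + s.1 • (s.1^2 • fr n s))) fp 0 1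
  calc _ ≤ ∫ s in SS δ p, ‖(3:ℝ) • (s.1^2 • f n s) + s.1 • (s.1^2 • fr n s)‖ := norm_integral_le_integral_norm _
    _ ≤ ∫ s, ‖(3:ℝ) • (s.1^2 • f n s) + s.1 • (s.1^2 • fr n s)‖ ∂nu :=
      setIntegral_mono_set ci.norm (.of_forall fun _ => norm_nonneg _) (SS_sub h0 h1 hpm).eventuallyLE
    _ ≤ ∫ s, (4 + 3*‖s.1^2 • f n s‖^2 + ‖s.1^2 • fr n s‖^2) ∂nu := by
      refine setIntegral_mono_on ci.norm cof oM fun s hs => ?_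
      refine (norm_add_le _ _).trans ?_
      rw [norm_smul (3:ℝ), norm_smul s.1, rnn (by norm_num : zR ≤ 3), rnn hs.1.1.le]
      have := le_one_sq ‖s.1^2 • f n s‖
      have := le_one_sq ‖s.1^2 • fr n s‖
      have : s.1 * ‖s.1^2 • fr n s‖ ≤ ‖s.1^2 • fr n s‖ := mul_le_of_le_one_left no hs.1.2.le
      linarith
    _ ≤ _ := by
      rw [integral_add cof cof, integral_add cof cof, integral_const_mul]
      linarith [hC n, hC' n]
end

section
variable {f fr ft : ℕ → Fe} {f0 fr0 : Fe}

theorem nu_JJ {F : Fs} (hF : Continuous F) : ∫ p, JJ F p.1 ∂nu = 2*π * ∫ p, F p ∂nu := by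
  have c : Continuous (fun p : Q2 => JJ F p.1) := (J_cont hF).comp continuous_fst
  rw [Om_iter c zero_le_one, Om_iter hF zero_le_one, ← ii_cm]
  refine intervalIntegral.integral_congr fun r _ => ?_
  simp only [JJ, intervalIntegral.integral_const, smul_eq_mul]; ring

theorem sq_sub_le {V : Type*} [NormedAddCommGroup V] (a b : V) : ‖a - b‖^2 ≤ 2*‖a‖^2 + 2*‖b‖^2 := by
  have := pow_le_pow_left₀ no (norm_sub_le a b) 2
  nlinarith [sq_nonneg (‖a‖-‖b‖)]
theorem sq_add_le {V : Type*} [NormedAddCommGroup V] (a b : V) : ‖a + b‖^2 ≤ 2*‖a‖^2 + 2*‖b‖^2 := by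
  have := sq_sub_le a (-b)
  simpa using this

theorem rell_pt {δ : ℝ} (h0 : 0 < δ) (h1 : δ < 1) {F Fr Ft G Gr Gt : Fe} (hF : PC1 F Fr Ft) (hG : PC1 G Gr Gt) {p : Q2} (hp : p ∈ Om 0 1) :
    ‖p.1^3 • (F p - G p)‖^2 ≤ 4*π*δ * JJ (fun s => ‖s.1^3 • (Ft s - Gt s)‖^2) p.1 + 2*((2*π*δ)⁻¹)^2 * ‖TT δ F p - TT δ G p‖^2 := by
  have hpi := Real.pi_pos
  have c1 := hF.c
  have c2 := hF.ct
  have c3 := hG.c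
  have c4 := hG.ct
  have hw : wb δ p.2 - wa δ p.2 = 2*π*δ := by simp only [wa,wb]; ring
  have a1 : wa δ p.2 ≤ p.2 := by simp only [wa]; nlinarith [hp.2.1]
  have a2 : p.2 ≤ wb δ p.2 := by simp only [wb]; nlinarith [hp.2.2]
  have a3 : -π ≤ wa δ p.2 := by simp only [wa]; nlinarith [hp.2.1]
  have a4 : wb δ p.2 ≤ π := by simp only [wb]; nlinarith [hp.2.2]
  have a5 : wa δ p.2 < wb δ p.2 := by rw [← sub_pos, hw]; positivity
  have := avg_bd (d := fun t => p.1^3 • (F (p.1,t) - G (p.1,t))) (d' := fun t => p.1^3 • (Ft (p.1,t) - Gt (p.1,t)))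
    (fun t => by simpa using ((hF.ht p.1 t).fun_sub (hG.ht p.1 t)).fun_const_smul (p.1^3)) fp a1 a2 a5
  rw [hw] at this
  have e : ∫ t in (wa δ p.2)..(wb δ p.2), p.1^3 • (F (p.1,t) - G (p.1,t)) = TT δ F p - TT δ G p := by
    unfold TT
    rw [← ii_sub cf2 cf2]
    simp [smul_sub]
  rw [e, norm_smul (2*π*δ)⁻¹, mul_pow, norm_inv, rnn (by positivity : 0 ≤ 2*π*δ)] at this
  have m : ∫ t in (wa δ p.2)..(wb δ p.2), ‖p.1^3 • (Ft (p.1,t) - Gt (p.1,t))‖^2 ≤ JJ (fun s => ‖s.1^3 • (Ft s - Gt s)‖^2) p.1 := by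
    unfold JJ
    exact intervalIntegral.integral_mono_interval a3 a5.le a4 (.of_forall fun _ => by positivity) cf2
  have m' := mln m (by positivity : 0 ≤ 4*π*δ)
  have : p = (p.1,p.2) := rfl
  nlinarith

theorem rell_int {δ : ℝ} (h0 : 0 < δ) (h1 : δ < 1) {F Fr Ft G Gr Gt : Fe} (hF : PC1 F Fr Ft) (hG : PC1 G Gr Gt) {C : ℝ}
    (b1 : ∫ p, ‖p.1^2 • Ft p‖^2 ∂nu ≤ C) (b2 : ∫ p, ‖p.1^2 • Gt p‖^2 ∂nu ≤ C) :
    ∫ p, ‖p.1^3 • (F p - G p)‖^2 ∂nu ≤ 32*π^2*δ*C + 2*((2*π*δ)⁻¹)^2 * ∫ p, ‖TT δ F p - TT δ G p‖^2 ∂nu := by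
  have hpi := Real.pi_pos
  have c1 := hF.c
  have c2 := hF.ct
  have c3 := hG.c
  have c4 := hG.ct
  have c5 := TT_cont (δ := δ) c1
  have c6 := TT_cont (δ := δ) c3
  have cF : Continuous (fun s : Q2 => ‖s.1^3 • (Ft s - Gt s)‖^2) := by fun_prop
  have cJ : Continuous (fun p : Q2 => JJ (fun s : Q2 => ‖s.1^3 • (Ft s - Gt s)‖^2) p.1) := (J_cont cF).comp continuous_fst
  have m := setIntegral_mono_on (cont_Om (F := fun p : Q2 => ‖p.1^3 • (F p - G p)‖^2) fp 0 1)
    (cont_Om (F := fun p : Q2 => 4*π*δ * JJ (fun s : Q2 => ‖s.1^3 • (Ft s - Gt s)‖^2) p.1 + 2*((2*π*δ)⁻¹)^2 * ‖TT δ F p - TT δ G p‖^2) fp 0 1) oM fun p hp => rell_pt h0 h1 hF hG hp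
  rw [integral_add cof cof, integral_const_mul, integral_const_mul, nu_JJ cF] at m
  have m2 : ∫ p, ‖p.1^3 • (Ft p - Gt p)‖^2 ∂nu ≤ ∫ p, (2*‖p.1^2 • Ft p‖^2 + 2*‖p.1^2 • Gt p‖^2) ∂nu := by
    refine setIntegral_mono_on (cont_Om cF _ _) cof oM fun p hp => ?_
    refine le_trans ?_ (sq_sub_le _ _)
    rw [← smul_sub, norm_smul, norm_smul]
    refine pow_le_pow_left₀ pv (mul_le_mul_of_nonneg_right ?_ no) 2
    rw [norm_pow, norm_pow, rnn hp.1.1.le]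
    exact pow_le_pow_of_le_one hp.1.1.le hp.1.2.le nrm0
  rw [integral_add cof cof, integral_const_mul, integral_const_mul] at m2
  have m3 : ∫ p, ‖p.1^3 • (Ft p - Gt p)‖^2 ∂nu ≤ 4*C := by linarith
  have m4 := mln m3 (by positivity : 0 ≤ 8*π^2*δ)
  linarith

theorem rell_cauchy (hp : ∀ n, PC1 (f n) (fr n) (ft n)) (hf : WK f f0) (hr : WK fr fr0) {C : ℝ} (ht : ∀ n, ∫ p, ‖p.1^2 • ft n p‖^2 ∂nu ≤ C) {ε : ℝ} (hε : 0 < ε) :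
    ∃ N, ∀ n ≥ N, ∀ m ≥ N, ∫ p, ‖p.1^3 • (f n p - f m p)‖^2 ∂nu ≤ ε := by
  have hpi := Real.pi_pos
  have hC : 0 ≤ C := (integral_nonneg fun _ => by positivity).trans (ht 0)
  obtain ⟨δ, h0, h1, hδ⟩ : ∃ δ : ℝ, 0 < δ ∧ δ < 1 ∧ 32*π^2*δ*C ≤ ε/2 := by
    refine ⟨min (1/2) (ε / (64*π^2*(C+1))), by positivity, (min_le_left _ _).trans_lt nrm0, ?_⟩
    have : min (1/2) (ε / (64*π^2*(C+1))) ≤ ε / (64*π^2*(C+1)) := min_le_right _ _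
    rw [le_div_iff₀ pv] at this
    have h : 0 < min (1/2) (ε / (64*π^2*(C+1))) := by positivity
    have : 0 < 64*π^2 * min (1/2) (ε / (64*π^2*(C+1))) := by positivity
    nlinarith
  obtain ⟨M, hM⟩ := TT_bd h0 h1 hp hf hr
  have key : Tendsto (fun nm : ℕ × ℕ => ∫ p, ‖TT δ (f nm.1) p - TT δ (f nm.2) p‖^2 ∂nu) atTop (𝓝 (∫ p, 0 ∂nu)) := by
    refine tendsto_integral_filter_of_dominated_convergence (fun _ => (M+M)^2) ?_ ?_ (integrable_const _) ?_
    · exact .of_forall fun nm => by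
        have := TT_cont (δ := δ) (hp nm.1).c
        have := TT_cont (δ := δ) (hp nm.2).c
        exact Continuous.aestronglyMeasurable fp
    · refine .of_forall fun nm => (ae_restrict_iff' oM).2 (.of_forall fun p hpm => ?_)
      rw [rnn pv]
      exact pow_le_pow_left₀ no ((norm_sub_le _ _).trans (add_le_add (hM _ p hpm) (hM _ p hpm))) 2
    · refine (ae_restrict_iff' oM).2 (.of_forall fun p hpm => ?_)
      obtain ⟨L, hL⟩ := TT_lim h0 h1 hp hf hr hpm
      rw [← prod_atTop_atTop_eq]
      have := (hL.comp tendsto_fst).sub (hL.comp (tendsto_snd (f := atTop)))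
      simpa using (this.norm.pow 2)
  have key2 := (key.const_mul (2*((2*π*δ)⁻¹)^2)).eventually (gt_mem_nhds (show _ < ε/2 by simp; positivity))
  obtain ⟨N, hN⟩ := eventually_atTop_prod_self.1 key2
  refine ⟨N, fun n hn m hm => (rell_int h0 h1 (hp n) (hp m) (ht n) (ht m)).trans ?_⟩
  have := hN n m hn hm
  linarith

theorem in6 (r : ℝ) (a b c : E3) : innerSL ℝ (r^4 • a) (r^2 • b) - innerSL ℝ (r^4 • a) (r^2 • c) = inner ℝ (r^3 • a) (r^3 • (b - c)) := by
  simp only [innerSL_apply_apply, real_inner_smul_left, real_inner_smul_right, inner_sub_right]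
  ring

theorem rellich (hp : ∀ n, PC1 (f n) (fr n) (ft n)) (hf : WK f f0) (hr : WK fr fr0) {C : ℝ} (ht : ∀ n, ∫ p, ‖p.1^2 • ft n p‖^2 ∂nu ≤ C) :
    (∀ n, Integrable (fun p => ‖p.1^3 • FD‖^2) nu) ∧ Tendsto (fun n => ∫ p, ‖p.1^3 • FD‖^2 ∂nu) atTop (𝓝 0) := by
  have me : ∀ n, MemLp (fun p : Q2 => p.1^4 • FD) 2 nu := fun n => by
    have m0 : MemLp (fun p => p.1^2 • f n p - p.1^2 • f0 p) 2 nu := (hf.mn n).sub hf.m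
    have ha : AEStronglyMeasurable (fun p : Q2 => p.1^2 • (p.1^2 • f n p - p.1^2 • f0 p)) nu :=
      (Continuous.aestronglyMeasurable (by fun_prop : Continuous fun p : Q2 => p.1^2)).smul m0.1
    have : MemLp (fun p : Q2 => p.1^2 • (p.1^2 • f n p - p.1^2 • f0 p)) 2 nu := by
      refine m0.of_le ha ((ae_restrict_iff' oM).2 (.of_forall fun p hpm => ?_))
      rw [norm_smul, norm_pow, rnn hpm.1.1.le]
      exact mul_le_of_le_one_left no (pow_le_one₀ hpm.1.1.le hpm.1.2.le)
    convert this using 2 with p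
    module
  have mi : ∀ n, MemLp (fun p : Q2 => innerSL ℝ (p.1^4 • FD)) 2 nu := fun n =>
    (me n).of_le ((innerSL ℝ).continuous.comp_aestronglyMeasurable (me n).1) (.of_forall fun p => (innerSL_apply_norm ℝ _).le)
  have m3 : ∀ n, Integrable (fun p : Q2 => ‖p.1^3 • FD‖^2) nu := fun n => by
    refine ((app_int (mi n) (hf.mn n)).sub (app_int (mi n) hf.m)).congr (.of_forall fun p => ?_)
    simp only [Pi.sub_apply, in6, ris]
  have lim : ∀ n, Tendsto (fun m => ∫ p, inner ℝ (p.1^3 • FD) (p.1^3 • (f n p - f m p)) ∂nu) atTop (𝓝 (∫ p, ‖p.1^3 • FD‖^2 ∂nu)) := fun n => by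
    have := (hf.w _ (mi n)).const_sub (∫ p, innerSL ℝ (p.1^4 • FD) (p.1^2 • f n p) ∂nu)
    rw [← integral_sub (app_int (mi n) (hf.mn n)) (app_int (mi n) hf.m)] at this
    convert this using 1
    · ext m
      rw [← integral_sub (app_int (mi n) (hf.mn n)) (app_int (mi n) (hf.mn m))]
      congr 1; ext p
      rw [in6]
    · congr 2; ext p
      rw [in6, ris]
  refine ⟨m3, ?_⟩
  rw [Metric.tendsto_atTop]
  intro ε hε
  obtain ⟨N, hN⟩ := rell_cauchy hp hf hr ht (half_pos hε)
  refine ⟨N, fun n hn => ?_⟩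
  rw [Real.dist_0_eq_abs, abs_of_nonneg (integral_nonneg fun _ => by positivity)]
  set A := ∫ p, ‖p.1^3 • FD‖^2 ∂nu
  have : A ≤ (A + ε/2)/2 := by
    refine le_of_tendsto (lim n) (eventually_atTop.2 ⟨N, fun m hm => ?_⟩)
    have c1 := hf.c n
    have c2 := hf.c m
    have i2 : Integrable (fun p : Q2 => ‖p.1^3 • (f n p - f m p)‖^2) nu := cont_Om fp _ _
    have : ∫ p, inner ℝ (p.1^3 • FD) (p.1^3 • (f n p - f m p)) ∂nu ≤ ∫ p, (2⁻¹ * ‖p.1^3 • FD‖^2 + 2⁻¹ * ‖p.1^3 • (f n p - f m p)‖^2) ∂nu := by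
      refine integral_mono ?_ (((m3 n).const_mul _).add (i2.const_mul _)) fun p => ?_
      · refine ((app_int (mi n) (hf.mn n)).sub (app_int (mi n) (hf.mn m))).congr (.of_forall fun p => ?_)
        simp only [Pi.sub_apply, in6]
      · have := real_inner_le_norm (p.1^3 • FD) (p.1^3 • (f n p - f m p))
        have := two_mul_le_add_sq ‖p.1^3 • FD‖ ‖p.1^3 • (f n p - f m p)‖
        dsimp only
        linarith
    rw [integral_add ((m3 n).const_mul _) (i2.const_mul _), integral_const_mul, integral_const_mul] at this
    have := hN n hn m hm
    linarith
  linarith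
end

section
theorem ae_sub {g : ℕ → Fs} (hi : ∀ n, Integrable (g n) nu) (h0 : ∀ n, ∀ p ∈ Om 0 1, 0 ≤ g n p) (ht : Tendsto (fun n => ∫ p, g n p ∂nu) atTop (𝓝 0)) :
    ∃ φ : ℕ → ℕ, StrictMono φ ∧ ∀ᵐ p ∂nu, Tendsto (fun n => g (φ n) p) atTop (𝓝 0) := by
  have : TendstoInMeasure nu g atTop (fun _ => zR) := by
    refine tendstoInMeasure_of_tendsto_eLpNorm (p := 1) one_ne_zero (fun n => (hi n).1) fp ?_
    have e : ∀ n, eLpNorm (g n - fun _ => zR) 1 nu = ENNReal.ofReal (∫ p, g n p ∂nu) := fun n => by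
      rw [eLpNorm_one_eq_lintegral_enorm, ← integral_congr_ae (f := fun p => ‖g n p‖), ofReal_integral_norm_eq_lintegral_enorm (hi n)]
      · simp
      · exact (ae_restrict_iff' oM).2 (.of_forall fun p hpm => rnn (h0 n p hpm))
    simp_rw [e]
    simpa using ENNReal.tendsto_ofReal ht
  exact this.exists_seq_tendsto_ae

structure Lim (Δ : ℝ) (y : ℕ → YY) (e q z er qr k : Fe) : Prop where
  cd : ∀ n, ContDiff ℝ 2 (y n)
  we : WK (fun n => ef (y n)) e
  wq : WK (fun n => qf (y n)) q
  wz : WK (fun n => zf (y n)) z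
  wer : WK (fun n => erf (y n)) er
  wqr : WK (fun n => qrf (y n)) qr
  wk : WK (fun n => kf (y n)) k
  ae : ∀ᵐ p ∂nu, Tendsto (fun n => ef (y n) p) atTop (𝓝 (e p))
  aq : ∀ᵐ p ∂nu, Tendsto (fun n => qf (y n) p) atTop (𝓝 (q p))
  az : ∀ᵐ p ∂nu, Tendsto (fun n => zf (y n) p) atTop (𝓝 (z p))
  ce : ∀ᵐ p ∂nu, ‖e p‖^2 = 1
  cq : ∀ᵐ p ∂nu, ‖q p‖^2 = 1 - Δ^2
  ceq : ∀ᵐ p ∂nu, inner ℝ (e p) (q p) = 0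

theorem nu_ae {P : Q2 → Prop} (h : ∀ p ∈ Om 0 1, P p) : ∀ᵐ p ∂nu, P p := (ae_restrict_iff' oM).2 (.of_forall h)

theorem WK.zr {v : ℕ → Fe} {v0} (h : WK v v0) : WK (fun n p => -(p.1 • v n p)) (fun p => -(p.1 • v0 p)) := by
  have := h.var (L := fun _ p => -(p.1 • ContinuousLinearMap.id ℝ E3)) (L0 := fun p => -(p.1 • ContinuousLinearMap.id ℝ E3)) (C := 1) (fun n => by fun_prop) (fun n p hp => by
    rw [norm_neg, norm_smul, rnn hp.1.1.le]
    exact mul_le_one₀ hp.1.2.le no ContinuousLinearMap.norm_id_le) (.of_forall fun p => tendsto_const_nhds)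
  simpa using this

theorem r_mono {a : Fe} {w : Fs} {C : ℝ} (ha : Continuous a) (hw : Continuous w) (hb : ∫ p, w p ∂nu ≤ C) (h : ∀ p ∈ Om 0 1, p.1^4 * ‖a p‖^2 ≤ w p) :
    ∫ p, ‖p.1^2 • a p‖^2 ∂nu ≤ C := by
  refine le_trans (setIntegral_mono_on cof (cont_Om hw _ _) oM fun p hp => ?_) hb
  rw [norm_smul, mul_pow, norm_pow, Real.norm_eq_abs, sq_abs]
  calc _ = p.1^4 * ‖a p‖^2 := by ring
    _ ≤ _ := h p hp

theorem conv_of {f : ℕ → E3} {f0 : E3} {r : ℝ} (hr : 0 < r) (h : Tendsto (fun n => ‖r^3 • (f n - f0)‖^2) atTop (𝓝 0)) : Tendsto f atTop (𝓝 f0) := by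
  rw [tendsto_iff_norm_sub_tendsto_zero]
  have := (h.sqrt).const_mul ((r^3)⁻¹)
  simp_rw [Real.sqrt_sq no, Real.sqrt_zero, mul_zero, norm_smul, rnn (pow_pos hr 3).le] at this
  refine this.congr fun n => ?_
  field_simp

theorem lim_ex {Δ C : ℝ} {h : ℕ → ℝ} {y : ℕ → YY} (ht : Tendsto h atTop (𝓝 0)) (hy : ∀ n, ContDiff ℝ 2 (y n)) (hB : ∀ n, Bd Δ C (h n) (y n)) :
    ∃ φ : ℕ → ℕ, StrictMono φ ∧ ∃ e q z er qr k, Lim Δ (fun n => y (φ n)) e q z er qr k ∧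
      Tendsto (fun n => ∫ p, (((‖p.1^3 • (ef (y (φ n)) p - e p)‖^2 + ‖p.1^3 • (qf (y (φ n)) p - q p)‖^2) + ‖p.1^3 • (zf (y (φ n)) p - z p)‖^2) + p.1 * G2 Δ (y (φ n)) p) ∂nu) atTop (𝓝 0) := by
  have cf := fun n => cont_fields (hy n)
  have E := fun n => e_pc1 (hy n)
  have Q := fun n => q_pc1 (hy n)
  have Z := fun n => z_pc1 (hy n)
  have B : ∀ n, (∫ p, ‖p.1^2 • ef (y n) p‖^2 ∂nu ≤ C) ∧ (∫ p, ‖p.1^2 • qf (y n) p‖^2 ∂nu ≤ C) ∧ (∫ p, ‖p.1^2 • zf (y n) p‖^2 ∂nu ≤ C) ∧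
      (∫ p, ‖p.1^2 • erf (y n) p‖^2 ∂nu ≤ C) ∧ (∫ p, ‖p.1^2 • qrf (y n) p‖^2 ∂nu ≤ C) ∧ (∫ p, ‖p.1^2 • kf (y n) p‖^2 ∂nu ≤ C) := fun n => by
    obtain ⟨h1,h2,h3,h4,h5,h6⟩ := cf n
    have h7 := (Z n).c
    have p1 : ∀ p ∈ Om 0 1, p.1^4 ≤ p.1^3 := fun p hp => pow_le_pow_of_le_one hp.1.1.le hp.1.2.le nrm0
    have p2 : ∀ p ∈ Om 0 1, 0 ≤ p.1^4 := fun p hp => by have := hp.1.1; positivity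
    have p3 : ∀ p ∈ Om 0 1, 0 ≤ p.1^3 := fun p hp => by have := hp.1.1.le; positivity
    refine ⟨r_mono h2 fp (hB n).f fun p hp => ?_, r_mono h3 fp (hB n).f fun p hp => ?_, r_mono h7 fp (hB n).f fun p hp => ?_,
      r_mono h4 fp (hB n).d3 fun p hp => ?_, r_mono h5 fp (hB n).d3 fun p hp => ?_, r_mono h6 fp (hB n).d3 fun p hp => ?_⟩
    iterate 3
      refine mln ?_ (p2 p hp)
      have := sq_nonneg ‖ef (y n) p‖
      have := sq_nonneg ‖qf (y n) p‖
      have := sq_nonneg ‖zf (y n) p‖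
      linarith
    all_goals
      refine mul_le_mul (p1 p hp) ?_ (sq_nonneg _) (p3 p hp)
      have := sq_nonneg ‖erf (y n) p‖
      have := sq_nonneg ‖qrf (y n) p‖
      have := sq_nonneg ‖kf (y n) p‖
      linarith
  obtain ⟨φ, hφ, v0, hv⟩ := wk_sub 6 (v := ![fun n => ef (y n), fun n => qf (y n), fun n => zf (y n), fun n => erf (y n), fun n => qrf (y n), fun n => kf (y n)])
    (fun i n => by
      obtain ⟨h1,h2,h3,h4,h5,h6⟩ := cf n
      fin_cases i
      exacts [h2, h3, (Z n).c, h4, h5, h6]) (C := C) (fun i n => by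
      obtain ⟨h1,h2,h3,h4,h5,h6⟩ := B n
      fin_cases i
      exacts [h1,h2,h3,h4,h5,h6])
  have we : WK (fun n => ef (y (φ n))) (v0 0) := hv 0
  have wq : WK (fun n => qf (y (φ n))) (v0 1) := hv 1
  have wz : WK (fun n => zf (y (φ n))) (v0 2) := hv 2
  have wer : WK (fun n => erf (y (φ n))) (v0 3) := hv 3
  have wqr : WK (fun n => qrf (y (φ n))) (v0 4) := hv 4
  have wk : WK (fun n => kf (y (φ n))) (v0 5) := hv 5
  have hsum : ∀ (n : ℕ) (a b : Fe) (u : Fe), Continuous a → Continuous b → Continuous u → (∫ p, ‖p.1^2 • a p‖^2 ∂nu ≤ C) → (∫ p, ‖p.1^2 • b p‖^2 ∂nu ≤ C) →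
      (∀ p ∈ Om 0 1, ‖u p‖ ≤ ‖a p‖ + ‖b p‖) → ∫ p, ‖p.1^2 • u p‖^2 ∂nu ≤ 2*C+2*C := fun n a b u ca cb cu ha hb hu => by
    refine r_mono (a := u) (w := fun p => 2*‖p.1^2 • a p‖^2+2*‖p.1^2 • b p‖^2) cu fp ?_ fun p hp => ?_
    · rw [integral_add cof cof, integral_const_mul, integral_const_mul]
      linarith
    · simp only [norm_smul, mul_pow, norm_pow, rnn hp.1.1.le]
      have := pow_le_pow_left₀ no (hu p hp) 2
      have h2 := mln (show ‖u p‖^2 ≤ 2*‖a p‖^2+2*‖b p‖^2 by nlinarith [sq_nonneg (‖a p‖-‖b p‖)]) (show 0 ≤ p.1^4 by have := hp.1.1; positivity)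
      nlinarith
  have rE := rellich (fun n => E (φ n)) we wer (C := 2*C+2*C) (fun n => by
    obtain ⟨h1,h2,h3,h4,h5,h6⟩ := cf (φ n)
    refine hsum n _ _ _ h3 h5 (E (φ n)).ct (B _).2.1 (B _).2.2.2.2.1 fun p hp => ?_
    refine (norm_add_le _ _).trans (add_le_add le_rfl ?_)
    rw [norm_smul, rnn hp.1.1.le]
    exact mul_le_of_le_one_left no hp.1.2.le)
  have rQ := rellich (fun n => Q (φ n)) wq wqr (C := 2*C+2*C) (fun n => by
    obtain ⟨h1,h2,h3,h4,h5,h6⟩ := cf (φ n)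
    refine hsum n _ _ _ h6 h2 (Q (φ n)).ct (B _).2.2.2.2.2 (B _).1 fun p hp => ?_
    refine (norm_sub_le _ _).trans (add_le_add ?_ le_rfl)
    rw [norm_smul, rnn hp.1.1.le]
    exact mul_le_of_le_one_left no hp.1.2.le)
  have rZ := rellich (fun n => Z (φ n)) wz wer.zr (C := 2*C+2*C) (fun n => by
    obtain ⟨h1,h2,h3,h4,h5,h6⟩ := cf (φ n)
    refine hsum n _ _ _ h5 h5 (Z (φ n)).ct (B _).2.2.2.2.1 (B _).2.2.2.2.1 fun p hp => ?_
    unfold ztf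
    rw [norm_neg, norm_smul, norm_pow, rnn hp.1.1.le]
    exact (mul_le_of_le_one_left no (pow_le_one₀ hp.1.1.le hp.1.2.le)).trans (le_add_of_nonneg_left no))
  have iG : ∀ n, Integrable (fun p => p.1 * G2 Δ (y (φ n)) p) nu := fun n => by
    have := G2_cont (hy (φ n)) Δ
    exact cont_Om fp _ _
  have G0 : ∀ n p, 0 ≤ G2 Δ (y n) p := fun n p => by unfold G2; positivity
  have rG : Tendsto (fun n => ∫ p, p.1 * G2 Δ (y (φ n)) p ∂nu) atTop (𝓝 0) := by
    refine squeeze_zero (fun n => setIntegral_nonneg oM fun p hp => mul_nonneg hp.1.1.le (G0 _ _)) (fun n => (hB (φ n)).g) ?_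
    have := ((ht.comp hφ.tendsto_atTop).pow 2).const_mul C
    simpa using this
  have tot : Tendsto (fun n => ∫ p, (((‖p.1^3 • (ef (y (φ n)) p - v0 0 p)‖^2 + ‖p.1^3 • (qf (y (φ n)) p - v0 1 p)‖^2) + ‖p.1^3 • (zf (y (φ n)) p - v0 2 p)‖^2) + p.1 * G2 Δ (y (φ n)) p) ∂nu) atTop (𝓝 0) := by
    have := ((rE.2.add rQ.2).add rZ.2).add rG
    simp only [add_zero] at this
    refine this.congr fun n => ?_
    rw [integral_add (((rE.1 n).fun_add (rQ.1 n)).fun_add (rZ.1 n)) (iG n), integral_add ((rE.1 n).fun_add (rQ.1 n)) (rZ.1 n), integral_add (rE.1 n) (rQ.1 n)]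
  obtain ⟨ψ, hψ, hae⟩ := ae_sub (fun n => (((rE.1 n).add (rQ.1 n)).add (rZ.1 n)).add (iG n)) (fun n p hp => by
    have := mul_nonneg hp.1.1.le (G0 (φ n) p)
    simp only [Pi.add_apply]
    positivity) tot
  simp only [Pi.add_apply] at hae
  have conv : ∀ᵐ p ∂nu, Tendsto (fun n => ef (y (φ (ψ n))) p) atTop (𝓝 (v0 0 p)) ∧ Tendsto (fun n => qf (y (φ (ψ n))) p) atTop (𝓝 (v0 1 p)) ∧
     Tendsto (fun n => zf (y (φ (ψ n))) p) atTop (𝓝 (v0 2 p)) ∧ Tendsto (fun n => G2 Δ (y (φ (ψ n))) p) atTop (𝓝 0) := by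
    filter_upwards [hae, nu_ae (P := fun p => p ∈ Om 0 1) fun p hp => hp] with p h hp
    have hp1 := hp.1.1
    refine ⟨conv_of hp1 (squeeze_zero (fun _ => by positivity) (fun n => ?_) h), conv_of hp1 (squeeze_zero (fun _ => by positivity) (fun n => ?_) h), conv_of hp1 (squeeze_zero (fun _ => by positivity) (fun n => ?_) h), ?_⟩
    iterate 3
      have := mul_nonneg hp.1.1.le (G0 (φ (ψ n)) p)
      have := sq_nonneg ‖p.1^3 • (ef (y (φ (ψ n))) p - v0 0 p)‖
      have := sq_nonneg ‖p.1^3 • (qf (y (φ (ψ n))) p - v0 1 p)‖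
      have := sq_nonneg ‖p.1^3 • (zf (y (φ (ψ n))) p - v0 2 p)‖
      linarith
    have : Tendsto (fun n => p.1 * G2 Δ (y (φ (ψ n))) p) atTop (𝓝 0) := squeeze_zero (fun _ => mul_nonneg hp1.le (G0 _ _)) (fun n => by
      have := sq_nonneg ‖p.1^3 • (ef (y (φ (ψ n))) p - v0 0 p)‖
      have := sq_nonneg ‖p.1^3 • (qf (y (φ (ψ n))) p - v0 1 p)‖
      have := sq_nonneg ‖p.1^3 • (zf (y (φ (ψ n))) p - v0 2 p)‖
      linarith) h
    have := this.const_mul (p.1⁻¹)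
    rw [mul_zero] at this
    refine this.congr fun n => ?_
    field_simp
  have cons : ∀ᵐ p ∂nu, ‖v0 0 p‖^2 = 1 ∧ ‖v0 1 p‖^2 = 1 - Δ^2 ∧ inner ℝ (v0 0 p) (v0 1 p) = 0 := by
    filter_upwards [conv] with p ⟨h1,h2,_,h4⟩
    have := ((((h1.norm.pow 2).sub_const 1).pow 2).add (((h1.inner (𝕜 := ℝ) h2).pow 2).const_mul 2)).add (((h2.norm.pow 2).sub_const dD).pow 2)
    have u := tendsto_nhds_unique this h4
    have a1 := sq_nonneg (‖v0 0 p‖^2 - 1)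
    have a2 := sq_nonneg (inner ℝ (v0 0 p) (v0 1 p))
    have a3 := sq_nonneg (‖v0 1 p‖^2 - dD)
    refine ⟨sub_eq_zero.1 (pow_eq_zero_iff two_ne_zero |>.1 la), sub_eq_zero.1 (pow_eq_zero_iff two_ne_zero |>.1 la), (pow_eq_zero_iff two_ne_zero |>.1 la)⟩
  exact ⟨φ ∘ ψ, hφ.comp hψ, v0 0, v0 1, v0 2, v0 3, v0 4, v0 5, ⟨fun n => hy _, we.sub hψ, wq.sub hψ, wz.sub hψ, wer.sub hψ, wqr.sub hψ, wk.sub hψ,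
    conv.mono fun p h => h.1, conv.mono fun p h => h.2.1, conv.mono fun p h => h.2.2.1, cons.mono fun p h => h.1, cons.mono fun p h => h.2.1, cons.mono fun p h => h.2.2⟩, tot.comp hψ.tendsto_atTop⟩
end

section
theorem diag_deriv {f f₁ f₂ : ℝ → ℝ → ℝ} (h1 : ∀ s t, HasDerivAt (fun s' => f s' t) (f₁ s t) s) (h2 : ∀ s t, HasDerivAt (fun t' => f s t') (f₂ s t) t)
    (c1 : Continuous fun p : Q2 => f₁ p.1 p.2) (c2 : Continuous fun p : Q2 => f₂ p.1 p.2) (r : ℝ) :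
    HasDerivAt (fun s => f s s) (f₁ r r + f₂ r r) r := by
  have := hasStrictFDerivAt_uncurry_coprod (𝕜 := ℝ) (u := (r,r)) (f := f) (f₁ := fun s t => ContinuousLinearMap.toSpanSingleton ℝ (f₁ s t))
    (f₂ := fun s t => ContinuousLinearMap.toSpanSingleton ℝ (f₂ s t)) (.of_forall fun v => (h1 v.1 v.2).hasFDerivAt) (.of_forall fun v => (h2 v.1 v.2).hasFDerivAt)
    (by
      apply Continuous.continuousAt
      exact (ContinuousLinearMap.toSpanSingletonCLE (𝕜 := ℝ) (E := ℝ)).continuous.comp c1)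
    (by
      apply Continuous.continuousAt
      exact (ContinuousLinearMap.toSpanSingletonCLE (𝕜 := ℝ) (E := ℝ)).continuous.comp c2)
  have h3 := HasFDerivAt.comp_hasDerivAt (f := fun s : ℝ => ((s, s) : Q2)) r this.hasFDerivAt ((hasDerivAt_id r).prodMk (hasDerivAt_id r))
  refine h3.congr_deriv ?_
  simp [Function.HasUncurry.uncurry]

/-- partially C¹, equal at ±π -/
structure TS (F Fr Ft : Fs) : Prop where
  hr : ∀ r θ, HasDerivAt (fun s => F (s, θ)) (Fr (r, θ)) r
  ht : ∀ r θ, HasDerivAt (fun s => F (r, s)) (Ft (r, θ)) θ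
  c : Continuous F
  cr : Continuous Fr
  ct : Continuous Ft
  pi : ∀ r, F (r, π) = F (r, -π)
  one : ∀ θ, F (1, θ) = 0

theorem ibp_r {F Fr Ft : Fs} (h : TS F Fr Ft) (h0 : ∀ θ, F (0, θ) = 0) : ∫ p, Fr p ∂nu = 0 := by
  rw [Om_iter h.cr zero_le_one]
  have : iR JJ Fr r = JJ F 1 - JJ F 0 := ii_ftc (fun r _ => J_deriv h.c h.cr h.hr r)
    (ii_cont (J_cont h.cr))
  refine this.trans ?_
  simp [JJ, h0, h.one]

theorem ibp_t {F Fr Ft : Fs} (h : TS F Fr Ft) : ∫ p, Ft p ∂nu = 0 := by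
  have hc := h.ct
  rw [Om_iter h.ct zero_le_one]
  have : ∀ r, iH Ft (r,θ) = 0 := fun r => by
    rw [intervalIntegral.integral_eq_sub_of_hasDerivAt (f := fun θ => F (r,θ)) (fun t _ => h.ht r t) cf2, h.pi, sub_self]
  simp [this]

theorem wedge0 {F Fr Ft g gr gt : Fs} (h : TS F Fr Ft) (h0 : ∀ θ, F (0, θ) = 0) (hg : PC1 g gr gt) :
    ∫ p, (Fr p * gt p - Ft p * gr p) ∂nu = 0 := by
  obtain ⟨c1, c2, c3, c4, c5, c6⟩ : _ ∧ _ ∧ _ ∧ _ ∧ _ ∧ _ := ⟨h.c, h.cr, h.ct, hg.c, hg.cr, hg.ct⟩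
  have K : ∀ s t, iH F (s,θ) * gt (t,θ) = iH - (Ft (s,θ) * g (t,θ)) := fun s t => by
    have := intervalIntegral.integral_eq_sub_of_hasDerivAt (a := -π) (b := π) (f := fun θ => F (s,θ) * g (t,θ)) (fun θ _ => (h.ht s θ).mul (hg.ht t θ))
      cf2
    rw [h.pi, hg.pi, sub_self, ii_add cf2 cf2] at this
    rw [intervalIntegral.integral_neg]; linarith
  have d := fun r => diag_deriv (f := fun s t => iH F (s,θ) * gt (t,θ)) (f₁ := fun s t => iH Fr (s,θ) * gt (t,θ))
    (f₂ := fun s t => iH -(Ft (s,θ) * gr (t,θ)))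
    (fun s t => J_deriv (F := fun p => F p * gt (t, p.2)) (Fr := fun p => Fr p * gt (t,p.2)) fp fp
      (fun r θ => (h.hr r θ).mul_const (gt (t,θ))) s)
    (fun s t => by
      simp_rw [K]
      exact J_deriv (F := fun p => -(Ft (s,p.2) * g p)) (Fr := fun p => -(Ft (s, p.2) * gr p)) fp fp
        (fun r θ => ((hg.hr r θ).const_mul (Ft (s,θ))).fun_neg) t)
    (intervalIntegral.continuous_parametric_intervalIntegral_of_continuous (f := fun (p : Q2) θ => Fr (p.1, θ) * gt (p.2, θ)) (by
      unfold Function.uncurry; fun_prop) continuous_const)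
    (intervalIntegral.continuous_parametric_intervalIntegral_of_continuous (f := fun (p : Q2) θ => -(Ft (p.1, θ) * gr (p.2, θ))) (by
      unfold Function.uncurry; fun_prop) continuous_const) r
  rw [Om_iter fp zero_le_one]
  have e : ∀ r, iH (Fr (r,θ) * gt (r,θ) - Ft (r,θ) * gr (r,θ)) = (iH Fr (r,θ) * gt (r,θ)) + iH -(Ft (r,θ) * gr (r,θ)) := fun r => by
    rw [← ii_add cf2 cf2]
    congr 1
  have ci : Continuous (fun r => iH (Fr (r,θ) * gt (r,θ) - Ft (r,θ) * gr (r,θ))) := J_cont (F := fun p => Fr p * gt p - Ft p * gr p) fp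
  rw [intervalIntegral.integral_eq_sub_of_hasDerivAt (f := fun s => iH F (s,θ) * gt (s,θ)) (fun r _ => by rw [e]; exact d r) (ii_cont ci)]
  simp [h0, h.one]

/-- class of scalar fields -/
structure HF (u ur ut : ℕ → Fs) (u0 ur0 ut0 : Fs) : Prop where
  pc : ∀ n, PC1 (u n) (ur n) (ut n)
  bd : ∃ M, ∀ n p, |u n p| ≤ M
  ae : ∀ᵐ p ∂nu, Tendsto (fun n => u n p) atTop (𝓝 (u0 p))
  wr : WK ur ur0
  wt : WK ut ut0

theorem WK.s {v : ℕ → Fs} {v0} (h : WK v v0) {φ : Fs} (hφ : MemLp φ 2 nu) :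
    Tendsto (fun n => ∫ p, φ p * (p.1^2 * v n p) ∂nu) atTop (𝓝 (∫ p, φ p * (p.1^2 * v0 p) ∂nu)) := by
  have := h.w (fun p => φ p • ContinuousLinearMap.id ℝ ℝ) (by
    refine MemLp.of_le_mul (c := 1) hφ (hφ.1.smul_const _) (.of_forall fun p => ?_)
    rw [norm_smul, mul_comm]; gcongr; exact ContinuousLinearMap.norm_id_le)
  simpa using this

theorem HF.m0 {u ur ut : ℕ → Fs} {u0 ur0 ut0} (h : HF u ur ut u0 ur0 ut0) : AEStronglyMeasurable u0 nu ∧ ∃ M, (∀ n p, |u n p| ≤ M) ∧ ∀ᵐ p ∂nu, |u0 p| ≤ M := by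
  obtain ⟨M, hM⟩ := h.bd
  refine ⟨aestronglyMeasurable_of_tendsto_ae atTop (fun n => (h.pc n).c.aestronglyMeasurable) h.ae, M, hM, ?_⟩
  filter_upwards [h.ae] with p hp
  exact le_of_tendsto hp.abs (.of_forall fun n => hM n p)

theorem HF.s {u ur ut : ℕ → Fs} {u0 ur0 ut0} (h : HF u ur ut u0 ur0 ut0) {φ : Fs} (hφ : Integrable φ nu) :
    Tendsto (fun n => ∫ p, u n p * φ p ∂nu) atTop (𝓝 (∫ p, u0 p * φ p ∂nu)) := by
  obtain ⟨-, M, hM, -⟩ := h.m0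
  refine tendsto_integral_of_dominated_convergence (fun p => M * ‖φ p‖) (fun n => (h.pc n).c.aestronglyMeasurable.mul hφ.1) (hφ.norm.const_mul _) (fun n => .of_forall fun p => ?_) ?_
  · rw [norm_mul]; exact mul_le_mul_of_nonneg_right (hM n p) no
  · filter_upwards [h.ae] with p hp
    exact hp.mul_const _

theorem HF.IBP_r {u ur ut : ℕ → Fs} {u0 ur0 ut0} (h : HF u ur ut u0 ur0 ut0) {η ηr ηt} (hη : TS η ηr ηt) :
    (∫ p, u0 p * hR3 ∂nu) + ∫ p, (p.1^2 * η p) * (p.1^2 * ur0 p) ∂nu = 0 := by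
  obtain ⟨d1, d2, d3⟩ : _ ∧ _ ∧ _ := ⟨hη.c, hη.cr, hη.ct⟩
  have H := (h.s (φ := fun p => 4*p.1^3*η p + p.1^4*ηr p) cof).add (h.wr.s (φ := fun p => p.1^2 * η p) (cont_mlp fp))
  refine tendsto_nhds_unique H (tendsto_const_nhds.congr fun n => ?_)
  obtain ⟨c1, c2, c3⟩ : _ ∧ _ ∧ _ := ⟨(h.pc n).c, (h.pc n).cr, (h.pc n).ct⟩
  rw [← integral_add cof cof]
  refine (Eq.trans ?_ (ibp_r (F := fun p => p.1^4 * η p * u n p) (Fr := fun p => hR3 * u n p + p.1^4 * η p * ur n p)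
    (Ft := fun p => p.1^4*ηt p * u n p + p.1^4*η p * ut n p) ⟨fun r θ => ?_, fun r θ => ?_, by fun_prop, by fun_prop, by fun_prop, fun r => ?_, fun θ => ?_⟩ fun θ => ?_)).symm
  · congr 1; ext p; ring
  · exact (((hasDerivAt_pow 4 r).fun_mul (hη.hr r θ)).fun_mul ((h.pc n).hr r θ)).congr_deriv (by simp)
  · exact (((hη.ht r θ).const_mul (r^4)).fun_mul ((h.pc n).ht r θ))
  · simp [hη.pi, (h.pc n).pi]
  · simp [hη.one]
  · simp

theorem HF.IBP_t {u ur ut : ℕ → Fs} {u0 ur0 ut0} (h : HF u ur ut u0 ur0 ut0) {η ηr ηt} (hη : TS η ηr ηt) :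
    (∫ p, u0 p * (p.1^4*ηt p) ∂nu) + ∫ p, (p.1^2 * η p) * (p.1^2 * ut0 p) ∂nu = 0 := by
  obtain ⟨d1, d2, d3⟩ : _ ∧ _ ∧ _ := ⟨hη.c, hη.cr, hη.ct⟩
  have H := (h.s (φ := fun p => p.1^4*ηt p) cof).add (h.wt.s (φ := fun p => p.1^2 * η p) (cont_mlp fp))
  refine tendsto_nhds_unique H (tendsto_const_nhds.congr fun n => ?_)
  obtain ⟨c1, c2, c3⟩ : _ ∧ _ ∧ _ := ⟨(h.pc n).c, (h.pc n).cr, (h.pc n).ct⟩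
  rw [← integral_add cof cof]
  refine (Eq.trans ?_ (ibp_t (F := fun p => p.1^4 * η p * u n p) (Fr := fun p => hR3 * u n p + p.1^4 * η p * ur n p)
    (Ft := fun p => p.1^4*ηt p * u n p + p.1^4*η p * ut n p) ⟨fun r θ => ?_, fun r θ => ?_, by fun_prop, by fun_prop, by fun_prop, fun r => ?_, fun θ => ?_⟩)).symm
  · congr 1; ext p; ring
  · exact (((hasDerivAt_pow 4 r).fun_mul (hη.hr r θ)).fun_mul ((h.pc n).hr r θ)).congr_deriv (by simp)
  · exact (((hη.ht r θ).const_mul (r^4)).fun_mul ((h.pc n).ht r θ))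
  · simp [hη.pi, (h.pc n).pi]
  · simp [hη.one]

theorem mlp_c {f φ : Fs} (hf : MemLp f 2 nu) (hφ : Continuous φ) : MemLp (fun p => φ p * f p) 2 nu := by
  obtain ⟨C, hC⟩ := (isCompact_Icc.prod isCompact_Icc : IsCompact (Set.Icc zR 1 ×ˢ Set.Icc (-π) π)).exists_bound_of_continuousOn hφ.continuousOn
  refine MemLp.of_le_mul (c := C) hf (hφ.aestronglyMeasurable.mul hf.1) (nu_ae fun p hp => ?_)
  rw [norm_mul]; gcongr; exact hC p (Om_sub _ _ hp)

theorem LW {u ur ut v vr vt : ℕ → Fs} {u0 ur0 ut0 v0 vr0 vt0} (hu : HF u ur ut u0 ur0 ut0) (hv : HF v vr vt v0 vr0 vt0) {η ηr ηt} (hη : TS η ηr ηt) :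
    (∫ p, u0 p * (hE * (p.1^2 * vt0 p) - (p.1^2 * ηt p) * (p.1^2 * vr0 p)) ∂nu) +
      ((∫ p, (η p * (p.1^2 * vt0 p)) * (p.1^2 * ur0 p) ∂nu) - ∫ p, (η p * (p.1^2 * vr0 p)) * (p.1^2 * ut0 p) ∂nu) = 0 := by
  obtain ⟨d1, d2, d3⟩ : _ ∧ _ ∧ _ := ⟨hη.c, hη.cr, hη.ct⟩
  have mt := hv.wt.m
  have mr := hv.wr.m
  simp only [smul_eq_mul] at mt mr
  have i1 : MemLp (fun p => hE * (p.1^2 * vt0 p)) 2 nu := mlp_c mt (φ := fun p => 4*p.1*η p + p.1^2*ηr p) fp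
  have i2 : MemLp (fun p => (p.1^2*ηt p) * (p.1^2 * vr0 p)) 2 nu := mlp_c mr (φ := fun p => p.1^2*ηt p) fp
  have H := (hu.s (φ := fun p => hE * (p.1^2 * vt0 p) - (p.1^2 * ηt p) * (p.1^2 * vr0 p))
    ((i1.sub i2).integrable nrm0)).add ((hu.wr.s (mlp_c mt d1)).sub (hu.wt.s (mlp_c mr d1)))
  refine tendsto_nhds_unique H (tendsto_const_nhds.congr fun m => ?_)
  obtain ⟨c1, c2, c3⟩ : _ ∧ _ ∧ _ := ⟨(hu.pc m).c, (hu.pc m).cr, (hu.pc m).ct⟩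
  have cA : Continuous fun p => hE * u m p + p.1^2 * η p * ur m p := by fun_prop
  have cB : Continuous fun p => (p.1^2*ηt p) * u m p + p.1^2 * η p * ut m p := by fun_prop
  have H2 := (hv.wt.s (cont_mlp cA)).sub (hv.wr.s (cont_mlp cB))
  have z : (∫ p, (hE * u m p + p.1^2 * η p * ur m p) * (p.1^2 * vt0 p) ∂nu) - ∫ p, ((p.1^2*ηt p) * u m p + p.1^2 * η p * ut m p) * (p.1^2 * vr0 p) ∂nu = 0 := by
    refine tendsto_nhds_unique H2 (tendsto_const_nhds.congr fun n => ?_)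
    obtain ⟨b1, b2, b3⟩ : _ ∧ _ ∧ _ := ⟨(hv.pc n).c, (hv.pc n).cr, (hv.pc n).ct⟩
    rw [← integral_sub cof cof]
    refine (Eq.trans ?_ (wedge0 (F := fun p => p.1^4 * η p * u m p) (Fr := fun p => hR3 * u m p + p.1^4 * η p * ur m p)
      (Ft := fun p => p.1^4*ηt p * u m p + p.1^4*η p * ut m p) ⟨fun r θ => ?_, fun r θ => ?_, by fun_prop, by fun_prop, by fun_prop, fun r => ?_, fun θ => ?_⟩ (fun θ => ?_) (hv.pc n))).symm
    · congr 1; ext p; ring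
    · exact (((hasDerivAt_pow 4 r).fun_mul (hη.hr r θ)).fun_mul ((hu.pc m).hr r θ)).congr_deriv (by simp)
    · exact (((hη.ht r θ).const_mul (r^4)).fun_mul ((hu.pc m).ht r θ))
    · simp [hη.pi, (hu.pc m).pi]
    · simp [hη.one]
    · simp
  have I1 : Integrable (fun p => (hE * u m p + p.1^2 * η p * ur m p) * (p.1^2 * vt0 p)) nu := (mlp_c mt cA).integrable nrm0
  have I2 : Integrable (fun p => ((p.1^2*ηt p) * u m p + p.1^2 * η p * ut m p) * (p.1^2 * vr0 p)) nu := (mlp_c mr cB).integrable nrm0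
  have I3 : Integrable (fun p => (η p * (p.1^2 * vt0 p)) * (p.1^2 * ur m p)) nu := ((mlp_c mt (φ := fun p => η p * (p.1^2 * ur m p)) fp).integrable nrm0).congr (.of_forall fun p => by dsimp only; ring)
  have I4 : Integrable (fun p => (η p * (p.1^2 * vr0 p)) * (p.1^2 * ut m p)) nu := ((mlp_c mr (φ := fun p => η p * (p.1^2 * ut m p)) fp).integrable nrm0).congr (.of_forall fun p => by dsimp only; ring)
  have I5 : Integrable (fun p => u m p * (hE * (p.1^2 * vt0 p) - (p.1^2 * ηt p) * (p.1^2 * vr0 p))) nu := 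
    (((mlp_c i1 c1).sub (mlp_c i2 c1)).integrable nrm0).congr (.of_forall fun p => by simp only [Pi.sub_apply]; ring)
  rw [← integral_sub I1 I2] at z
  rw [← integral_sub I3 I4, ← integral_add I5 (I3.sub' I4), ← z]
  congr 1; ext p; ring
end

section
abbrev WW := E3 × E3 × E3

theorem PC1.prod {V V' : Type*} [NormedAddCommGroup V] [NormedSpace ℝ V] [NormedAddCommGroup V'] [NormedSpace ℝ V'] {f fr ft : Q2 → V} {g gr gt : Q2 → V'}
    (h : PC1 f fr ft) (h' : PC1 g gr gt) : PC1 (fun p => (f p, g p)) (fun p => (fr p, gr p)) (fun p => (ft p, gt p)) :=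
  ⟨fun r θ => (h.hr r θ).prodMk (h'.hr r θ), fun r θ => (h.ht r θ).prodMk (h'.ht r θ), h.c.prodMk h'.c, h.cr.prodMk h'.cr, h.ct.prodMk h'.ct,
    fun r θ => by rw [h.per, h'.per]⟩

theorem WK.lin {V V' : Type*} [NormedAddCommGroup V] [NormedSpace ℝ V] [NormedAddCommGroup V'] [NormedSpace ℝ V'] {v : ℕ → Q2 → V} {v0} (h : WK v v0) (L : V →L[ℝ] V') :
    WK (fun n p => L (v n p)) (fun p => L (v0 p)) :=
  h.var (L := fun _ _ => L) (L0 := fun _ => L) (C := ‖L‖) (fun _ => continuous_const) (fun _ _ _ => le_rfl) (.of_forall fun _ => tendsto_const_nhds)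

theorem WK.prod {V V' : Type*} [NormedAddCommGroup V] [NormedSpace ℝ V] [NormedAddCommGroup V'] [NormedSpace ℝ V'] {v : ℕ → Q2 → V} {v0} (h : WK v v0)
    {v' : ℕ → Q2 → V'} {v0'} (h' : WK v' v0') : WK (fun n p => (v n p, v' n p)) (fun p => (v0 p, v0' p)) := by
  simpa using (h.lin (.inl ℝ V V')).add (h'.lin (.inr ℝ V V'))

theorem WK.rmul {v : ℕ → Fe} {v0} (h : WK v v0) (m : ℕ) : WK (fun n p => p.1^m • v n p) (fun p => p.1^m • v0 p) := by
  have := h.var (L := fun _ p => p.1^m • ContinuousLinearMap.id ℝ E3) (L0 := fun p => p.1^m • ContinuousLinearMap.id ℝ E3) (C := 1) (fun n => by fun_prop) (fun n p hp => by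
    have h1 : 0 < p.1 := hp.1.1
    have h2 : p.1 < 1 := hp.1.2
    rw [norm_smul, rnn pv]
    calc _ ≤ 1 * (1:ℝ) := mul_le_mul (pow_le_one₀ h1.le h2.le) ContinuousLinearMap.norm_id_le no zero_le_one
      _ = 1 := one_mul _) (.of_forall fun _ => tendsto_const_nhds)
  simpa using this

theorem WK.neg {V : Type*} [NormedAddCommGroup V] [NormedSpace ℝ V] {v : ℕ → Q2 → V} {v0} (h : WK v v0) : WK (fun n p => -(v n p)) (fun p => -(v0 p)) := by
  simpa using h.lin (-(ContinuousLinearMap.id ℝ V))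

def Xf (y : YY) (p : Q2) : WW := (ef y p, qf y p, zf y p)
def Xrf (y : YY) (p : Q2) : WW := (erf y p, qrf y p, zrf y p)
def Xtf (y : YY) (p : Q2) : WW := (etf y p, qtf y p, ztf y p)
def Xr0 (er qr : Fe) (p : Q2) : WW := (er p, qr p, -(p.1 • er p))
def Xt0 (e q qr k : Fe) (p : Q2) : WW := (q p + p.1 • qr p, p.1 • k p - e p, -(p.1^2 • qr p))

theorem X_pc1 {y : YY} (hy : CDy) : PC1 (Xf y) (Xrf y) (Xtf y) := (e_pc1 hy).prod ((q_pc1 hy).prod (z_pc1 hy))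

section
variable {Δ : ℝ} {y : ℕ → YY} {e q z er qr k : Fe}

theorem Lim.xr (h : Lm) : WK (fun n => Xrf (y n)) (Xr0 er qr) := h.wer.prod (h.wqr.prod h.wer.zr)

theorem Lim.xt (h : Lm) : WK (fun n => Xtf (y n)) (Xt0 e q qr k) := by
  have h1 := h.wq.add (h.wqr.rmul 1)
  have h2 := (h.wk.rmul 1).add h.we.neg
  have := h1.prod (h2.prod (h.wqr.rmul 2).neg)
  simp only [pow_one, ← sub_eq_add_neg] at this
  exact this

theorem Lim.xae (h : Lm) : ∀ᵐ p ∂nu, Tendsto (fun n => Xf (y n) p) atTop (𝓝 X3) := by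
  filter_upwards [h.ae, h.aq, h.az] with p h1 h2 h3
  exact h1.prodMk_nhds (h2.prodMk_nhds h3)

structure Cb (G : WW → ℝ) : Prop where
  c : ContDiff ℝ 1 G
  b : ∃ M, ∀ x, |G x| ≤ M
  d : ∃ M, ∀ x, ‖fderiv ℝ G x‖ ≤ M

theorem Cb.of {V : Type*} [NormedAddCommGroup V] [NormedSpace ℝ V] {f : V → ℝ} (hf : ContDiff ℝ 1 f) (hs : HasCompactSupport f) (L : WW →L[ℝ] V) : Cb (fun x => f (L x)) := by
  obtain ⟨M, hM⟩ := hf.continuous.bounded_above_of_compact_support hs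
  obtain ⟨M', hM'⟩ := (hf.continuous_fderiv one_ne_zero).bounded_above_of_compact_support (hs.fderiv ℝ)
  refine ⟨hf.comp L.contDiff, ⟨M, fun x => hM _⟩, M' * ‖L‖, fun x => ?_⟩
  rw [fderiv_fun_comp (g := f) x (hf.differentiable one_ne_zero _) L.differentiableAt, L.fderiv]
  exact (ContinuousLinearMap.opNorm_comp_le _ _).trans (by gcongr; exact hM' _)

theorem Cb.hf {G : WW → ℝ} (hG : Cb G) (h : Lm) : HF (fun n p => G (Xf (y n) p)) (fun n p => fderiv ℝ G (Xf (y n) p) (Xrf (y n) p)) (fun n p => fderiv ℝ G (Xf (y n) p) (Xtf (y n) p))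
    (fun p => G X3) (fun p => fderiv ℝ G X3 R3) (fun p => fderiv ℝ G X3 T3) := by
  have X := fun n => X_pc1 (h.cd n)
  have cG := hG.c.continuous
  have cd := hG.c.continuous_fderiv one_ne_zero
  have dG : ∀ x, HasFDerivAt G (fderiv ℝ G x) x := fun x => (hG.c.differentiable one_ne_zero x).hasFDerivAt
  obtain ⟨M, hM⟩ := hG.d
  refine ⟨fun n => ⟨fun r θ => ?_, fun r θ => ?_, ?_, ?_, ?_, fun r θ => ?_⟩, hG.b.imp fun M hM n p => hM _, ?_, ?_, ?_⟩
  · exact (dG _).comp_hasDerivAt r ((X n).hr r θ)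
  · exact (dG _).comp_hasDerivAt θ ((X n).ht r θ)
  · exact cG.comp (X n).c
  · exact (cd.comp (X n).c).clm_apply (X n).cr
  · exact (cd.comp (X n).c).clm_apply (X n).ct
  · simp only [(X n).per]
  · filter_upwards [h.xae] with p hp
    exact (cG.tendsto _).comp hp
  · refine h.xr.var (L := fun n p => fderiv ℝ G (Xf (y n) p)) (L0 := fun p => fderiv ℝ G X3) (C := M) (fun n => cd.comp (X n).c) (fun n p _ => hM _) ?_
    filter_upwards [h.xae] with p hp
    exact (cd.tendsto _).comp hp
  · refine h.xt.var (L := fun n p => fderiv ℝ G (Xf (y n) p)) (L0 := fun p => fderiv ℝ G X3) (C := M) (fun n => cd.comp (X n).c) (fun n p _ => hM _) ?_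
    filter_upwards [h.xae] with p hp
    exact (cd.tendsto _).comp hp

theorem cb_arctan {G : WW → ℝ} (hG : Cb G) (m : ℝ) (hm : 0 < m) : Cb (fun x => m⁻¹ * arctan (m * G x)) ∧ ∀ x, fderiv ℝ (fun x => m⁻¹ * arctan (m * G x)) x = (1 / (1 + (m * G x)^2)) • fderiv ℝ G x := by
  have dG : ∀ x, HasFDerivAt G (fderiv ℝ G x) x := fun x => (hG.c.differentiable one_ne_zero x).hasFDerivAt
  have fd : ∀ x, fderiv ℝ (fun x => m⁻¹ * arctan (m * G x)) x = (1 / (1 + (m * G x)^2)) • fderiv ℝ G x := fun x => by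
    rw [((((dG x).const_mul m).arctan).const_mul m⁻¹).fderiv, smul_smul, smul_smul]
    congr 1; field_simp
  refine ⟨⟨contDiff_const.mul (Real.contDiff_arctan.comp (contDiff_const.mul hG.c)), ⟨m⁻¹ * (π/2), fun x => ?_⟩, ?_⟩, fd⟩
  · rw [abs_mul, abs_of_pos (inv_pos.2 hm)]; gcongr
    exact abs_le.2 ⟨(neg_pi_div_two_lt_arctan _).le, (arctan_lt_pi_div_two _).le⟩
  · refine hG.d.imp fun M hM x => ?_
    rw [fd, norm_smul, rnn pv]
    calc _ ≤ 1 * ‖fderiv ℝ G x‖ := by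
          gcongr
          rw [div_le_one pv]; nlinarith [sq_nonneg (m * G x)]
      _ ≤ M := by rw [one_mul]; exact hM x

theorem ts_of {η : Fs} (hη : ContDiff ℝ ((⊤ : ℕ∞) : WithTop ℕ∞) η) (hs : tsupport η ⊆ Om 0 1) : TS η (fun p => fderiv ℝ η p (1,0)) (fun p => fderiv ℝ η p (0,1)) := by
  have cd := hη.continuous_fderiv (by simp)
  have z : ∀ p, p ∉ Om 0 1 → η p = 0 := fun p hp => image_eq_zero_of_notMem_tsupport fun h => hp (hs h)
  have d : ∀ p, HasFDerivAt η (fderiv ℝ η p) p := fun p => (hη.differentiable (by simp) p).hasFDerivAt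
  refine ⟨fun r θ => ?_, fun r θ => ?_, hη.continuous, by fun_prop, by fun_prop, fun r => ?_, fun θ => ?_⟩
  · exact (d (r,θ)).comp_hasDerivAt r ((hasDerivAt_id r).prodMk (hasDerivAt_const r θ))
  · exact (d (r,θ)).comp_hasDerivAt θ ((hasDerivAt_const θ r).prodMk (hasDerivAt_id θ))
  · rw [z _ (by simp [Om]), z _ (by simp [Om])]
  · rw [z _ (by simp [Om])]

theorem Om_open (a b : ℝ) : IsOpen (Om a b) := isOpen_Ioo.prod isOpen_Ioo

theorem dbr {f : Fs} (hf : Integrable f nu) (h : ∀ η : Fs, ContDiff ℝ ((⊤ : ℕ∞) : WithTop ℕ∞) η → tsupport η ⊆ Om 0 1 → ∫ p, η p * f p ∂nu = 0) : ∀ᵐ p ∂nu, f p = 0 := by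
  rw [ae_restrict_iff' oM]
  refine (Om_open 0 1).ae_eq_zero_of_integral_contDiff_smul_eq_zero (μ := volume) (f := f) ?_ fun g hg _ hs => ?_
  · exact (IntegrableOn.locallyIntegrableOn hf)
  · rw [← h g hg hs, setIntegral_eq_integral_of_forall_compl_eq_zero]
    · rfl
    · intro p hp
      rw [image_eq_zero_of_notMem_tsupport fun h => hp (hs h), zero_mul]

theorem lev_core {X0 D0 : Q2 → WW} (hX : AEStronglyMeasurable X0 nu) (hD : MemLp (fun p => p.1^2 • D0 p) 2 nu)
    (H : ∀ η : Fs, ContDiff ℝ ((⊤ : ℕ∞) : WithTop ℕ∞) η → tsupport η ⊆ Om 0 1 → ∃ φ, Integrable φ nu ∧ ∀ G, Cb G → (∫ p, G (X0 p) * φ p ∂nu) + ∫ p, (p.1^2 * η p) * (p.1^2 * fderiv ℝ G (X0 p) (D0 p)) ∂nu = 0)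
    {G : WW → ℝ} (hG : Cb G) : ∀ᵐ p ∂nu, G (X0 p) = 0 → fderiv ℝ G (X0 p) (D0 p) = 0 := by
  obtain ⟨M, hM⟩ := hG.d
  have cd := hG.c.continuous_fderiv one_ne_zero
  have cG := hG.c.continuous
  have mg : MemLp (fun p => p.1^2 * fderiv ℝ G (X0 p) (D0 p)) 2 nu := by
    refine MemLp.of_le_mul (c := M) hD ?_ (.of_forall fun p => ?_)
    · have := app_aesm (cd.comp_aestronglyMeasurable hX) hD.1
      simpa using this
    · calc _ = ‖fderiv ℝ G (X0 p) (p.1^2 • D0 p)‖ := by simp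
        _ ≤ _ := (ContinuousLinearMap.le_opNorm _ _).trans (by gcongr; exact hM _)
  have mi := mg.integrable (by norm_num : (1:ℝ≥0∞) ≤ 2)
  set S : Set (Q2) := {p | G (X0 p) = 0}
  have gm : AEStronglyMeasurable (fun p => G (X0 p)) nu := cG.comp_aestronglyMeasurable hX
  -- limit function
  let w : Fs := fun p => p.1^2 * (if G (X0 p) = 0 then p.1^2 * fderiv ℝ G (X0 p) (D0 p) else 0)
  have wt : ∀ p, Tendsto (fun m : ℕ => p.1^2 * aG) atTop (𝓝 (w p)) := fun p => by
    by_cases h0 : G (X0 p) = 0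
    · simp [w, h0]
    · simp only [w, h0, if_false, mul_zero]
      have t1 : Tendsto (fun m : ℕ => 1 + (m1R * G (X0 p))^2) atTop atTop := by
        refine tendsto_atTop_add_const_left _ _ ?_
        simp_rw [mul_pow]
        refine Tendsto.atTop_mul_const pv ?_
        exact (tendsto_pow_atTop two_ne_zero).comp (tendsto_atTop_add_const_right _ _ tendsto_natCast_atTop_atTop)
      have := ((t1.const_div_atTop 1).mul_const (p.1^2 * fderiv ℝ G (X0 p) (D0 p))).const_mul (p.1^2)
      simpa using this
  have wb : ∀ (m : ℕ), ∀ p ∈ Om 0 1, ‖p.1^2 * aG‖ ≤ ‖p.1^2 * fderiv ℝ G (X0 p) (D0 p)‖ := fun m p hp => by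
    have h1 : 0 < p.1 := hp.1.1
    have h2 : p.1 < 1 := hp.1.2
    rw [norm_mul, norm_mul (1 / _), rnn (by positivity : 0 ≤ p.1^2), rnn (by positivity : 0 ≤ 1 / (1 + (m1R * G (X0 p))^2)), ← mul_assoc]
    refine mul_le_of_le_one_left no (mul_le_one₀ (pow_le_one₀ h1.le h2.le) pv ?_)
    rw [div_le_one pv]; nlinarith [sq_nonneg (m1R * G (X0 p))]
  have am : ∀ m : ℕ, AEStronglyMeasurable (fun p : Q2 => p.1^2 * aG) nu := fun m => by
    refine AEStronglyMeasurable.mul fp (AEStronglyMeasurable.mul ?_ mg.1)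
    have cc : Continuous fun t : ℝ => 1 / (1 + (m1R * t)^2) := Continuous.div fp fp fun t => by positivity
    exact cc.comp_aestronglyMeasurable gm
  have wm : AEStronglyMeasurable w nu := aestronglyMeasurable_of_tendsto_ae atTop am (.of_forall wt)
  have wi : Integrable w nu := mi.mono wm (nu_ae fun p hp => le_of_tendsto (wt p).norm (.of_forall fun m => wb m p hp))
  have w0 : ∀ᵐ p ∂nu, w p = 0 := by
    refine dbr wi fun η hη hs => ?_
    obtain ⟨φ, hφ, hH⟩ := H η hη hs
    have cη := hη.continuous
    obtain ⟨B, hB⟩ := (isCompact_Icc.prod isCompact_Icc : IsCompact (Set.Icc zR 1 ×ˢ Set.Icc (-π) π)).exists_bound_of_continuousOn cη.continuousOn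
    have l1 : Tendsto (fun m : ℕ => ∫ p, η p * (p.1^2 * aG) ∂nu) atTop (𝓝 (∫ p, η p * w p ∂nu)) := by
      refine tendsto_integral_of_dominated_convergence (fun p => B * ‖p.1^2 * fderiv ℝ G (X0 p) (D0 p)‖) (fun m => cη.aestronglyMeasurable.mul (am m)) (mi.norm.const_mul _)
        (fun m => nu_ae fun p hp => ?_) (.of_forall fun p => (wt p).const_mul _)
      rw [norm_mul]
      have := hB p (Om_sub _ _ hp)
      exact mul_le_mul this (wb m p hp) no ((norm_nonneg _).trans this)
    have l2 : Tendsto (fun m : ℕ => ∫ p, η p * (p.1^2 * aG) ∂nu) atTop (𝓝 0) := by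
      have t : Tendsto (fun m : ℕ => m1R⁻¹ * ((π/2) * ∫ p, ‖φ p‖ ∂nu)) atTop (𝓝 0) := by
        have := (tendsto_inv_atTop_zero.comp (tendsto_atTop_add_const_right atTop (1:ℝ) tendsto_natCast_atTop_atTop)).mul_const ((π/2) * ∫ p, ‖φ p‖ ∂nu)
        simpa using this
      refine squeeze_zero_norm (fun m => ?_) t
      have hm : zR < (m:ℝ)+1 := by positivity
      obtain ⟨a1, a2⟩ := cb_arctan hG _ hm
      have h1 := hH _ a1
      simp only [a2] at h1
      have : ∫ p, η p * (p.1^2 * aG) ∂nu = -∫ p, m1R⁻¹ * arctan (m1R * G (X0 p)) * φ p ∂nu := by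
        rw [eq_neg_iff_add_eq_zero, add_comm, ← h1]
        congr 2; ext p; simp; ring
      rw [this, norm_neg, ← integral_const_mul, ← integral_const_mul]
      refine norm_integral_le_of_norm_le ((hφ.norm.const_mul _).const_mul _) (.of_forall fun p => ?_)
      rw [norm_mul, norm_mul, rnn (inv_pos.2 hm).le, mul_assoc]
      gcongr
      exact abs_le.2 ⟨(neg_pi_div_two_lt_arctan _).le, (arctan_lt_pi_div_two _).le⟩
    exact tendsto_nhds_unique l1 l2
  filter_upwards [w0, nu_ae (P := fun p => 0 < p.1) (fun p hp => hp.1.1)] with p hp h1 h2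
  simp only [w, h2, if_true] at hp
  have : p.1^2 ≠ 0 := by positivity
  simpa [this] using hp

theorem Lim.mX (h : Lm) : AEStronglyMeasurable (fun p => X3) nu :=
  aestronglyMeasurable_of_tendsto_ae atTop (fun n => (X_pc1 (h.cd n)).c.aestronglyMeasurable) h.xae

theorem Lim.lev_cb (h : Lm) {G : WW → ℝ} (hG : Cb G) : ∀ᵐ p ∂nu, G X3 = 0 → fderiv ℝ G X3 R3 = 0 ∧ fderiv ℝ G X3 T3 = 0 := by
  have h1 := lev_core h.mX h.xr.m (fun η hη hs => by
    have t := ts_of hη hs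
    obtain ⟨d1, d2, d3⟩ : _ ∧ _ ∧ _ := ⟨t.c, t.cr, t.ct⟩
    exact ⟨_, cont_Om (F := fun p => 4*p.1^3*η p + p.1^4*(fderiv ℝ η p (1,0))) fp _ _, fun G hG => (hG.hf h).IBP_r t⟩) hG
  have h2 := lev_core h.mX h.xt.m (fun η hη hs => by
    have t := ts_of hη hs
    obtain ⟨d1, d2, d3⟩ : _ ∧ _ ∧ _ := ⟨t.c, t.cr, t.ct⟩
    exact ⟨_, cont_Om (F := fun p => p.1^4*(fderiv ℝ η p (0,1))) fp _ _, fun G hG => (hG.hf h).IBP_t t⟩) hG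
  filter_upwards [h1, h2] with p h3 h4 h5
  exact ⟨h3 h5, h4 h5⟩

theorem Lim.lev (h : Lm) {g : WW → ℝ} (hg : ContDiff ℝ 1 g) : ∀ᵐ p ∂nu, g X3 = 0 → fderiv ℝ g X3 R3 = 0 ∧ fderiv ℝ g X3 T3 = 0 := by
  let χ : ℕ → ContDiffBump (0 : WW) := fun m => ⟨(m:ℝ)+1, (m:ℝ)+2, by positivity, by linarith⟩
  have := ae_all_iff.2 fun m : ℕ => h.lev_cb (G := fun x => χ m x * g x) (by
    have := Cb.of (f := fun x => χ m x * g x) ((χ m).contDiff.mul hg) ((χ m).hasCompactSupport.mul_right) (.id ℝ WW)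
    simpa using this)
  filter_upwards [this] with p hp h0
  obtain ⟨m, hm⟩ := exists_nat_gt ‖(X3 : WW)‖
  have he : (fun x => χ m x * g x) =ᶠ[𝓝 X3] g := by
    filter_upwards [(χ m).eventuallyEq_one_of_mem_ball (x := X3) (by rw [mem_ball_zero_iff]; exact hm.trans (by simp [χ]))] with x hx
    rw [hx]; simp
  have := hp m (by rw [h0, mul_zero])
  rwa [he.fderiv_eq] at this
end
end

section
def crs (a b : E3) : E3 := !₂[a 1*b 2-a 2*b 1, a 2*b 0-a 0*b 2, a 0*b 1-a 1*b 0]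

def crsL : E3 →L[ℝ] E3 →L[ℝ] E3 := LinearMap.toContinuousLinearMap (LinearMap.toContinuousLinearMap.toLinearMap ∘ₗ (LinearMap.mk₂ ℝ crs
  (fun a b c => by ext i; fin_cases i <;> simp [crs] <;> ring) (fun a b c => by ext i; fin_cases i <;> simp [crs] <;> ring)
  (fun a b c => by ext i; fin_cases i <;> simp [crs] <;> ring) (fun a b c => by ext i; fin_cases i <;> simp [crs] <;> ring)))

theorem crsL_apply (a b : E3) : crsL a b = crs a b := rfl

def Psi (x : WW) : E3 × E3 := (crs x.1 x.2.1, x.2.2)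

theorem Psi_cd : ContDiff ℝ 2 Psi := by
  unfold Psi
  simp_rw [← crsL_apply]
  exact (ContDiff.clm_apply (crsL.contDiff.comp contDiff_fst) (contDiff_fst.comp contDiff_snd)).prodMk (contDiff_snd.comp contDiff_snd)

theorem Psi_fd (x v : WW) : fderiv ℝ Psi x v = (crs v.1 x.2.1 + crs x.1 v.2.1, v.2.2) := by
  have h1 : HasFDerivAt (fun x : WW => crsL x.1) (crsL.comp (.fst ℝ E3 (E3 × E3))) x := crsL.hasFDerivAt.comp x hasFDerivAt_fst
  have h2 : HasFDerivAt (fun x : WW => x.2.1) mFS x := ContinuousLinearMap.hasFDerivAt mFS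
  have h3 : HasFDerivAt (fun x : WW => x.2.2) ((ContinuousLinearMap.snd ℝ E3 E3).comp (.snd ℝ E3 (E3 × E3))) x := ContinuousLinearMap.hasFDerivAt ((ContinuousLinearMap.snd ℝ E3 E3).comp (.snd ℝ E3 (E3 × E3)))
  have : HasFDerivAt Psi _ x := (h1.clm_apply h2).prodMk h3
  rw [this.fderiv]
  simp [crsL_apply, add_comm]

theorem perp_eq {e q v : E3} {c2 : ℝ} (hc : c2 ≠ 0) (he : ‖e‖^2 = 1) (hq : ‖q‖^2 = c2) (heq : inner ℝ e q = 0) (h1 : inner ℝ e v = 0) (h2 : inner ℝ q v = 0) :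
    v = (inner ℝ (crs e q) v / c2) • crs e q := by
  rw [nsq3, Fin.sum_univ_three] at he hq
  rw [inn3, Fin.sum_univ_three] at heq h1 h2
  ext i
  rw [PiLp.smul_apply, smul_eq_mul, div_mul_eq_mul_div, eq_div_iff hc, inn3, Fin.sum_univ_three]
  have n0 : crs e q 0 = e 1*q 2-e 2*q 1 := rfl
  have n1 : crs e q 1 = e 2*q 0-e 0*q 2 := rfl
  have n2 : crs e q 2 = e 0*q 1-e 1*q 0 := rfl
  fin_cases i <;> simp only [n0, n1, n2, Fin.zero_eta, Fin.mk_one, Fin.reduceFinMk]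
  · linear_combination (-(v 0))*hq - v 0*(q 0^2+q 1^2+q 2^2)*he + v 0*(e 0*q 0+e 1*q 1+e 2*q 2)*heq + ((e 2*q 0-e 0*q 2)*e 2 - (e 0*q 1-e 1*q 0)*e 1)*h2 + (-(e 2*q 0-e 0*q 2)*q 2+(e 0*q 1-e 1*q 0)*q 1)*h1
  · linear_combination (-(v 1))*hq - v 1*(q 0^2+q 1^2+q 2^2)*he + v 1*(e 0*q 0+e 1*q 1+e 2*q 2)*heq + ((e 0*q 1-e 1*q 0)*e 0 - (e 1*q 2-e 2*q 1)*e 2)*h2 + (-(e 0*q 1-e 1*q 0)*q 0+(e 1*q 2-e 2*q 1)*q 2)*h1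
  · linear_combination (-(v 2))*hq - v 2*(q 0^2+q 1^2+q 2^2)*he + v 2*(e 0*q 0+e 1*q 1+e 2*q 2)*heq + ((e 1*q 2-e 2*q 1)*e 1 - (e 2*q 0-e 0*q 2)*e 0)*h2 + (-(e 1*q 2-e 2*q 1)*q 1+(e 2*q 0-e 0*q 2)*q 0)*h1

theorem crs_n {e q : E3} {c2 : ℝ} (he : ‖e‖^2 = 1) (hq : ‖q‖^2 = c2) (heq : inner ℝ e q = 0) :
    ‖crs e q‖^2 = c2 ∧ inner ℝ e (crs e q) = 0 ∧ inner ℝ q (crs e q) = 0 ∧ crs (crs e q) q = (-c2) • e ∧ crs e (crs e q) = -q := by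
  have n0 : crs e q 0 = e 1*q 2-e 2*q 1 := rfl
  have n1 : crs e q 1 = e 2*q 0-e 0*q 2 := rfl
  have n2 : crs e q 2 = e 0*q 1-e 1*q 0 := rfl
  rw [nsq3, Fin.sum_univ_three] at he hq
  rw [inn3, Fin.sum_univ_three] at heq
  refine ⟨?_, ?_, ?_, ?_, ?_⟩
  · rw [nsq3, Fin.sum_univ_three, n0, n1, n2]
    linear_combination hq + (q 0^2+q 1^2+q 2^2)*he - (e 0*q 0+e 1*q 1+e 2*q 2)*heq
  · rw [inn3, Fin.sum_univ_three, n0, n1, n2]; ring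
  · rw [inn3, Fin.sum_univ_three, n0, n1, n2]; ring
  · ext i; fin_cases i <;> simp [crs]
    · linear_combination q 0 * heq - e 0 * hq
    · linear_combination q 1 * heq - e 1 * hq
    · linear_combination q 2 * heq - e 2 * hq
  · ext i; fin_cases i <;> simp [crs]
    · linear_combination e 0 * heq - q 0 * he
    · linear_combination e 1 * heq - q 1 * he
    · linear_combination e 2 * heq - q 2 * he

theorem crs_self (a : E3) : crs a a = 0 := by ext i; fin_cases i <;> simp [crs] <;> ring

theorem rank1 {e q er qr k : E3} {c2 r : ℝ} (hc : 0 < c2) (he : ‖e‖^2 = 1) (hq : ‖q‖^2 = c2) (heq : inner ℝ e q = 0)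
    (h1 : inner ℝ e er = 0) (h2 : inner ℝ q er = 0) (h3 : inner ℝ e qr = 0) (h4 : inner ℝ q qr = 0) (h5 : inner ℝ e (r • k - e) = -c2) (h6 : inner ℝ q (r • k - e) = 0)
    (hK : inner ℝ er (r • k - e) - inner ℝ (q + r • qr) qr = 0) :
    ∃ a b ν, a * ν = r * b^2 ∧ er = a • crs e q ∧ qr = b • crs e q ∧ r • k - e = (-c2) • e + ν • crs e q := by
  obtain ⟨n1, n2, n3, -, -⟩ := crs_n he hq heq
  have e1 := perp_eq hc.ne' he hq heq h1 h2
  have e2 := perp_eq hc.ne' he hq heq h3 h4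
  have e3 := perp_eq (v := (r • k - e) + c2 • e) hc.ne' he hq heq (by rw [inner_add_right, h5, inner_smul_right, ris, he]; ring)
    (by rw [inner_add_right, h6, inner_smul_right, real_inner_comm, heq]; ring)
  set a := inner ℝ (crs e q) er / c2
  set b := inner ℝ (crs e q) qr / c2
  set ν := inner ℝ (crs e q) ((r • k - e) + c2 • e) / c2
  have e4 : r • k - e = (-c2) • e + ν • crs e q := by rw [← e3]; module
  refine ⟨a, b, ν, ?_, e1, e2, e4⟩
  rw [e4, e1, e2] at hK
  simp only [inner_add_left, inner_add_right, inner_smul_left, inner_smul_right, ris, n1, n3, real_inner_comm e (crs e q), n2, RCLike.conj_to_real] at hK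
  have : c2 * (a * ν - r * b^2) = 0 := by linear_combination hK
  rcases mul_eq_zero.1 this with h | h
  · exact absurd h hc.ne'
  · linarith

theorem rank1_Psi {e q er qr k z : E3} {c2 r : ℝ} (hc : 0 < c2) (he : ‖e‖^2 = 1) (hq : ‖q‖^2 = c2) (heq : inner ℝ e q = 0) {a b ν : ℝ} (h1 : er = a • crs e q) (h2 : qr = b • crs e q)
    (h3 : r • k - e = (-c2) • e + ν • crs e q) :
    fderiv ℝ Psi (e,q,z) (er, qr, -(r • er)) = a • ((-c2) • e, -(r • crs e q)) + b • (-q, (0:E3)) ∧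
    fderiv ℝ Psi (e,q,z) (q + r • qr, r • k - e, -(r^2 • qr)) = (r * b) • ((-c2) • e, -(r • crs e q)) + ν • (-q, (0:E3)) := by
  obtain ⟨-, -, -, n4, n5⟩ := crs_n he hq heq
  have l1 : ∀ (s : ℝ) (u v : E3), crs (s • u) v = s • crs u v := fun s u v => by simp [← crsL_apply]
  have l2 : ∀ (s : ℝ) (u v : E3), crs u (s • v) = s • crs u v := fun s u v => by simp [← crsL_apply]
  have l3 : ∀ (u u' v : E3), crs (u + u') v = crs u v + crs u' v := fun s u v => by simp [← crsL_apply]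
  have l4 : ∀ (u v v' : E3), crs u (v+v') = crs u v + crs u v' := fun s u v => by simp [← crsL_apply]
  rw [Psi_fd, Psi_fd, h3, h2, h1]
  simp only [l1, l2, l3, l4, n4, n5, crs_self]
  refine ⟨?_, ?_⟩
  · ext1
    · simp
    · simp; module
  · ext1
    · simp; module
    · simp; module
end

section
variable {Δ : ℝ} {y : ℕ → YY} {e q z er qr k : Fe}

theorem Lim.levI (h : Lm) (A B : WW →L[ℝ] E3) (c : ℝ) : ∀ᵐ p ∂nu, inner ℝ (A X3) (B X3) = c →
    (inner ℝ (A X3) (B R3) + inner ℝ (A R3) (B X3) = 0) ∧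
    (inner ℝ (A X3) (B T3) + inner ℝ (A T3) (B X3) = 0) := by
  have := h.lev (g := fun x => inner ℝ (A x) (B x) - c) ((A.contDiff.inner ℝ B.contDiff).sub contDiff_const)
  filter_upwards [this] with p hp h0
  have hd : ∀ x v, fderiv ℝ (fun x => inner ℝ (A x) (B x) - c) x v = inner ℝ (A x) (B v) + inner ℝ (A v) (B x) := fun x v => by
    rw [fderiv_sub_const, fderiv_inner_apply ℝ A.differentiableAt B.differentiableAt]; simp
  have := hp (by rw [h0, sub_self])
  rwa [hd, hd] at this

/-- a.e. orthogonality relations -/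
theorem Lim.orth (h : Lm) : ∀ᵐ p ∂nu, 0 < p.1 ∧ inner ℝ (e p) (er p) = 0 ∧ inner ℝ (q p) (er p) = 0 ∧ inner ℝ (e p) (qr p) = 0 ∧ inner ℝ (q p) (qr p) = 0 ∧
    inner ℝ (e p) (p.1 • k p - e p) = -(1 - Δ^2) ∧ inner ℝ (q p) (p.1 • k p - e p) = 0 := by
  let A1 : WW →L[ℝ] E3 := .fst ℝ E3 (E3 × E3)
  let A2 : WW →L[ℝ] E3 := (ContinuousLinearMap.fst ℝ E3 E3).comp (.snd ℝ E3 (E3 × E3))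
  filter_upwards [h.ce, h.cq, h.ceq, h.levI A1 A1 1, h.levI A2 A2 dD, h.levI A1 A2 0, nu_ae (P := fun p => 0 < p.1) (fun p hp => hp.1.1)] with p c1 c2 c3 l1 l2 l3 hp
  have l1 := l1 (by simpa [A1, ris] using c1)
  have l2 := l2 (by simpa [A2, ris] using c2)
  have l3 := l3 (by simpa [A1, A2] using c3)
  simp only [A1, A2, ContinuousLinearMap.coe_fst', ContinuousLinearMap.comp_apply, ContinuousLinearMap.coe_snd', Xr0, Xt0] at l1 l2 l3
  rw [real_inner_comm (e p) (er p), real_inner_comm (e p) (q p + _)] at l1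
  rw [real_inner_comm (q p) (qr p), real_inner_comm (q p) (p.1 • k p - e p)] at l2
  rw [real_inner_comm (q p) (er p), real_inner_comm (q p) (q p + _)] at l3
  have a1 : inner ℝ (e p) (qr p) = 0 := by
    have := l1.2
    rw [inner_add_right, c3, inner_smul_right] at this
    have h3 : p.1 * inner ℝ (e p) (qr p) = 0 := by linarith
    exact (mul_eq_zero.1 h3).resolve_left hp.ne'
  have a2 : inner ℝ (q p) (qr p) = 0 := by linarith [l2.1]
  refine ⟨hp, by linarith [l1.1], by linarith [l3.1], a1, a2, ?_, by linarith [l2.2]⟩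
  have := l3.2
  rw [inner_add_right (q p), ris, c2, inner_smul_right (q p), a2] at this
  linarith

def chi : ContDiffBump (0 : E3 × E3) := ⟨2, 3, by norm_num, by norm_num⟩
def pL : WW →L[ℝ] E3 × E3 := (ContinuousLinearMap.fst ℝ E3 (E3 × E3)).prod mFS
theorem pL_apply (x : WW) : pL x = (x.1, x.2.1) := rfl

theorem cut_cb {g : E3 × E3 → ℝ} (hg : ContDiff ℝ 1 g) : Cb (fun x => chi (pL x) * g (pL x)) :=
  Cb.of (f := fun x => chi x * g x) (chi.contDiff.mul hg) (chi.hasCompactSupport.mul_right) pL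

theorem chi_near {e q z : E3} (he : ‖e‖^2 = 1) (hq : ‖q‖^2 = 1 - Δ^2) : ∀ᶠ x in 𝓝 ((e, q, z) : WW), chi (pL x) = 1 := by
  have h1 : ‖e‖ < 2 := by nlinarith [norm_nonneg e]
  have h2 : ‖q‖ < 2 := by nlinarith [norm_nonneg q, sq_nonneg Δ]
  have := chi.eventuallyEq_one_of_mem_ball (x := pL (e,q,z)) (by
    rw [mem_ball_zero_iff, pL_apply, Prod.norm_def]; exact max_lt h1 h2)
  exact pL.continuous.continuousAt.eventually this

theorem cut_val {g : E3 × E3 → ℝ} {e q z : E3} (he : ‖e‖^2 = 1) (hq : ‖q‖^2 = 1 - Δ^2) : chi (pL (e,q,z)) * g (pL (e,q,z)) = g (e, q) ∧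
    fderiv ℝ (fun x => chi (pL x) * g (pL x)) (e,q,z) = fderiv ℝ (fun x => g (pL x)) (e,q,z) := by
  have h := chi_near (z := z) he hq
  refine ⟨by rw [h.self_of_nhds, one_mul]; rfl, Filter.EventuallyEq.fderiv_eq ?_⟩
  filter_upwards [h] with x hx
  rw [hx, one_mul]

theorem Lim.Kz (h : Lm) : ∀ᵐ p ∂nu, inner ℝ (er p) (p.1 • k p - e p) - inner ℝ (q p + p.1 • qr p) (qr p) = 0 := by
  let gE : Fin 3 → E3 × E3 → ℝ := fun i x => x.1 i
  let gQ : Fin 3 → E3 × E3 → ℝ := fun i x => x.2 i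
  have cE : ∀ i, ContDiff ℝ 1 (gE i) := fun i => by
    have : gE i = fun x => ((pr i).comp (.fst ℝ E3 E3)) x := rfl
    rw [this]; exact ContinuousLinearMap.contDiff _
  have cQ : ∀ i, ContDiff ℝ 1 (gQ i) := fun i => by
    have : gQ i = fun x => ((pr i).comp (.snd ℝ E3 E3)) x := rfl
    rw [this]; exact ContinuousLinearMap.contDiff _
  have fE : ∀ i x v, fderiv ℝ (fun x => gE i (pL x)) x v = v.1 i := fun i x v => by
    have : (fun x => gE i (pL x)) = fun x => ((pr i).comp (.fst ℝ E3 (E3 × E3))) x := rfl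
    rw [this, ContinuousLinearMap.fderiv]; rfl
  have fQ : ∀ i x v, fderiv ℝ (fun x => gQ i (pL x)) x v = v.2.1 i := fun i x v => by
    have : (fun x => gQ i (pL x)) = fun x => ((pr i).comp mFS) x := rfl
    rw [this, ContinuousLinearMap.fderiv]; rfl
  have m1 : ∀ i : Fin 3, MemLp (fun p => p.1^2 * (er p i)) 2 nu := fun i => by simpa using (h.wer.lin (pr i)).m
  have m2 : ∀ i : Fin 3, MemLp (fun p => p.1^2 * (qr p i)) 2 nu := fun i => by simpa using (h.wqr.lin (pr i)).m
  have m3 : ∀ i : Fin 3, MemLp (fun p => p.1^2 * (T3.1 i)) 2 nu := fun i => by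
    exact (h.xt.lin ((pr i).comp (.fst ℝ E3 (E3 × E3)))).m
  have m4 : ∀ i : Fin 3, MemLp (fun p => p.1^2 * (T3.2.1 i)) 2 nu := fun i => by
    exact (h.xt.lin ((pr i).comp mFS)).m
  have ii : ∀ i : Fin 3, Integrable (fun p => (p.1^2 * (er p i)) * (p.1^2 * (T3.2.1 i)) - (p.1^2 * (T3.1 i)) * (p.1^2 * (qr p i))) nu := fun i =>
    ((m1 i).integrable_mul (m4 i)).sub ((m3 i).integrable_mul (m2 i))
  have key := dbr (f := fun p => ∑ i : Fin 3, ((p.1^2 * (er p i)) * (p.1^2 * (T3.2.1 i)) - (p.1^2 * (T3.1 i)) * (p.1^2 * (qr p i)))) (integrable_finset_sum _ fun i _ => ii i)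
    fun η hη hs => by
      have t := ts_of hη hs
      set ηr := fun p => fderiv ℝ η p (1,0)
      set ηt := fun p => fderiv ℝ η p (0,1)
      obtain ⟨d1, d2, d3⟩ : _ ∧ _ ∧ _ := ⟨t.c, t.cr, t.ct⟩
      have L := fun i : Fin 3 => LW ((cut_cb (cE i)).hf h) ((cut_cb (cQ i)).hf h) t
      have bE : ∀ i : Fin 3, ∀ᵐ p ∂nu, ‖e p i‖ ≤ 1 := fun i => by
        filter_upwards [h.ce] with p hp
        have := PiLp.norm_apply_le (e p) i
        nlinarith [norm_nonneg (e p)]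
      have mE : ∀ i : Fin 3, AEStronglyMeasurable (fun p => e p i) nu := fun i =>
        ((pr i).comp (.fst ℝ E3 (E3 × E3))).continuous.comp_aestronglyMeasurable h.mX
      have j1 : ∀ i : Fin 3, Integrable (fun p => e p i * (hE * (p.1^2 * (T3.2.1 i)) - (p.1^2 * ηt p) * (p.1^2 * qr p i))) nu := fun i => by
        refine Integrable.bdd_mul (c := 1) ?_ (mE i) (bE i)
        exact ((mlp_c (m4 i) (φ := fun p => 4*p.1*η p + p.1^2*ηr p) fp).sub (mlp_c (m2 i) (φ := fun p => p.1^2*ηt p) fp)).integrable nrm0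
      have j2 : ∀ i : Fin 3, Integrable (fun p => η p * (p.1^2 * (T3.2.1 i)) * (p.1^2 * er p i)) nu := fun i => (mlp_c (m4 i) d1).integrable_mul (m1 i)
      have j3 : ∀ i : Fin 3, Integrable (fun p => η p * (p.1^2 * qr p i) * (p.1^2 * (T3.1 i))) nu := fun i => (mlp_c (m2 i) d1).integrable_mul (m3 i)
      have L' : ∀ i : Fin 3, (∫ p, e p i * (hE * (p.1^2 * (T3.2.1 i)) - (p.1^2 * ηt p) * (p.1^2 * qr p i)) ∂nu) +
          ∫ p, (η p * (p.1^2 * (T3.2.1 i)) * (p.1^2 * er p i) - η p * (p.1^2 * qr p i) * (p.1^2 * (T3.1 i))) ∂nu = 0 := fun i => by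
        rw [integral_sub (j2 i) (j3 i), ← L i]
        congr 1
        · refine integral_congr_ae ?_
          filter_upwards [h.ce, h.cq] with p h1 h2
          rw [(cut_val h1 h2).1, (cut_val h1 h2).2, fQ, fQ]; rfl
        · congr 1
          · refine integral_congr_ae ?_
            filter_upwards [h.ce, h.cq] with p h1 h2
            rw [(cut_val h1 h2).2, (cut_val h1 h2).2, fQ, fE]; rfl
          · refine integral_congr_ae ?_
            filter_upwards [h.ce, h.cq] with p h1 h2
            rw [(cut_val h1 h2).2, (cut_val h1 h2).2, fQ, fE]; rfl
      have S : ∑ i : Fin 3, _ = zR := Finset.sum_eq_zero fun i _ => L' i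
      rw [Finset.sum_add_distrib, ← integral_finset_sum _ (fun i _ => j1 i), ← integral_finset_sum _ (fun i _ => (j2 i).sub' (j3 i))] at S
      have z1 : ∫ p, ∑ i : Fin 3, e p i * (hE * (p.1^2 * (T3.2.1 i)) - (p.1^2 * ηt p) * (p.1^2 * qr p i)) ∂nu = 0 := by
        have : ∫ p, -dD * hR3 ∂nu = 0 := by
          rw [integral_const_mul, ibp_r (F := fun p => p.1^4*η p) (Fr := fun p => 4*p.1^3*η p + p.1^4*ηr p) (Ft := fun p => p.1^4 * ηt p)
            ⟨fun r θ => ?_, fun r θ => (t.ht r θ).const_mul (r^4), by fun_prop, by fun_prop, by fun_prop, fun r => by simp [t.pi], fun θ => by simp [t.one]⟩ (fun θ => by simp), mul_zero]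
          exact ((hasDerivAt_pow 4 r).fun_mul (t.hr r θ)).congr_deriv (by simp)
        rw [← this]
        refine integral_congr_ae ?_
        filter_upwards [h.orth] with p ⟨_, _, _, o3, _, o5, _⟩
        rw [inn3, Fin.sum_univ_three] at o3 o5
        rw [Fin.sum_univ_three]
        simp only [Xt0]
        linear_combination hE*p.1^2*o5 - p.1^4 * ηt p * o3
      rw [z1, zero_add] at S
      rw [← S]
      congr 1; ext p
      rw [Finset.mul_sum]
      exact Finset.sum_congr rfl fun i _ => by ring
  filter_upwards [key, nu_ae (P := fun p => 0 < p.1) (fun p hp => hp.1.1)] with p hp h0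
  have h1 : p.1^4 ≠ 0 := by positivity
  refine (mul_eq_zero.1 (?_ : p.1^4 * _ = 0)).resolve_left h1
  rw [inn3, inn3, ← Finset.sum_sub_distrib, Finset.mul_sum, ← hp]
  exact Finset.sum_congr rfl fun i _ => by simp only [Xt0]; ring

theorem Lim.alg (h : Lm) (hΔ : Δ^2 < 1) : ∀ᵐ p ∂nu, ∃ a b ν : ℝ, a * ν = p.1 * b^2 ∧ er p = a • crs (e p) (q p) ∧ qr p = b • crs (e p) (q p) ∧
    p.1 • k p - e p = (-dD) • e p + ν • crs (e p) (q p) := by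
  filter_upwards [h.ce, h.cq, h.ceq, h.orth, h.Kz] with p h1 h2 h3 ⟨_, o1, o2, o3, o4, o5, o6⟩ h5
  exact rank1 la h1 h2 h3 o1 o2 o3 o4 o5 o6 h5
end

section
def Pf (σ r : ℝ) : ℝ := Real.smoothTransition (r/σ - 1)
def Ef (σ r : ℝ) : ℝ := Pf σ r / r^4 - 1

theorem Pf_cd (σ : ℝ) : ContDiff ℝ 1 (Pf σ) := Real.smoothTransition.contDiff.comp fp

theorem Pf_zero {σ r : ℝ} (hσ : 0 < σ) (hr : r ≤ σ) : Pf σ r = 0 :=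
  Real.smoothTransition.zero_of_nonpos (by rw [sub_nonpos, div_le_one hσ]; exact hr)

theorem Pf_one {σ r : ℝ} (hσ : 0 < σ) (hr : 2*σ ≤ r) : Pf σ r = 1 :=
  Real.smoothTransition.one_of_one_le (by rw [le_sub_iff_add_le, le_div_iff₀ hσ]; linarith)

theorem Pf_supp {σ r : ℝ} (hσ : 0 < σ) (hr : r ∉ Set.Ioo σ sS) : deriv (Pf σ) r = 0 := by
  by_cases h : r ≤ σ
  · exact IsLocalMin.deriv_eq_zero (.of_forall fun s => by rw [Pf_zero hσ h]; exact Real.smoothTransition.nonneg _)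
  · exact IsLocalMax.deriv_eq_zero (.of_forall fun s => by rw [Pf_one (r := r) hσ (by by_contra h2; exact hr ⟨not_le.1 h, not_le.1 h2⟩)]; exact Real.smoothTransition.le_one _)

theorem Pf_bd : ∃ M, 0 < M ∧ ∀ σ r : ℝ, 0 < σ → |deriv (Pf σ) r| ≤ M/σ := by
  have cd : ContDiff ℝ 1 Real.smoothTransition := Real.smoothTransition.contDiff
  obtain ⟨M, hM⟩ := (isCompact_Icc (a := zR) (b := 1)).exists_bound_of_continuousOn (cd.continuous_deriv le_rfl).continuousOn
  refine ⟨|M|+1, by positivity, fun σ r hσ => ?_⟩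
  by_cases hr : r ∈ Set.Ioo σ sS
  · have h1 : HasDerivAt (fun r => r/σ - 1) (1/σ) r := ((hasDerivAt_id r).div_const σ).sub_const 1
    have h2 : HasDerivAt (Pf σ) _ r := ((cd.differentiable one_ne_zero _).hasDerivAt).comp r h1
    rw [h2.deriv, abs_mul, abs_of_pos (one_div_pos.2 hσ), mul_one_div]
    gcongr
    have := hM (r/σ-1) ⟨by rw [sub_nonneg, one_le_div hσ]; exact hr.1.le, by rw [sub_le_iff_le_add, div_le_iff₀ hσ]; linarith [hr.2]⟩
    rw [Real.norm_eq_abs] at this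
    linarith [le_abs_self M]
  · rw [Pf_supp hσ hr, abs_zero]; positivity

theorem Ef_cd {σ : ℝ} (hσ : 0 < σ) : ContDiff ℝ 1 (Ef σ) := by
  rw [contDiff_iff_contDiffAt]
  intro r
  by_cases h : r < σ
  · refine (contDiffAt_const (c := (-1:ℝ))).congr_of_eventuallyEq ?_
    filter_upwards [Iio_mem_nhds h] with s hs
    rw [Ef, Pf_zero hσ (le_of_lt hs)]; simp
  · have : r ≠ 0 := by linarith
    exact ((Pf_cd σ).contDiffAt.div (contDiffAt_id.pow 4) (pow_ne_zero _ this)).sub contDiffAt_const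

theorem Ef_deriv {σ r : ℝ} (hr : 0 < r) : 4*r*Ef σ r + r^2 * deriv (Ef σ) r = deriv (Pf σ) r/r^2 - 4*r := by
  have h1 := ((Pf_cd σ).differentiable one_ne_zero r).hasDerivAt
  have h2 : HasDerivAt (Ef σ) _ r := (h1.div (hasDerivAt_pow 4 r) (pow_ne_zero _ hr.ne')).sub_const 1
  rw [h2.deriv, Ef]
  field_simp
  push_cast
  ring

theorem Ef_ts {σ : ℝ} (hσ : 0 < σ) (h2 : σ < 1/2) {g g' : ℝ → ℝ} (hg : ∀ t, HasDerivAt g (g' t) t) (hg' : Continuous g') (hp : g π = g (-π)) :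
    TS (fun p => Ef σ p.1 * g p.2) (fun p => deriv (Ef σ) p.1 * g p.2) (fun p => Ef σ p.1 * g' p.2) := by
  have c := Ef_cd hσ
  have c1 := c.continuous
  have c2 := c.continuous_deriv le_rfl
  have c3 : Continuous g := continuous_iff_continuousAt.2 fun t => (hg t).continuousAt
  exact ⟨fun r θ => ((c.differentiable one_ne_zero r).hasDerivAt).mul_const (g θ), fun r θ => (hg θ).const_mul (Ef σ r), by fun_prop, by fun_prop, by fun_prop,
    fun r => by simp [hp], fun θ => by simp [Ef, Pf_one hσ (show 2*σ ≤ 1 by linarith)]⟩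

theorem P_int {u : Fs} (hu : Integrable (fun p => p.1^2 * u p) nu) {σ : ℝ} (hσ : 0 < σ) : Integrable (fun p => deriv (Pf σ) p.1 * u p) nu ∧ Integrable (fun p => p.1^3 * u p) nu := by
  obtain ⟨M, hM, hb⟩ := Pf_bd
  have c := (Pf_cd σ).continuous_deriv le_rfl
  constructor
  · have := hu.bdd_mul (f := fun p => deriv (Pf σ) p.1 / p.1^2) (c := M/σ/σ^2) (by
      exact (Measurable.aestronglyMeasurable fp)) (.of_forall fun p => by
        by_cases hp : p.1 ∈ Set.Ioo σ sS
        · rw [Real.norm_eq_abs, abs_div, abs_of_nonneg (sq_nonneg p.1)]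
          have := hp.1
          gcongr
          exact hb _ _ hσ
        · rw [Pf_supp hσ hp]; simp; positivity)
    refine this.congr ?_
    filter_upwards [nu_ae (P := fun p => 0 < p.1) fun p hp => hp.1.1] with p hp
    field_simp
  · have := hu.bdd_mul (f := fun p => p.1) (c := 1) fp (nu_ae fun p hp => by rw [rnn hp.1.1.le]; exact hp.1.2.le)
    exact this.congr (.of_forall fun p => by ring)

theorem trans0 {u : Fs} (hu : Integrable (fun p => p.1^2 * u p) nu) (h1 : ∀ σ : ℝ, 0 < σ → σ < 1/2 → ∫ p, d4 * u p ∂nu = 0)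
    (h2 : ∀ ε : ℝ, 0 < ε → ∃ σ : ℝ, 0 < σ ∧ σ < 1/2 ∧ iSg p.1⁻¹ * |u p| ≤ ε) : ∫ p, p.1^3 * u p ∂nu = 0 := by
  obtain ⟨M, hM, hb⟩ := Pf_bd
  by_contra h
  obtain ⟨σ, hσ, hσ2, hs⟩ := h2 (|∫ p, p.1^3 * u p ∂nu| / M) pv
  have i := P_int hu hσ
  have e1 := h1 σ hσ hσ2
  have : ∫ p, deriv (Pf σ) p.1 * u p ∂nu = 4 * ∫ p, p.1^3 * u p ∂nu := by
    rw [← integral_const_mul, ← sub_eq_zero, ← integral_sub i.1 (i.2.const_mul 4), ← e1]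
    congr 1; ext p; ring
  have iu : IntegrableOn (fun p : Q2 => p.1⁻¹ * |u p|) (Om σ sS) := by
    have := (hu.norm.mono_measure (Measure.restrict_mono (Om_mono hσ.le la) le_rfl) : Integrable _ (volume.restrict (Om σ sS)))
    have := this.bdd_mul (f := fun p => (p.1^3)⁻¹) (c := (σ^3)⁻¹) (Measurable.aestronglyMeasurable fp) ((ae_restrict_iff' oM).2 (.of_forall fun p hp => by
      have := hp.1.1
      rw [rnn (by have := hσ.trans this; positivity)]
      gcongr))
    refine this.congr ((ae_restrict_iff' oM).2 (.of_forall fun p hp => ?_))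
    have := hσ.trans hp.1.1
    simp only [norm_mul, Real.norm_eq_abs, abs_of_nonneg (sq_nonneg p.1), abs_pow, abs_of_pos this]
    field_simp
  have h3 : |∫ p, deriv (Pf σ) p.1 * u p ∂nu| ≤ 2*M * iSg p.1⁻¹ * |u p| := by
    rw [← Real.norm_eq_abs, ← integral_const_mul]
    have : ∫ p, deriv (Pf σ) p.1 * u p ∂nu = iSg deriv (Pf σ) p.1 * u p := by
      refine (setIntegral_eq_of_subset_of_forall_sdiff_eq_zero oM (Om_mono hσ.le la) fun p hp => ?_)
      rw [Pf_supp hσ fun h => hp.2 ⟨h, hp.1.2⟩, zero_mul]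
    rw [this]
    refine norm_integral_le_of_norm_le (iu.const_mul _) ((ae_restrict_iff' oM).2 (.of_forall fun p hp => ?_))
    rw [norm_mul, Real.norm_eq_abs, Real.norm_eq_abs, ← mul_assoc]
    gcongr
    refine (hb σ p.1 hσ).trans ?_
    have := hp.1.2
    have := hσ.trans hp.1.1
    rw [← div_eq_mul_inv, div_le_div_iff₀ hσ this]
    nlinarith
  rw [this, abs_mul] at h3
  have h4 := mln hs (show 0 ≤ 2*M by positivity)
  have : 2*M*(|∫ p, p.1^3 * u p ∂nu| / M) = 2 * |∫ p, p.1^3 * u p ∂nu| := by field_simp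
  have := abs_pos.2 h
  norm_num at h3
  linarith


variable {Δ : ℝ} {y : ℕ → YY} {e q z er qr k : Fe}

theorem Lim.cons (h : Lm) (hΔ : Δ^2 < 1) {G1 G2 : WW → ℝ} (c1 : Cb G1) (c2 : Cb G2) {f1 f2 : E3 × E3 → ℝ} (d1 : Differentiable ℝ f1) (d2 : Differentiable ℝ f2)
    (g1 : ∀ e q z : E3, ‖e‖^2 = 1 → ‖q‖^2 = 1-Δ^2 → G1 =ᶠ[𝓝 (e,q,z)] fun x => f1 (Psi x))
    (g2 : ∀ e q z : E3, ‖e‖^2 = 1 → ‖q‖^2 = 1-Δ^2 → G2 =ᶠ[𝓝 (e,q,z)] fun x => f2 (Psi x)) :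
    Integrable (fun p => p.1^2 * (G1 X3 * fderiv ℝ G2 X3 T3)) nu ∧
    ∀ σ : ℝ, 0 < σ → σ < 1/2 → ∫ p, d4 * (G1 X3 * fderiv ℝ G2 X3 T3) ∂nu = 0 := by
  have H1 := c1.hf h
  have H2 := c2.hf h
  constructor
  · obtain ⟨m, M, _, hM⟩ := H1.m0
    refine ((H2.wt.m.integrable nrm0).bdd_mul (c := M) m hM).congr (.of_forall fun p => ?_)
    simp only [smul_eq_mul]; ring
  · intro σ hσ hσ2
    have t := Ef_ts hσ hσ2 (g := fun _ => 1) (g' := fun _ => 0) (fun t => hasDerivAt_const t 1) continuous_const rfl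
    have L := LW H1 H2 t
    have wd : ∀ᵐ p ∂nu, fderiv ℝ G2 X3 T3 * fderiv ℝ G1 X3 R3 =
        fderiv ℝ G2 X3 R3 * fderiv ℝ G1 X3 T3 := by
      filter_upwards [h.ce, h.cq, h.ceq, h.alg hΔ] with p h1 h2 h3 ⟨a, b, ν, hab, h4, h5, h6⟩
      have D : ∀ {f : E3 × E3 → ℝ} {G : WW → ℝ}, Differentiable ℝ f → G =ᶠ[𝓝 X3] (fun x => f (Psi x)) → ∀ v, fderiv ℝ G X3 v = fderiv ℝ f (Psi X3) (fderiv ℝ Psi X3 v) := fun hf hG v => by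
        rw [hG.fderiv_eq, fderiv_fun_comp _ (hf _) (Psi_cd.differentiable two_ne_zero _)]; rfl
      rw [D d1 (g1 _ _ _ h1 h2), D d1 (g1 _ _ _ h1 h2), D d2 (g2 _ _ _ h1 h2), D d2 (g2 _ _ _ h1 h2)]
      obtain ⟨r1, r2⟩ := rank1_Psi (z := z p) (r := p.1) la h1 h2 h3 h4 h5 h6
      unfold Xr0 Xt0
      rw [r1, r2]
      simp only [map_add, map_smul, smul_eq_mul]
      generalize fderiv ℝ f1 _ _ = A1
      generalize fderiv ℝ f1 _ _ = A2
      generalize fderiv ℝ f2 _ _ = B1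
      generalize fderiv ℝ f2 _ _ = B2
      linear_combination (A1*B2-A2*B1) * hab
    rw [sub_eq_zero.2 (integral_congr_ae ?_), add_zero] at L
    · rw [← L]
      refine integral_congr_ae ?_
      filter_upwards [nu_ae (P := fun p => 0 < p.1) fun p hp => hp.1.1] with p hp
      have := Ef_deriv (σ := σ) hp
      simp only [mul_one, mul_zero, zero_mul, sub_zero]
      rw [this]
      field_simp
    · filter_upwards [wd] with p hp
      linear_combination Ef σ p.1 * 1 * p.1^4 * hp
end

section
def L1 : WW →L[ℝ] E3 := .fst ℝ E3 (E3 × E3)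
def L2 : WW →L[ℝ] E3 := (ContinuousLinearMap.fst ℝ E3 E3).comp (.snd ℝ E3 (E3 × E3))
def L3 : WW →L[ℝ] E3 := (ContinuousLinearMap.snd ℝ E3 E3).comp (.snd ℝ E3 (E3 × E3))
def ip : WW →L[ℝ] WW →L[ℝ] ℝ := (innerSL ℝ).bilinearComp L1 L1 + (innerSL ℝ).bilinearComp L2 L2 + (innerSL ℝ).bilinearComp L3 L3
def n2 (x : WW) : ℝ := ‖x.1‖^2 + ‖x.2.1‖^2 + ‖x.2.2‖^2

theorem ip_apply (x w : WW) : ip x w = inner ℝ x.1 w.1 + inner ℝ x.2.1 w.2.1 + inner ℝ x.2.2 w.2.2 := rfl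
theorem ip_self (x : WW) : ip x x = n2 x := by simp only [ip_apply, ris, n2]
theorem n2_nonneg (x : WW) : 0 ≤ n2 x := by unfold n2; positivity
theorem n2_cont : Continuous n2 := by unfold n2; fun_prop
theorem ip_le (x w : WW) : 2 * ip x w ≤ n2 x + n2 w := by
  have h := n2_nonneg (x - w)
  rw [← ip_self, map_sub, map_sub] at h
  simp only [_root_.sub_apply, ip_self] at h
  have : ip x w = ip w x := by simp only [ip_apply, real_inner_comm]
  linarith
theorem n2_add (x w : WW) : n2 (x + w) ≤ 2 * n2 x + 2 * n2 w := by
  have := sq_add_le x.1 w.1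
  have := sq_add_le x.2.1 w.2.1
  have := sq_add_le x.2.2 w.2.2
  simp only [n2, Prod.fst_add, Prod.snd_add]; linarith
theorem n2_smul (r : ℝ) (x : WW) : n2 (r • x) = r^2 * n2 x := by
  simp only [n2, Prod.smul_fst, Prod.smul_snd, norm_smul, mul_pow, Real.norm_eq_abs, sq_abs]; ring
theorem sq_le_n2 (x : WW) : ‖x‖^2 ≤ n2 x := by
  have : ‖x‖ = max ‖x.1‖ (max ‖x.2.1‖ ‖x.2.2‖) := rfl
  rw [this, n2]
  have := sq_nonneg ‖x.1‖
  have := sq_nonneg ‖x.2.1‖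
  have := sq_nonneg ‖x.2.2‖
  rcases max_choice ‖x.1‖ (max ‖x.2.1‖ ‖x.2.2‖) with h | h <;> rcases max_choice ‖x.2.1‖ ‖x.2.2‖ with h' | h' <;> rw [h] <;> try rw [h']
  all_goals linarith

/-- frame fields -/
def eF (f : WW) (t : ℝ) : E3 := f.1 + cos t • f.2.1 + sin t • f.2.2
def qF (f : WW) (t : ℝ) : E3 := cos t • f.2.2 - sin t • f.2.1
def XF (f : WW) (t : ℝ) : WW := (eF f t, qF f t, 0)
def TF (f : WW) (t : ℝ) : WW := (qF f t, f.1 - eF f t, 0)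

theorem XF_cont (f : WW) : Continuous (fun p : Q2 => XF f p.2) := by unfold XF eF qF; fun_prop
theorem TF_cont (f : WW) : Continuous (fun p : Q2 => TF f p.2) := by unfold TF eF qF; fun_prop
theorem XF_sub (f g : WW) (t : ℝ) : XF (f - g) t = XF f t - XF g t := by
  refine Prod.ext ?_ (Prod.ext ?_ ?_) <;> simp [XF, eF, qF] <;> module
theorem TF_sub (f g : WW) (t : ℝ) : TF (f - g) t = TF f t - TF g t := by
  refine Prod.ext ?_ (Prod.ext ?_ ?_) <;> simp [TF, eF, qF] <;> module
theorem XF_n2 (f : WW) (t : ℝ) : n2 (XF f t) ≤ 8 * n2 f ∧ n2 (TF f t) ≤ 8 * n2 f := by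
  have c := sin_sq_add_cos_sq t
  have hs : sin t^2 ≤ 1 := by nlinarith
  have hc : cos t^2 ≤ 1 := by nlinarith
  have ns : ∀ (s : ℝ) (v : E3), s^2 ≤ 1 → ‖s • v‖^2 ≤ ‖v‖^2 := fun s v h => by
    rw [norm_smul, mul_pow, Real.norm_eq_abs, sq_abs]; exact mul_le_of_le_one_left (sq_nonneg _) h
  have e1 : f.1 - eF f t = -(cos t • f.2.1 + sin t • f.2.2) := by unfold eF; module
  have h1 := sq_add_le (cos t • f.2.1) (sin t • f.2.2)
  have h2 := sq_sub_le (cos t • f.2.2) (sin t • f.2.1)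
  have h3 := sq_add_le f.1 (cos t • f.2.1 + sin t • f.2.2)
  have := ns _ f.2.1 hs
  have := ns _ f.2.2 hs
  have := ns _ f.2.1 hc
  have := ns _ f.2.2 hc
  have := sq_nonneg ‖f.1‖
  have := sq_nonneg ‖f.2.1‖
  have := sq_nonneg ‖f.2.2‖
  simp only [n2, XF, TF, e1, norm_neg, norm_zero]
  rw [← add_assoc] at h3
  unfold eF qF
  constructor <;> linarith

theorem inv_int {F : Fs} {a b : ℝ} (ha : 0 < a) (hF : IntegrableOn F (Om a b)) (m : ℕ) : IntegrableOn (fun p => (p.1^m)⁻¹ * F p) (Om a b) :=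
  hF.bdd_mul (c := (a^m)⁻¹) (Measurable.aestronglyMeasurable fp) ((ae_restrict_iff' oM).2 (.of_forall fun p hp => by
    have := hp.1.1
    have := ha.trans this
    rw [rnn pv]
    gcongr))

theorem r_int {σ : ℝ} (h : 0 < σ) : IntegrableOn (fun p : Q2 => p.1⁻¹) (Om σ sS) ∧ iSg p.1⁻¹ = 2*π*log 2 := by
  have h1 := inv_int h (cont_Om (F := fun _ => (1:ℝ)) continuous_const σ sS) 1
  simp only [pow_one, mul_one] at h1
  refine ⟨h1, ?_⟩
  have : iSg (max p.1 σ)⁻¹ = iSg p.1⁻¹ := setIntegral_congr_fun oM fun p hp => by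
    simp only [max_eq_left hp.1.1.le]
  rw [← this, Om_iter (F := fun p : Q2 => (max p.1 σ)⁻¹) (Continuous.inv₀ fp fun p => (lt_max_of_lt_right h).ne') la]
  simp only [intervalIntegral.integral_const, smul_eq_mul, ii_cm]
  have : ∫ r in σ..2*σ, (max r σ)⁻¹ = ∫ r in σ..2*σ, r⁻¹ := intervalIntegral.integral_congr fun r hr => by
    rw [Set.uIcc_of_le la] at hr
    simp only [max_eq_left hr.1]
  rw [this, integral_inv_of_pos h la, mul_div_assoc, div_self h.ne']
  ring_nf

def QQ (X T : Q2 → WW) (f : WW) (σ : ℝ) : ℝ := iSg p.1⁻¹ * nX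

abbrev M2 (X : Q2 → WW) : Prop := MemLp (fun p => p.1^2 • X p) 2 nu

theorem n2_int {X m : Q2 → WW} (hX : M2 X) (hm : Continuous m) {σ : ℝ} (h : 0 < σ) (h2 : 2*σ ≤ 1) : IntegrableOn (fun p => p.1⁻¹ * n2 (X p - m p)) (Om σ sS) := by
  have h3 : MemLp (fun p => p.1^2 • X p - p.1^2 • m p) 2 nu := hX.sub (cont_mlp fp)
  have sq : ∀ L : WW →L[ℝ] E3, Integrable (fun p => ‖L (p.1^2 • X p - p.1^2 • m p)‖^2) nu := fun L => by
    have := L.comp_memLp' h3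
    exact (mlp2 this.1).1 this
  have h4 : Integrable (fun p => n2 (p.1^2 • X p - p.1^2 • m p)) nu := ((sq L1).add (sq L2)).add (sq L3)
  refine (inv_int h (h4.mono_measure (Measure.restrict_mono (Om_mono h.le h2) le_rfl)) 5).congr ((ae_restrict_iff' oM).2 (.of_forall fun p hp => ?_))
  have := h.trans hp.1.1
  simp only [← smul_sub, n2_smul]
  field_simp

theorem QQ_int {X T : Q2 → WW} (hX : M2 X) (hT : M2 T) (f : WW) {σ : ℝ} (h : 0 < σ) (h2 : 2*σ ≤ 1) :
    IntegrableOn (fun p => p.1⁻¹ * nX) (Om σ sS) :=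
  ((n2_int hX (XF_cont f) h h2).add (n2_int hT (TF_cont f) h h2)).congr (.of_forall fun p => by simp only [Pi.add_apply]; ring)

theorem QQ_tri {X T : Q2 → WW} (hX : M2 X) (hT : M2 T) (f g : WW) {σ : ℝ} (h : 0 < σ) (h2 : 2*σ ≤ 1) : QQ X T f σ ≤ 2 * QQ X T g σ + 256 * n2 (g - f) := by
  have hr := r_int h
  have i1 := QQ_int hX hT g h h2
  have : QQ X T f σ ≤ iSg (2 * (p.1⁻¹ * (n2 (X p - XF g p.2) + n2 (T p - TF g p.2))) + (32 * n2 (g-f)) * p.1⁻¹) := by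
    refine setIntegral_mono_on (QQ_int hX hT f h h2) ((i1.const_mul 2).add (hr.1.const_mul _)) oM fun p hp => ?_
    have h3 := n2_add (X p - XF g p.2) (XF (g-f) p.2)
    have h4 := n2_add (T p - TF g p.2) (TF (g-f) p.2)
    have h5 := XF_n2 (g-f) p.2
    have e1 : X p - XF g p.2 + XF (g-f) p.2 = X p - XF f p.2 := by rw [XF_sub]; abel
    have e2 : T p - TF g p.2 + TF (g-f) p.2 = T p - TF f p.2 := by rw [TF_sub]; abel
    rw [e1] at h3; rw [e2] at h4
    have : 0 ≤ p.1⁻¹ := inv_nonneg.2 (h.trans hp.1.1).le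
    have := mln (show n2 (X p - XF f p.2) + n2 (T p - TF f p.2) ≤ 2*(n2 (X p - XF g p.2) + n2 (T p - TF g p.2)) + 32 * n2 (g-f) by linarith) this
    linarith
  rw [integral_add (i1.const_mul 2) (hr.1.const_mul _), integral_const_mul, integral_const_mul, hr.2] at this
  refine this.trans (add_le_add le_rfl ?_)
  have h6 : 2*π*log 2 ≤ 8 := by nlinarith [Real.pi_lt_d2, Real.log_two_lt_d9, Real.pi_pos, Real.log_two_gt_d9]
  nlinarith [n2_nonneg (g-f)]

theorem QQ_mono {X T : Q2 → WW} (f : WW) {σ : ℝ} (h : 0 < σ) : 0 ≤ QQ X T f σ := setIntegral_nonneg oM fun p hp =>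
  mul_nonneg (inv_nonneg.2 (h.trans hp.1.1).le) (add_nonneg (n2_nonneg _) (n2_nonneg _))

/-- weak lower semicontinuity -/
theorem lsc {v : ℕ → Q2 → WW} {v0 : Q2 → WW} (hv : WK v v0) {m : Q2 → WW} (hm : Continuous m) {σ c : ℝ} (h : 0 < σ) (h2 : 2*σ ≤ 1)
    (hf : ∃ᶠ n in atTop, iSg p.1⁻¹ * n2 (v n p - m p) ≤ c) : iSg p.1⁻¹ * n2 (v0 p - m p) ≤ c := by
  have sub := Om_mono h.le h2
  have m1 : MemLp (fun p => p.1^2 • v0 p - p.1^2 • m p) 2 nu := hv.m.sub (cont_mlp fp)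
  have I0 := n2_int hv.m hm h h2
  let Φ : Q2 → WW →L[ℝ] ℝ := (Om σ sS).indicator fun p => (p.1^5)⁻¹ • ip (p.1^2 • v0 p - p.1^2 • m p)
  have mΦ : MemLp Φ 2 nu := by
    have h3 : MemLp (fun p => ip (p.1^2 • v0 p - p.1^2 • m p)) 2 nu := ip.comp_memLp' m1
    refine MemLp.of_le_mul (c := (σ^5)⁻¹) h3 ?_ (.of_forall fun p => ?_)
    · have h4 : AEStronglyMeasurable (fun p : Q2 => (p.1^5)⁻¹) nu := Measurable.aestronglyMeasurable fp
      exact (h4.smul h3.1).indicator oM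
    · by_cases hp : p ∈ Om σ sS
      · have h4 := hp.1.1
        have h5 := h.trans h4
        simp only [Φ, Set.indicator_of_mem hp, norm_smul]
        rw [rnn (by positivity : 0 ≤ (p.1^5)⁻¹)]
        gcongr
      · simp only [Φ, Set.indicator_of_notMem hp, norm_zero]; positivity
  have eq : ∀ u : Q2 → WW, (∫ p, Φ p (p.1^2 • u p) ∂nu) = iSg p.1⁻¹ * ip (v0 p - m p) (u p) := fun u => by
    rw [← integral_indicator oM, ← integral_indicator oM]
    congr 1; ext p
    by_cases hp : p ∈ Om σ sS
    · have := h.trans hp.1.1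
      simp only [Set.indicator_of_mem (sub hp), Set.indicator_of_mem hp, Φ, ← smul_sub, map_smul, _root_.smul_apply, smul_eq_mul]
      field_simp
    · rw [Set.indicator_of_notMem hp]
      by_cases h5 : p ∈ Om 0 1 <;> simp [Φ, hp, h5]
  have iI : ∀ u : Q2 → WW, M2 u → IntegrableOn (fun p => p.1⁻¹ * ip (v0 p - m p) (u p)) (Om σ sS) := fun u hu => by
    have hh : IntegrableOn (fun p => Φ p (p.1^2 • u p)) (Om σ sS) := (app_int mΦ hu).mono_measure (Measure.restrict_mono sub le_rfl)
    refine hh.congr_fun (fun p hp => ?_) oM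
    have := h.trans hp.1.1
    simp only [Set.indicator_of_mem hp, Φ, ← smul_sub, map_smul, _root_.smul_apply, smul_eq_mul]
    field_simp
  have lim := hv.w Φ mΦ
  simp only [eq] at lim
  have mm : M2 m := cont_mlp fp
  have lim2 := lim.sub_const (iSg p.1⁻¹ * ip (v0 p - m p) (m p))
  have e0 : (iSg p.1⁻¹ * ip (v0 p - m p) (v0 p)) - (iSg p.1⁻¹ * ip (v0 p - m p) (m p)) = iSg p.1⁻¹ * n2 (v0 p - m p) := by
    rw [← integral_sub (iI _ hv.m) (iI _ mm)]
    congr 1; ext p; rw [← ip_self, map_sub (ip (v0 p - m p))]; ring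
  rw [e0] at lim2
  set Q := iSg p.1⁻¹ * n2 (v0 p - m p)
  have : Q ≤ (Q + c)/2 := by
    refine le_of_tendsto_of_frequently lim2 (hf.mono fun n hn => ?_)
    have mv : M2 (v n) := cont_mlp (by have := hv.c n; fun_prop)
    have I1 := n2_int mv hm h h2
    rw [← integral_sub (iI _ mv) (iI _ mm)]
    have : iSg (p.1⁻¹ * ip (v0 p - m p) (v n p) - p.1⁻¹ * ip (v0 p - m p) (m p)) ≤
        iSg (1/2) * (p.1⁻¹ * n2 (v0 p - m p) + p.1⁻¹ * n2 (v n p - m p)) := by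
      refine setIntegral_mono_on ((iI _ mv).sub (iI _ mm)) ((I0.add I1).const_mul _) oM fun p hp => ?_
      have h4 := ip_le (v0 p - m p) (v n p - m p)
      rw [map_sub (ip (v0 p - m p))] at h4
      have := mln h4 (inv_nonneg.2 (h.trans hp.1.1).le)
      linarith
    rw [integral_const_mul, integral_add I0 I1] at this
    linarith
  linarith
end

section
theorem mean_var {F Fr : Fe} (hF : Continuous F) (hFr : Continuous Fr) (hd : ∀ r θ, HasDerivAt (fun s => F (s, θ)) (Fr (r, θ)) r) {σ r : ℝ} (h : 0 < σ)
    (h1 : σ ≤ r) (h2 : r ≤ 2*σ) : ‖(2*π)⁻¹ • JJ F r - (2*π)⁻¹ • JJ F σ‖^2 ≤ iSg p.1 * ‖Fr p‖^2 := by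
  have hpi := Real.pi_pos
  have cJ := J_cont hFr
  have c2 : Continuous (JJ fun p => ‖Fr p‖^2) := J_cont (F := fun p => ‖Fr p‖^2) fp
  have nn : ∀ s, 0 ≤ JJ (fun p => ‖Fr p‖^2) s := fun s => J_nonneg s (fun _ => by positivity)
  have f1 : (2*π)⁻¹ • JJ F r - (2*π)⁻¹ • JJ F σ = ∫ s in σ..r, (2*π)⁻¹ • JJ Fr s :=
    (intervalIntegral.integral_eq_sub_of_hasDerivAt (f := fun s => (2*π)⁻¹ • JJ F s) (fun s _ => (J_deriv hF hFr hd s).const_smul ((2*π)⁻¹ : ℝ)) cf2).symm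
  have f2 : ‖(2*π)⁻¹ • JJ F r - (2*π)⁻¹ • JJ F σ‖ ≤ ∫ s in σ..2*σ, ‖(2*π)⁻¹ • JJ Fr s‖ := by
    rw [f1]
    refine (intervalIntegral.norm_integral_le_integral_norm h1).trans ?_
    rw [← intervalIntegral.integral_add_adjacent_intervals (b := r) (c := 2*σ) cf2 cf2]
    have := intervalIntegral.integral_nonneg (μ := volume) h2 (f := fun s => ‖(2*π)⁻¹ • JJ Fr s‖) fun _ _ => norm_nonneg _
    linarith
  have f3 : ∀ s, ‖(2*π)⁻¹ • JJ Fr s‖^2 ≤ JJ (fun p => ‖Fr p‖^2) s := fun s => by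
    have a1 : ‖JJ Fr s‖ ≤ iT ‖Fr (s,t)‖ := intervalIntegral.norm_integral_le_integral_norm la
    have a2 := cs_ii (u := fun t => ‖Fr (s,t)‖) fp (show -π ≤ π by linarith)
    have a3 : ‖JJ Fr s‖^2 ≤ (2*π) * JJ (fun p => ‖Fr p‖^2) s := by
      refine (pow_le_pow_left₀ no a1 2).trans (a2.trans (le_of_eq ?_))
      unfold JJ; ring
    rw [norm_smul, mul_pow, rnn pv, inv_pow]
    have := nn s
    rw [inv_mul_le_iff₀ pv]
    nlinarith [Real.pi_gt_three, mul_nonneg hpi.le this]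
  have f4 := cs_ii (u := fun s => ‖(2*π)⁻¹ • JJ Fr s‖) fp (show σ ≤ 2*σ by linarith)
  refine (pow_le_pow_left₀ no f2 2).trans (f4.trans ?_)
  rw [Om_J fp (fun s => s) continuous_id la, ← ii_cm]
  refine intervalIntegral.integral_mono_on la cf2 cf2 fun s hs => ?_
  exact (mln (f3 s) la).trans (mul_le_mul_of_nonneg_right (by linarith [hs.1]) (nn s))

def fr (y : YY) (r : ℝ) : WW := (Em (ef y) r, Am (ef y) (qf y) r, Bm (ef y) (qf y) r)
def Dd (y : YY) (p : Q2) : ℝ := eps (ef y) (qf y) (etf y) (qtf y) p + dl0 (ef y) (qf y) p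
      + p.1^2 * eq2 + ‖zf y p‖^2

theorem Dd_cont {y : YY} (hy : CDy) : Continuous (Dd y) := by
  obtain ⟨h1,h2,h3,h4,h5,h6⟩ := cont_fields hy
  have a1 := eps_cont h2 h3 (e_pc1 hy).ct (q_pc1 hy).ct
  have a2 := dl0_cont h2 h3
  have a3 := (z_pc1 hy).c
  unfold Dd; fun_prop
theorem eps_nn (e q et qt : Fe) (p) : 0 ≤ eps e q et qt p := by unfold eps; positivity
theorem dl0_nn (e q : Fe) (p) : 0 ≤ dl0 e q p := by unfold dl0; positivity
theorem Dd_nn (y : YY) (p) : 0 ≤ Dd y p := by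
  have := eps_nn (ef y) (qf y) (etf y) (qtf y) p
  have := dl0_nn (ef y) (qf y) p
  unfold Dd; positivity

theorem Dd_int {y : YY} (hy : CDy) {a b : ℝ} (h : 0 < a) : IntegrableOn (fun p => p.1⁻¹ * Dd y p) (Om a b) := by
  simpa using inv_int h (cont_Om (Dd_cont hy) a b) 1

theorem fr_var {y : YY} (hy : CDy) {σ r : ℝ} (h : 0 < σ)
    (h1 : σ ≤ r) (h2 : r ≤ 2*σ) : n2 (fr y r - fr y σ) ≤ 2 * iSg p.1⁻¹ * Dd y p := by
  obtain ⟨c1,c2,c3,c4,c5,c6⟩ := cont_fields hy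
  have E := (e_pc1 hy).hr
  have Q := (q_pc1 hy).hr
  have m1 := mean_var c2 c4 E h h1 h2
  have m2 := mean_var (F := fun p => cos p.2 • ef y p - sin p.2 • qf y p) (Fr := fun p => cos p.2 • erf y p - sin p.2 • qrf y p) fp fp
    (fun r θ => ((E r θ).const_smul (cos θ)).fun_sub ((Q r θ).const_smul (sin θ))) h h1 h2
  have m3 := mean_var (F := fun p => sin p.2 • ef y p + cos p.2 • qf y p) (Fr := fun p => sin p.2 • erf y p + cos p.2 • qrf y p) fp fp
    (fun r θ => ((E r θ).const_smul (sin θ)).fun_add ((Q r θ).const_smul (cos θ))) h h1 h2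
  have e : n2 (fr y r - fr y σ) ≤ (iSg p.1 * ‖erf y p‖^2) + (iSg p.1 * ‖cos p.2 • erf y p - sin p.2 • qrf y p‖^2) + iSg p.1 * ‖sin p.2 • erf y p + cos p.2 • qrf y p‖^2 :=
    add_le_add (add_le_add m1 m2) m3
  refine e.trans ?_
  rw [← integral_add cof cof, ← integral_add cof cof, ← integral_const_mul]
  refine setIntegral_mono_on cof ((Dd_int hy h).const_mul 2) oM fun p hp => ?_
  have hp0 := h.trans hp.1.1
  have rot : ‖cos p.2 • erf y p - sin p.2 • qrf y p‖^2 + ‖sin p.2 • erf y p + cos p.2 • qrf y p‖^2 = ‖erf y p‖^2 + ‖qrf y p‖^2 := by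
    rw [nsq3, nsq3, nsq3, nsq3]
    simp only [PiLp.sub_apply, PiLp.add_apply, PiLp.smul_apply, smul_eq_mul, Fin.sum_univ_three]
    linear_combination (erf y p 0^2 + qrf y p 0^2 + (erf y p 1^2 + qrf y p 1^2) + (erf y p 2^2 + qrf y p 2^2)) * sin_sq_add_cos_sq p.2
  have d : p.1^2 * eq2 ≤ Dd y p := by
    have := eps_nn (ef y) (qf y) (etf y) (qtf y) p
    have := dl0_nn (ef y) (qf y) p
    have := sq_nonneg ‖zf y p‖
    unfold Dd; linarith
  have d2 := mln d (inv_nonneg.2 hp0.le)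
  have : p.1⁻¹ * (p.1^2 * eq2) = p.1 * eq2 := by field_simp
  rw [this] at d2
  nlinarith [mul_nonneg hp0.le (sq_nonneg ‖qrf y p‖)]

theorem Qn {y : YY} (hy : CDy) {σ : ℝ} (h : 0 < σ) (h2 : 2*σ ≤ 1) : QQ (Xf y) (Xtf y) (fr y σ) σ ≤ 600 * iSg p.1⁻¹ * Dd y p := by
  have hr := r_int h
  have X := X_pc1 hy
  have mX : M2 (Xf y) := cont_mlp (by have := X.c; fun_prop)
  have mT : M2 (Xtf y) := cont_mlp (by have := X.ct; fun_prop)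
  set K := iSg p.1⁻¹ * Dd y p with hK
  have K0 : 0 ≤ K := setIntegral_nonneg oM fun p hp => mul_nonneg (inv_nonneg.2 (h.trans hp.1.1).le) (Dd_nn _ _)
  have : QQ (Xf y) (Xtf y) (fr y σ) σ ≤ iSg (2 * (p.1⁻¹ * Dd y p) + (64 * K) * p.1⁻¹) := by
    refine setIntegral_mono_on (QQ_int mX mT _ h h2) (((Dd_int hy h).const_mul 2).add (hr.1.const_mul _)) oM fun p hp => ?_
    have hp0 := h.trans hp.1.1
    have hp1 : p.1 ≤ 1 := hp.1.2.le.trans h2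
    have h3 := n2_add (Xf y p - XF (fr y p.1) p.2) (XF (fr y p.1 - fr y σ) p.2)
    have h4 := n2_add (Xtf y p - TF (fr y p.1) p.2) (TF (fr y p.1 - fr y σ) p.2)
    have h5 := XF_n2 (fr y p.1 - fr y σ) p.2
    have h6 := fr_var hy h hp.1.1.le hp.1.2.le
    have e1 : Xf y p - XF (fr y p.1) p.2 + XF (fr y p.1 - fr y σ) p.2 = Xf y p - XF (fr y σ) p.2 := by rw [XF_sub]; abel
    have e2 : Xtf y p - TF (fr y p.1) p.2 + TF (fr y p.1 - fr y σ) p.2 = Xtf y p - TF (fr y σ) p.2 := by rw [TF_sub]; abel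
    rw [e1] at h3; rw [e2] at h4
    have e3 : n2 (Xf y p - XF (fr y p.1) p.2) = dl0 (ef y) (qf y) p + ‖zf y p‖^2 := by
      simp only [n2, Xf, XF, fr, eF, qF, dl0, Prod.fst_sub, Prod.snd_sub, sub_zero, sub_add_eq_sub_sub, sub_sub_eq_add_sub]
    have hh : ∀ x a b c : E3, x - (a - (a+b+c)) = x+b+c := fun x a b c => by abel
    have e4 : n2 (Xtf y p - TF (fr y p.1) p.2) = eps (ef y) (qf y) (etf y) (qtf y) p + ‖ztf y p‖^2 := by
      simp only [n2, Xtf, TF, fr, eF, qF, eps, Prod.fst_sub, Prod.snd_sub, sub_zero, hh]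
      rw [sub_sub_eq_add_sub]
    have e5 : ‖ztf y p‖^2 ≤ p.1^2 * eq2 := by
      rw [ztf, norm_neg, norm_smul, rnn pv, mul_pow]
      have : (p.1^2)^2 ≤ p.1^2 := by rw [← pow_mul]; exact pow_le_pow_of_le_one hp0.le hp1 nrm0
      have := mul_le_mul_of_nonneg_right this (sq_nonneg ‖qrf y p‖)
      nlinarith [mul_nonneg (sq_nonneg p.1) (sq_nonneg ‖erf y p‖)]
    have := mln (show n2 (Xf y p - XF (fr y σ) p.2) + n2 (Xtf y p - TF (fr y σ) p.2) ≤ 2*Dd y p + 64 * K by unfold Dd; linarith) (inv_nonneg.2 hp0.le)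
    linarith
  rw [integral_add ((Dd_int hy h).const_mul 2) (hr.1.const_mul _), integral_const_mul, integral_const_mul, hr.2] at this
  have h6 : 2*π*log 2 ≤ 8 := by nlinarith [Real.pi_lt_d2, Real.log_two_lt_d9, Real.pi_pos, Real.log_two_gt_d9]
  nlinarith
end

section
theorem r_prod {g : ℝ → ℝ} (hg : Continuous g) {σ : ℝ} (h : 0 < σ) : IntegrableOn (fun p : Q2 => p.1⁻¹ * g p.2) (Om σ sS) ∧
    iSg p.1⁻¹ * g p.2 = log 2 * iT g t := by
  have h1 := inv_int h (cont_Om (F := fun p => g p.2) fp σ sS) 1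
  simp only [pow_one] at h1
  refine ⟨h1, ?_⟩
  have : iSg (max p.1 σ)⁻¹ * g p.2 = iSg p.1⁻¹ * g p.2 := setIntegral_congr_fun oM fun p hp => by
    simp only [max_eq_left hp.1.1.le]
  have c : Continuous (fun r : ℝ => (max r σ)⁻¹) := Continuous.inv₀ fp fun p => (lt_max_of_lt_right h).ne'
  rw [← this, Om_J (F := fun p => g p.2) fp (fun r => (max r σ)⁻¹) c la]
  simp only [JJ]
  rw [intervalIntegral.integral_mul_const]
  have : ∫ r in σ..2*σ, (max r σ)⁻¹ = ∫ r in σ..2*σ, r⁻¹ := intervalIntegral.integral_congr fun r hr => by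
    rw [Set.uIcc_of_le la] at hr
    simp only [max_eq_left hr.1]
  rw [this, integral_inv_of_pos h la, mul_div_assoc, div_self h.ne', mul_one]

theorem XF_id (f : WW) (t : ℝ) : n2 (XF f t) = n2 f + (2 * inner ℝ f.1 f.2.1) * cos t + (2 * inner ℝ f.1 f.2.2) * sin t := by
  simp only [n2, XF, eF, qF, nsq3, inn3, norm_zero, PiLp.sub_apply, PiLp.add_apply, PiLp.smul_apply, smul_eq_mul, Fin.sum_univ_three]
  linear_combination (f.2.1 0^2 + f.2.1 1^2 + f.2.1 2^2 + f.2.2 0^2 + f.2.2 1^2 + f.2.2 2^2) * sin_sq_add_cos_sq t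

theorem XF_iint (f : WW) : iT n2 (XF f t) = 2*π*n2 f := by
  simp only [XF_id]
  rw [ii_add cf2 cf2, ii_add cf2 cf2,
    ii_cm, ii_cm, integral_cos, integral_sin]
  simp only [intervalIntegral.integral_const, sin_pi, sin_neg, cos_neg, sub_self, neg_zero, mul_zero, add_zero, smul_eq_mul]; ring

def Lxy : WW →L[ℝ] WW := L1.prod (L2.prod 0)

theorem frame_bd {X T : Q2 → WW} (hX : M2 X) (hT : M2 T) (f : WW) {σ : ℝ} (h : 0 < σ) (h2 : 2*σ ≤ 1) :
    n2 f ≤ (iSg p.1⁻¹ * n2 ((X p).1, (X p).2.1, 0)) + QQ X T f σ := by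
  have c : Continuous fun t => n2 (XF f t) := n2_cont.comp (by unfold XF eF qF; fun_prop)
  obtain ⟨i0, e0⟩ := r_prod c h
  rw [XF_iint] at e0
  have hX' : M2 (fun p => X30) := by
    have h3 := Lxy.comp_memLp' hX
    have e3 : (Lxy ∘ fun p => p.1^2 • X p) = fun p => p.1^2 • X30 := funext fun p => by rw [Function.comp, map_smul]; rfl
    rw [e3] at h3; exact h3
  have i1 := n2_int (m := fun _ => 0) hX' continuous_const h h2
  simp only [sub_zero] at i1
  have i2 := QQ_int hX hT f h h2
  have : iSg p.1⁻¹ * n2 (XF f p.2) ≤ iSg (2 * (p.1⁻¹ * n2 ((X p).1, (X p).2.1, 0)) + 2 * (p.1⁻¹ * nX)) := by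
    refine setIntegral_mono_on i0 ((i1.const_mul 2).add (i2.const_mul 2)) oM fun p hp => ?_
    have a := n2_add X30 (XF f p.2 - X30)
    rw [add_sub_cancel] at a
    have b : n2 (XF f p.2 - X30) ≤ n2 (X p - XF f p.2) := by
      simp only [n2, XF, Prod.fst_sub, Prod.snd_sub, norm_sub_rev (X p).1, norm_sub_rev (X p).2.1, sub_zero, norm_zero]
      have := sq_nonneg ‖(X p).2.2‖
      linarith
    have c := n2_nonneg (T p - TF f p.2)
    have := mln (show n2 (XF f p.2) ≤ 2 * n2 X30 + 2*nX by linarith) (inv_nonneg.2 (h.trans hp.1.1).le)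
    linarith
  rw [e0, integral_add (i1.const_mul 2) (i2.const_mul 2), integral_const_mul, integral_const_mul] at this
  have h6 : 2 ≤ log 2 * (2*π) := by nlinarith [Real.pi_gt_three, Real.log_two_gt_d9]
  have := mul_le_mul_of_nonneg_right h6 (n2_nonneg f)
  unfold QQ; linarith

theorem dy {g : Fs} (hg : ∀ p, 0 < p.1 → 0 ≤ g p) (hi : ∀ a : ℝ, 0 < a → IntegrableOn g (Om a (1/2))) (J : ℕ) :
    ∑ j ∈ Finset.range J, ∫ p in Om ((1/2)^(j+2)) (2*(1/2)^(j+2)), g p ≤ ∫ p in Om ((1/2)^(J+1)) (1/2), g p := by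
  induction J with
  | zero => simpa using setIntegral_nonneg oM fun p hp => hg p (lt_trans nrm0 hp.1.1)
  | succ J ih =>
    rw [Finset.sum_range_succ]
    have e : (2:ℝ)*(1/2)^(J+2) = (1/2)^(J+1) := by rw [pow_succ]; ring
    have p1 : zR < (1/2)^(J+2) := by positivity
    have le1 : ((1:ℝ)/2)^(J+2) ≤ (1/2)^(J+1) := by linarith
    have le2 : ((1:ℝ)/2)^(J+1) ≤ 1/2 := pow_le_of_le_one nrm0 nrm0 (by lia)
    rw [e]
    have s1 := Om_mono (le_refl ((1/2:ℝ)^(J+2))) le2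
    have s2 := Om_mono le1 (le_refl (1/2 : ℝ))
    have dj : Disjoint (Om ((1/2)^(J+1)) (1/2)) (Om ((1/2)^(J+2)) ((1/2)^(J+1))) := Set.disjoint_left.2 fun p h1 h2 => by
      have := h1.1.1
      have := h2.1.2
      linarith
    refine (add_le_add ih le_rfl).trans ?_
    rw [← setIntegral_union dj oM ((hi _ p1).mono_set s2) ((hi _ p1).mono_set s1)]
    refine setIntegral_mono_set (hi _ p1) ((ae_restrict_iff' oM).2 (.of_forall fun p hp => hg p (p1.trans hp.1.1))) (LE.le.eventuallyLE (Set.union_subset s2 s1))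

theorem pig {Δ C h : ℝ} {y : YY} (hy : CDy) (hB : Bd Δ C h y) {J : ℕ} (hJ : 0 < J) (hh : h ≤ (1/2)^(J+1)) :
    ∃ j ∈ Finset.range J, QQ (Xf y) (Xtf y) (fr y ((1/2)^(j+2))) ((1/2)^(j+2)) ≤ 600 * (C / J) := by
  have p0 : zR < (1/2)^(J+1) := by positivity
  have p1 : ((1:ℝ)/2)^(J+1) < 1/2 := pow_lt_self_of_lt_one₀ nrm0 nrm0 (by lia)
  have h1 := hB.s _ hh p0 p1
  have e : ∫ p in Om ((1/2)^(J+1)) (1/2), (max p.1 ((1/2)^(J+1)))⁻¹ * (eps (ef y) (qf y) (etf y) (qtf y) p + dl0 (ef y) (qf y) p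
      + p.1^2 * eq2 + ‖zf y p‖^2) = ∫ p in Om ((1/2)^(J+1)) (1/2), p.1⁻¹ * Dd y p :=
    setIntegral_congr_fun oM fun p hp => by simp only [max_eq_left hp.1.1.le]; rfl
  rw [e] at h1
  have h2 := (dy (fun p hp => mul_nonneg (inv_nonneg.2 hp.le) (Dd_nn y p)) (fun a ha => Dd_int hy ha) J).trans h1
  have h3 : ∑ j ∈ Finset.range J, ∫ p in Om ((1/2)^(j+2)) (2*(1/2)^(j+2)), p.1⁻¹ * Dd y p ≤ ∑ j ∈ Finset.range J, C / J := by
    have : (J:ℝ) ≠ 0 := by positivity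
    simpa [mul_div_cancel₀ _ this] using h2
  obtain ⟨j, hj, h4⟩ := Finset.exists_le_of_sum_le ⟨0, Finset.mem_range.2 hJ⟩ h3
  refine ⟨j, hj, (Qn hy pv ?_).trans la⟩
  rw [pow_add]
  have : ((1:ℝ)/2)^j ≤ 1 := pow_le_one₀ nrm0 nrm0
  nlinarith

variable {Δ : ℝ} {y : ℕ → YY} {e q z er qr k : Fe}

theorem Lim.wX (h : Lm) : WK (fun n => Xf (y n)) (fun p => X3) := h.we.prod (h.wq.prod h.wz)

theorem n2_bd {f : ℕ → WW} {M : ℝ} (h : ∀ n, n2 (f n) ≤ M) : ∃ g : WW, ∃ φ : ℕ → ℕ, StrictMono φ ∧ Tendsto (fun n => n2 (f (φ n) - g)) atTop (𝓝 0) := by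
  have hb : Bornology.IsBounded (closedBall (0:WW) (√M)) := isBounded_closedBall
  obtain ⟨g, _, φ, hφ, hl⟩ := tendsto_subseq_of_bounded hb (x := f) fun n => by
    rw [mem_closedBall, dist_zero_right]
    exact Real.le_sqrt_of_sq_le ((sq_le_n2 _).trans (h n))
  refine ⟨g, φ, hφ, ?_⟩
  have := (n2_cont.tendsto _).comp (hl.sub_const g)
  have e0 : n2 (g - g) = 0 := by simp [n2]
  rw [e0] at this; exact this

set_option maxHeartbeats 1000000 in
theorem Lim.bu1 (h : Lm) {C : ℝ} {t : ℕ → ℝ} (ht : Tendsto t atTop (𝓝 0)) (hB : ∀ n, Bd Δ C (t n) (y n)) {ε : ℝ} (hε : 0 < ε) :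
    ∃ f : WW, ∃ σ : ℝ, 0 < σ ∧ σ ≤ 1/4 ∧ QQ (fun p => X3) (Xt0 e q qr k) f σ ≤ ε := by
  obtain ⟨J, hJ⟩ := exists_nat_gt (600 * C * 6 / ε)
  have hJ' : 600 * (C / ((J+1 : ℕ):ℝ)) ≤ ε/6 := by
    push_cast
    rw [div_lt_iff₀ hε] at hJ
    rw [← mul_div_assoc, div_le_iff₀ pv]
    linarith
  have ev : ∀ᶠ n in atTop, t n ≤ (1/2)^(J+1+1) := (ht.eventually_lt_const pv).mono fun n => le_of_lt
  obtain ⟨j, hj, hfr⟩ : ∃ j ∈ Finset.range (J+1), ∃ᶠ n in atTop, QQ (Xf (y n)) (Xtf (y n)) (fr (y n) ((1/2)^(j+2))) ((1/2)^(j+2)) ≤ ε/6 := by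
    by_contra! hc
    have : ∀ᶠ n in atTop, ∀ j ∈ Finset.range (J+1), ¬ QQ (Xf (y n)) (Xtf (y n)) (fr (y n) ((1/2)^(j+2))) ((1/2)^(j+2)) ≤ ε/6 :=
      (Filter.eventually_all_finset _).2 fun j hj => by simpa [Filter.not_frequently] using hc j hj
    obtain ⟨n, h1, h2⟩ := (this.and ev).exists
    obtain ⟨j, hj, h3⟩ := pig (h.cd n) (hB n) J.succ_pos h2
    exact h1 j hj (h3.trans hJ')
  set σ : ℝ := (1/2)^(j+2) with hσ
  have σ0 : 0 < σ := by positivity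
  have σ1 : σ ≤ 1/4 := by
    rw [hσ, pow_add]
    have : ((1:ℝ)/2)^j ≤ 1 := pow_le_one₀ nrm0 nrm0
    nlinarith
  have σ2 : 2*σ ≤ 1 := by linarith
  obtain ⟨ψ, hψ, hq⟩ := Filter.extraction_of_frequently_atTop hfr
  have mX : ∀ n, M2 (Xf (y n)) := fun n => cont_mlp (by have := (X_pc1 (h.cd n)).c; fun_prop)
  have mT : ∀ n, M2 (Xtf (y n)) := fun n => cont_mlp (by have := (X_pc1 (h.cd n)).ct; fun_prop)
  have fb : ∀ n, n2 (fr (y (ψ n)) σ) ≤ (σ^5)⁻¹ * C + ε/6 := fun n => by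
    refine (frame_bd (mX (ψ n)) (mT (ψ n)) _ σ0 σ2).trans (add_le_add ?_ (hq n))
    set w := y (ψ n)
    obtain ⟨c1,c2,c3,c4,c5,c6⟩ := cont_fields (h.cd (ψ n))
    have cz := (z_pc1 (h.cd (ψ n))).c
    have cF : Continuous fun p : Q2 => p.1^4 * (‖ef w p‖^2 + ‖qf w p‖^2 + ‖zf w p‖^2) := by fun_prop
    have b1 : iSg p.1^4 * (‖ef w p‖^2 + ‖qf w p‖^2 + ‖zf w p‖^2) ≤ C := by
      refine le_trans ?_ (hB (ψ n)).f
      refine setIntegral_mono_set (cont_Om cF _ _) ((ae_restrict_iff' oM).2 (.of_forall fun p hp => ?_)) (LE.le.eventuallyLE (Om_mono σ0.le σ2))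
      simp only [Pi.zero_apply]; positivity
    refine le_trans ?_ (mln b1 pv)
    rw [← integral_const_mul]
    have i0 : IntegrableOn (fun p : Q2 => p.1⁻¹ * n2 ((Xf w p).1, (Xf w p).2.1, 0)) (Om σ sS) := by
      have := inv_int (F := fun p => n2 ((Xf w p).1, (Xf w p).2.1, 0)) σ0 (cont_Om (n2_cont.comp (by unfold Xf; fun_prop)) σ sS) 1
      simpa using this
    refine setIntegral_mono_on i0 ((cont_Om cF _ _).const_mul _) oM fun p hp => ?_
    have hp0 := σ0.trans hp.1.1
    have : p.1⁻¹ ≤ (σ^5)⁻¹ * p.1^4 := by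
      rw [inv_mul_eq_div, inv_eq_one_div, div_le_div_iff₀ hp0 pv]
      have := pow_le_pow_left₀ σ0.le hp.1.1.le 5
      nlinarith
    have hz := sq_nonneg ‖zf w p‖
    simp only [n2, Xf, norm_zero]
    rw [← mul_assoc]
    exact mul_le_mul this la pv pv
  obtain ⟨f, φ, hφ, hl⟩ := n2_bd fb
  refine ⟨f, σ, σ0, σ1, ?_⟩
  have fq : ∃ᶠ n in atTop, QQ (Xf (y n)) (Xtf (y n)) f σ ≤ ε/2 := by
    have e1 : ∀ᶠ n in atTop, QQ (Xf (y (ψ (φ n)))) (Xtf (y (ψ (φ n)))) f σ ≤ ε/2 := by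
      filter_upwards [hl.eventually_lt_const (show zR < ε/(6*256) by positivity)] with n hn
      have := QQ_tri (mX (ψ (φ n))) (mT (ψ (φ n))) f (fr (y (ψ (φ n))) σ) σ0 σ2
      have := hq (φ n)
      rw [lt_div_iff₀ nrm0] at hn
      linarith
    exact ((hψ.comp hφ).tendsto_atTop).frequently (p := fun n => QQ (Xf (y n)) (Xtf (y n)) f σ ≤ ε/2) e1.frequently
  have sp : ∀ {X T : Q2 → WW}, M2 X → M2 T → QQ X T f σ = (iSg p.1⁻¹ * n2 (X p - XF f p.2)) + iSg p.1⁻¹ * n2 (T p - TF f p.2) := fun hX hT => by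
    unfold QQ
    rw [← integral_add (n2_int hX (XF_cont f) σ0 σ2) (n2_int hT (TF_cont f) σ0 σ2)]
    simp only [mul_add]
  have nn : ∀ (X m : Q2 → WW), 0 ≤ iSg p.1⁻¹ * n2 (X p - m p) := fun X m => setIntegral_nonneg oM fun p hp => mul_nonneg (inv_nonneg.2 (σ0.trans hp.1.1).le) (n2_nonneg _)
  have l1 := lsc h.wX (XF_cont f) (c := ε/2) σ0 σ2 (fq.mono fun n hn => by
    have := nn (Xtf (y n)) (fun p => TF f p.2)
    rw [sp (mX n) (mT n)] at hn
    linarith)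
  have l2 := lsc h.xt (TF_cont f) (c := ε/2) σ0 σ2 (fq.mono fun n hn => by
    have := nn (Xf (y n)) (fun p => XF f p.2)
    rw [sp (mX n) (mT n)] at hn
    linarith)
  rw [sp h.wX.m h.xt.m]
  linarith

theorem Lim.bu (h : Lm) {C : ℝ} {t : ℕ → ℝ} (ht : Tendsto t atTop (𝓝 0)) (hB : ∀ n, Bd Δ C (t n) (y n)) :
    ∃ f : WW, ∀ ε : ℝ, 0 < ε → ∃ σ : ℝ, 0 < σ ∧ σ ≤ 1/4 ∧ QQ (fun p => X3) (Xt0 e q qr k) f σ ≤ ε := by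
  choose f σ σ0 σ1 hq using fun n : ℕ => h.bu1 ht hB (ε := 1/((n:ℝ)+1)) Nat.one_div_pos_of_nat
  have mX := h.wX.m
  have mT := h.xt.m
  have fb : ∀ n, n2 (f n) ≤ 17 := fun n => by
    have s2 : 2 * σ n ≤ 1 := by linarith [σ1 n]
    have a := frame_bd mX mT (f n) (σ0 n) s2
    have b : (∫ p in Om (σ n) (2*σ n), p.1⁻¹ * n2 (e p, q p, 0)) ≤ 16 := by
      have hr := r_int (σ0 n)
      have : ∀ᵐ p ∂(volume.restrict (Om (σ n) (2*σ n))), p.1⁻¹ * n2 (e p, q p, 0) ≤ 2 * p.1⁻¹ := by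
        filter_upwards [ae_mono (Measure.restrict_mono (Om_mono (σ0 n).le s2) le_rfl) h.ce, ae_mono (Measure.restrict_mono (Om_mono (σ0 n).le s2) le_rfl) h.cq, ae_restrict_mem oM] with p h1 h2 hp
        have := (σ0 n).trans hp.1.1
        simp only [n2, h1, h2, norm_zero]
        rw [mul_comm]
        gcongr
        nlinarith [sq_nonneg Δ]
      refine (integral_mono_of_nonneg ((ae_restrict_iff' oM).2 (.of_forall fun p hp => ?_)) (hr.1.const_mul 2) this).trans ?_
      · exact mul_nonneg (inv_nonneg.2 ((σ0 n).trans hp.1.1).le) (n2_nonneg _)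
      · rw [integral_const_mul, hr.2]
        nlinarith [Real.pi_lt_d2, Real.log_two_lt_d9, Real.pi_pos, Real.log_two_gt_d9]
    have c : 1/((n:ℝ)+1) ≤ 1 := by rw [div_le_one pv]; linarith [n.cast_nonneg (α := ℝ)]
    linarith [hq n]
  obtain ⟨g, φ, hφ, hl⟩ := n2_bd fb
  refine ⟨g, fun ε hε => ?_⟩
  have l2 := (tendsto_one_div_add_atTop_nhds_zero_nat (𝕜 := ℝ)).comp hφ.tendsto_atTop
  obtain ⟨n, h1, h2⟩ := ((hl.eventually_lt_const (show zR < ε/512 by positivity)).and (l2.eventually_lt_const (show zR < ε/4 by positivity))).exists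
  refine ⟨σ (φ n), σ0 _, σ1 _, ?_⟩
  have := QQ_tri mX mT g (f (φ n)) (σ0 (φ n)) (by linarith [σ1 (φ n)])
  have := hq (φ n)
  simp only [Function.comp] at h2
  linarith
end

section
variable {Δ : ℝ} {y : ℕ → YY} {e q z er qr k : Fe}

/-- constraints pass to the frame -/
theorem Lim.frame (h : Lm) {f : WW} (hf : ∀ ε : ℝ, 0 < ε → ∃ σ : ℝ, 0 < σ ∧ σ ≤ 1/4 ∧ QQ (fun p => X3) (Xt0 e q qr k) f σ ≤ ε) :
    ‖f.1‖^2 = Δ^2 ∧ ‖f.2.1‖^2 = 1-Δ^2 ∧ ‖f.2.2‖^2 = 1-Δ^2 ∧ inner ℝ f.1 f.2.1 = 0 ∧ inner ℝ f.1 f.2.2 = 0 ∧ inner ℝ f.2.1 f.2.2 = 0 := by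
  have hpi := Real.pi_pos
  let G : ℝ → ℝ := fun t => (‖eF f t‖^2 - 1)^2 + (‖qF f t‖^2 - dD)^2 + (inner ℝ (eF f t) (qF f t))^2
  have cG : Continuous G := by simp only [G, eF, qF]; fun_prop
  have nG : ∀ t, 0 ≤ G t := fun t => by positivity
  set B := 8 * n2 f with hB
  have B0 : 0 ≤ B := mul_nonneg nrm0 (n2_nonneg f)
  have key : ∀ p, ‖e p‖^2 = 1 → ‖q p‖^2 = 1-Δ^2 → inner ℝ (e p) (q p) = 0 → G p.2 ≤ (4*B+4) * n2 (X3 - XF f p.2) := fun p h1 h2 h3 => by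
    have b := (XF_n2 f p.2).1
    have b1 : ‖eF f p.2‖^2 + ‖qF f p.2‖^2 ≤ B := by
      have : n2 (XF f p.2) = ‖eF f p.2‖^2 + ‖qF f p.2‖^2 := by simp [n2, XF]
      rw [this] at b; exact b
    have be := sq_nonneg ‖eF f p.2‖
    have bq := sq_nonneg ‖qF f p.2‖
    have q1 : ‖q p‖^2 ≤ 1 := by nlinarith [sq_nonneg Δ]
    have sqi : ∀ u v : E3, (‖u‖^2 - ‖v‖^2)^2 ≤ ‖v - u‖^2 * (2*‖u‖^2+2*‖v‖^2) := fun u v => by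
      have a1 : ‖u‖^2 - ‖v‖^2 = inner ℝ (u - v) (u + v) := by
        rw [inner_add_right, inner_sub_left, inner_sub_left, ris, ris, real_inner_comm v u]; ring
      have a2 := abs_real_inner_le_norm (u-v) (u+v)
      rw [a1, ← sq_abs, norm_sub_rev v u]
      refine (pow_le_pow_left₀ (abs_nonneg _) a2 2).trans ?_
      rw [mul_pow]
      gcongr
      exact sq_add_le u v
    have g1 := sqi (eF f p.2) (e p)
    have g2 := sqi (qF f p.2) (q p)
    have g3 : (inner ℝ (eF f p.2) (qF f p.2))^2 ≤ 2*(‖e p - eF f p.2‖^2 * ‖qF f p.2‖^2) + 2*‖q p - qF f p.2‖^2 := by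
      have a1 : inner ℝ (eF f p.2) (qF f p.2) = -inner ℝ (e p - eF f p.2) (qF f p.2) - inner ℝ (e p) (q p - qF f p.2) := by
        rw [inner_sub_left, inner_sub_right, h3]; ring
      have a2 := pow_le_pow_left₀ (abs_nonneg _) (abs_real_inner_le_norm (e p - eF f p.2) (qF f p.2)) 2
      have a3 := pow_le_pow_left₀ (abs_nonneg _) (abs_real_inner_le_norm (e p) (q p - qF f p.2)) 2
      rw [sq_abs, mul_pow] at a2 a3
      rw [h1, one_mul] at a3
      rw [a1]
      nlinarith [sq_nonneg (inner ℝ (e p - eF f p.2) (qF f p.2) - inner ℝ (e p) (q p - qF f p.2))]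
    rw [h1] at g1; rw [h2] at g2
    have s1 := sq_nonneg ‖e p - eF f p.2‖
    have s2 := sq_nonneg ‖q p - qF f p.2‖
    have s3 := sq_nonneg ‖z p‖
    have t1 := mln (show 2*‖eF f p.2‖^2 + 2*1 + 2 * ‖qF f p.2‖^2 ≤ 2*B+2 by linarith) s1
    have t2 := mln (show 2*‖qF f p.2‖^2 + 2*dD + 2 ≤ 2*B+4 by linarith) s2
    have t3 := mul_nonneg B0 s1
    have t4 := mul_nonneg B0 s2
    have t5 := mul_nonneg B0 s3
    simp only [G, n2, XF, Prod.fst_sub, Prod.snd_sub, sub_zero]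
    linarith
  have Gi : log 2 * iT G t ≤ 0 := by
    refine le_of_forall_pos_le_add fun ε hε => ?_
    obtain ⟨σ, s0, s1, hs⟩ := hf (ε / (4*B+4)) pv
    have s2 : 2*σ ≤ 1 := by linarith
    obtain ⟨i0, e0⟩ := r_prod cG s0
    rw [← e0, zero_add]
    have i1 := QQ_int h.wX.m h.xt.m f s0 s2
    rw [le_div_iff₀ pv, mul_comm] at hs
    refine le_trans ?_ hs
    unfold QQ
    rw [← integral_const_mul]
    refine integral_mono_ae i0 (i1.const_mul _) ?_
    have mo := Measure.restrict_mono (Om_mono s0.le s2) (le_refl (volume : Measure (Q2)))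
    filter_upwards [ae_mono mo h.ce, ae_mono mo h.cq, ae_mono mo h.ceq, ae_restrict_mem oM] with p h1 h2 h3 hp
    have := key p h1 h2 h3
    have t := mul_nonneg (show 0 ≤ 4*B+4 by linarith) (n2_nonneg (Xt0 e q qr k p - TF f p.2))
    have := mln (this.trans (le_add_of_nonneg_right t)) (inv_nonneg.2 (s0.trans hp.1.1).le)
    refine this.trans (le_of_eq (by ring))
  have G0 : ∀ t, -π ≤ t → t ≤ π → ‖eF f t‖^2 = 1 ∧ ‖qF f t‖^2 = 1-Δ^2 ∧ inner ℝ (eF f t) (qF f t) = 0 := fun t h1 h2 => by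
    have : G t = 0 := by
      by_contra hne
      have := intervalIntegral.integral_pos (show -π < π by linarith) cG.continuousOn (fun x _ => nG x) ⟨t, ⟨h1, h2⟩, lt_of_le_of_ne (nG t) (Ne.symm hne)⟩
      have := mul_pos (Real.log_pos (by norm_num : (1:ℝ) < 2)) this
      linarith
    simp only [G] at this
    have a1 := sq_nonneg (‖eF f t‖^2 - 1)
    have a2 := sq_nonneg (‖qF f t‖^2 - dD)
    have a3 := sq_nonneg (inner ℝ (eF f t) (qF f t) : ℝ)
    have b1 := pow_eq_zero_iff (two_ne_zero) |>.1 (show (‖eF f t‖^2 - 1)^2 = 0 by linarith)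
    have b2 := pow_eq_zero_iff (two_ne_zero) |>.1 (show (‖qF f t‖^2 - dD)^2 = 0 by linarith)
    exact ⟨by linarith, by linarith, pow_eq_zero_iff (two_ne_zero) |>.1 (show (inner ℝ (eF f t) (qF f t) : ℝ)^2 = 0 by linarith)⟩
  obtain ⟨x1, x2, x3⟩ := G0 0 la hpi.le
  obtain ⟨u1, u2, u3⟩ := G0 (π/2) la la
  obtain ⟨v1, v2, v3⟩ := G0 π la le_rfl
  simp only [eF, qF, cos_zero, sin_zero, cos_pi_div_two, sin_pi_div_two, cos_pi, sin_pi, one_smul, zero_smul, neg_smul, add_zero, sub_zero, zero_sub, norm_neg, inner_neg_right, inner_add_left, inner_neg_left] at *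
  rw [norm_add_sq_real] at x1 u1 v1
  rw [norm_neg] at v1
  rw [inner_neg_right] at v1
  rw [real_inner_comm f.2.1 f.2.2] at u3
  exact ⟨by linarith, u2, x2, by linarith, by linarith, by linarith⟩

def RW (R : E3 ≃ₗᵢ[ℝ] E3) (x : WW) : WW := (R x.1, R x.2.1, R x.2.2)
theorem RW_n2 (R : E3 ≃ₗᵢ[ℝ] E3) (x : WW) : n2 (RW R x) = n2 x := by simp [n2, RW]
theorem RW_sub (R : E3 ≃ₗᵢ[ℝ] E3) (x w : WW) : RW R x - RW R w = RW R (x - w) := by simp [RW]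
theorem RW_XF (R : E3 ≃ₗᵢ[ℝ] E3) (f : WW) (t : ℝ) : XF (RW R f) t = RW R (XF f t) ∧ TF (RW R f) t = RW R (TF f t) := by simp [RW, XF, TF, eF, qF]
theorem RW_QQ (R : E3 ≃ₗᵢ[ℝ] E3) (X T : Q2 → WW) (f : WW) (σ : ℝ) : QQ (fun p => RW R (X p)) (fun p => RW R (T p)) (RW R f) σ = QQ X T f σ := by
  simp only [QQ, RW_XF, RW_sub, RW_n2]

theorem Lim.rot (h : Lm) (R : E3 ≃ₗᵢ[ℝ] E3) :
    Lim Δ (fun n => Ry (y n) R 0) (fun p => R (e p)) (fun p => R (q p)) (fun p => R (z p)) (fun p => R (er p)) (fun p => R (qr p)) (fun p => R (k p)) := by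
  let L : E3 →L[ℝ] E3 := RE
  have cd := h.cd
  have e1 : ∀ n, ef (Ry (y n) R 0) = fun p => L (ef (y n) p) := fun n => funext fun p => Ry_e (cd n) R 0 p
  have e2 : ∀ n, qf (Ry (y n) R 0) = fun p => L (qf (y n) p) := fun n => funext fun p => Ry_q (cd n) R 0 p
  have e3 : ∀ n, zf (Ry (y n) R 0) = fun p => L (zf (y n) p) := fun n => funext fun p => by
    unfold zf; rw [Ry_e (cd n) R 0 p, map_sub, map_smul]; simp [Yf, Ry, L]
  have e4 : ∀ n, erf (Ry (y n) R 0) = fun p => L (erf (y n) p) := fun n => funext fun p => Ry_er (cd n) R 0 p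
  have e5 : ∀ n, qrf (Ry (y n) R 0) = fun p => L (qrf (y n) p) := fun n => funext fun p => Ry_qr (cd n) R 0 p
  have e6 : ∀ n, kf (Ry (y n) R 0) = fun p => L (kf (y n) p) := fun n => funext fun p => Ry_k (cd n) R 0 p
  refine ⟨fun n => Ry_cd (cd n) R 0, ?_, ?_, ?_, ?_, ?_, ?_, ?_, ?_, ?_, ?_, ?_, ?_⟩
  · simp only [e1]; exact h.we.lin L
  · simp only [e2]; exact h.wq.lin L
  · simp only [e3]; exact h.wz.lin L
  · simp only [e4]; exact h.wer.lin L
  · simp only [e5]; exact h.wqr.lin L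
  · simp only [e6]; exact h.wk.lin L
  · filter_upwards [h.ae] with p hp; simp only [e1]; exact (L.continuous.tendsto _).comp hp
  · filter_upwards [h.aq] with p hp; simp only [e2]; exact (L.continuous.tendsto _).comp hp
  · filter_upwards [h.az] with p hp; simp only [e3]; exact (L.continuous.tendsto _).comp hp
  · simpa using h.ce
  · simpa using h.cq
  · simpa using h.ceq

def f0 (Δ : ℝ) : WW := (EuclideanSpace.single 2 Δ, EuclideanSpace.single 0 (√dD), EuclideanSpace.single 1 (√dD))

theorem frame_rot (hΔ : 0 < Δ) (hΔ1 : Δ^2 < 1) {f : WW} (h : ‖f.1‖^2 = Δ^2 ∧ ‖f.2.1‖^2 = 1-Δ^2 ∧ ‖f.2.2‖^2 = 1-Δ^2 ∧ inner ℝ f.1 f.2.1 = 0 ∧ inner ℝ f.1 f.2.2 = 0 ∧ inner ℝ f.2.1 f.2.2 = 0) :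
    ∃ R : E3 ≃ₗᵢ[ℝ] E3, RW R f = f0 Δ := by
  obtain ⟨h1, h2, h3, h4, h5, h6⟩ := h
  set c := √dD with hc
  have c0 : 0 < c := Real.sqrt_pos.2 la
  have cs : c^2 = 1-Δ^2 := Real.sq_sqrt la
  have n1 : ‖f.1‖ = Δ := by rw [← Real.sqrt_sq (norm_nonneg f.1), h1, Real.sqrt_sq hΔ.le]
  have n2 : ‖f.2.1‖ = c := by rw [← Real.sqrt_sq (norm_nonneg f.2.1), h2]
  have n3 : ‖f.2.2‖ = c := by rw [← Real.sqrt_sq (norm_nonneg f.2.2), h3]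
  let v : Fin 3 → E3 := ![c⁻¹ • f.2.1, c⁻¹ • f.2.2, Δ⁻¹ • f.1]
  have ov : Orthonormal ℝ v := by
    constructor
    · intro i; fin_cases i <;> simp [v, norm_smul, n1, n2, n3, abs_of_pos, c0, hΔ, c0.ne', hΔ.ne']
    · intro i j hij
      have h4' := h4
      have h5' := h5
      have h6' := h6
      rw [real_inner_comm] at h4' h5' h6'
      fin_cases i <;> fin_cases j <;> simp [v, inner_smul_left, inner_smul_right, h4, h5, h6, h4', h5', h6'] at hij ⊢
  let b := OrthonormalBasis.mk ov (by
    have := ov.linearIndependent.span_eq_top_of_card_eq_finrank' (by simp)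
    rw [this])
  have hb : ∀ i, b.repr (v i) = EuclideanSpace.single i 1 := fun i => by
    have : v i = b i := by simp [b]
    rw [this, b.repr_self]
  have r1 : f.2.1 = c • v 0 := by simp [v, smul_smul, c0.ne']
  have r2 : f.2.2 = c • v 1 := by simp [v, smul_smul, c0.ne']
  have r3 : f.1 = Δ • v 2 := by simp [v, smul_smul, hΔ.ne']
  refine ⟨b.repr, ?_⟩
  simp only [RW, f0]
  rw [r1, r2, r3, map_smul, map_smul, map_smul, hb, hb, hb]
  refine Prod.ext ?_ (Prod.ext ?_ ?_) <;> ext i <;> fin_cases i <;> simp [c]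

theorem f0_eF (t : ℝ) : eF (f0 Δ) t = e0 Δ t ∧ qF (f0 Δ) t = q0 Δ t := by
  constructor <;> ext i <;> fin_cases i <;> simp [eF, qF, f0, e0, q0, mul_comm]

/-- normalised limit -/
structure NL (Δ : ℝ) (y : ℕ → YY) (e q z er qr k : Fe) : Prop extends Lm where
  bu : ∀ ε : ℝ, 0 < ε → ∃ σ : ℝ, 0 < σ ∧ σ ≤ 1/4 ∧ QQ (fun p => X3) (Xt0 e q qr k) (f0 Δ) σ ≤ ε
  p0 : 0 < Δ
  p1 : Δ^2 < 1

theorem Lim.nl (h : Lm) (p0 : 0 < Δ) (p1 : Δ^2 < 1) {C : ℝ} {t : ℕ → ℝ} (ht : Tendsto t atTop (𝓝 0)) (hB : ∀ n, Bd Δ C (t n) (y n)) :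
    ∃ R : E3 ≃ₗᵢ[ℝ] E3, NL Δ (fun n => Ry (y n) R 0) (fun p => R (e p)) (fun p => R (q p)) (fun p => R (z p)) (fun p => R (er p)) (fun p => R (qr p)) (fun p => R (k p)) := by
  obtain ⟨f, hf⟩ := h.bu ht hB
  obtain ⟨R, hR⟩ := frame_rot p0 p1 (h.frame hf)
  refine ⟨R, h.rot R, fun ε hε => ?_, p0, p1⟩
  obtain ⟨σ, s0, s1, hs⟩ := hf ε hε
  refine ⟨σ, s0, s1, le_trans (le_of_eq ?_) hs⟩
  rw [← RW_QQ R (fun p => X3) (Xt0 e q qr k) f σ, hR]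
  congr 1
  ext1 p; simp [Xt0, RW]
end

section
variable {Δ : ℝ} {y : ℕ → YY} {e q z er qr k : Fe}

theorem Pf_cone {u0 : ℝ → ℝ} (c0 : Continuous u0) {σ : ℝ} (hσ : 0 < σ) (hσ2 : σ < 1/2) : ∫ p : Q2, d4 * u0 p.2 ∂nu = 0 := by
  have cd : Continuous (deriv (Pf σ)) := (Pf_cd σ).continuous_deriv le_rfl
  rw [Om_J (F := fun p => u0 p.2) fp (fun r => deriv (Pf σ) r - 4*r^3) fp zero_le_one]
  simp only [JJ, intervalIntegral.integral_mul_const]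
  have : iR (deriv (Pf σ) r - 4*r^3) = (Pf σ 1 - 1^4) - (Pf σ 0 - 0^4) := by
    refine intervalIntegral.integral_eq_sub_of_hasDerivAt (f := fun r => Pf σ r - r^4) (fun r _ => ?_) cf2
    refine ((((Pf_cd σ).differentiable one_ne_zero) r).hasDerivAt.fun_sub (hasDerivAt_pow 4 r)).congr_deriv nrm0
  rw [this, Pf_one hσ la, Pf_zero hσ hσ.le]; norm_num

theorem NL.tr (h : NL Δ y e q z er qr k) {u : Fs} {u0 : ℝ → ℝ} (c0 : Continuous u0) (hu : Integrable (fun p => p.1^2 * u p) nu)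
    (h1 : ∀ σ : ℝ, 0 < σ → σ < 1/2 → ∫ p, d4 * u p ∂nu = 0) {M : ℝ} (hM0 : 0 ≤ M)
    (hM : ∀ᵐ p ∂nu, |u p - u0 p.2| ≤ M * (‖X3 - XF (f0 Δ) p.2‖ + ‖Xt0 e q qr k p - TF (f0 Δ) p.2‖)) :
    Integrable (fun p => p.1^3 * u p) nu ∧ ∫ p, p.1^3 * u p ∂nu = ∫ p : Q2, p.1^3 * u0 p.2 ∂nu := by
  have i0 : Integrable (fun p : Q2 => p.1^2 * u0 p.2) nu := cont_Om fp 0 1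
  have i3 : Integrable (fun p : Q2 => p.1^3 * u0 p.2) nu := cont_Om fp 0 1
  have ui : Integrable (fun p => p.1^3 * u p) nu := (P_int hu (show zR < 1 by norm_num)).2
  refine ⟨ui, ?_⟩
  have iw : Integrable (fun p => p.1^2 * (u p - u0 p.2)) nu := (hu.sub' i0).congr (.of_forall fun p => by simp only; ring)
  have main : ∫ p, p.1^3 * (u p - u0 p.2) ∂nu = 0 := by
    refine trans0 (u := fun p => u p - u0 p.2) iw (fun σ s0 s1 => ?_) fun ε hε => ?_
    · have a1 : Integrable (fun p => d4 * u p) nu := by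
        obtain ⟨b1, b2⟩ := P_int hu s0
        exact (b1.sub' (b2.const_mul 4)).congr (.of_forall fun p => by simp only; ring)
      have a2 : Integrable (fun p : Q2 => d4 * u0 p.2) nu := by
        obtain ⟨b1, b2⟩ := P_int i0 s0
        exact (b1.sub' (b2.const_mul 4)).congr (.of_forall fun p => by simp only; ring)
      simp only [mul_sub]
      rw [integral_sub a1 a2, h1 σ s0 s1, Pf_cone c0 s0 s1, sub_zero]
    · have hl := Real.log_pos (by norm_num : (1:ℝ) < 2)
      have hpi := Real.pi_pos
      set A := M * (2*π*log 2) with hA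
      have A0 : 0 ≤ A := by positivity
      set δ := ε / (2*(A+1)) with hδ
      have d0 : 0 < δ := by positivity
      obtain ⟨σ, s0, s1, hs⟩ := h.bu (ε * δ / (4 * (M+1))) pv
      have s2 : 2*σ ≤ 1 := by linarith
      refine ⟨σ, s0, by linarith, ?_⟩
      have iq := QQ_int h.wX.m h.xt.m (f0 Δ) s0 s2
      obtain ⟨ir, er'⟩ := r_int s0
      have mo := Measure.restrict_mono (Om_mono s0.le s2) (le_refl (volume : Measure (Q2)))
      have iw' : IntegrableOn (fun p => p.1⁻¹ * |u p - u0 p.2|) (Om σ sS) := by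
        have := inv_int s0 (iw.mono_measure mo).abs 3
        refine this.congr ((ae_restrict_iff' oM).2 (.of_forall fun p hp => ?_))
        have : 0 < p.1 := s0.trans hp.1.1
        simp only [abs_mul, abs_of_pos (pow_pos this 2)]
        field_simp
      have key : iSg p.1⁻¹ * |u p - u0 p.2| ≤ iSg ((M*δ) * p.1⁻¹ + (2*M/δ) * (p.1⁻¹ * (n2 (X3 - XF (f0 Δ) p.2) + n2 (Xt0 e q qr k p - TF (f0 Δ) p.2)))) := by
        refine integral_mono_ae iw' ((ir.const_mul _).add (iq.const_mul _)) ?_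
        filter_upwards [ae_mono mo hM, ae_restrict_mem oM] with p hp hp'
        have hp0 : 0 < p.1 := s0.trans hp'.1.1
        have e1 := sq_le_n2 (X3 - XF (f0 Δ) p.2)
        have e2 := sq_le_n2 (Xt0 e q qr k p - TF (f0 Δ) p.2)
        set a := ‖X3 - XF (f0 Δ) p.2‖
        set b := ‖Xt0 e q qr k p - TF (f0 Δ) p.2‖
        set N := n2 (X3 - XF (f0 Δ) p.2) + n2 (Xt0 e q qr k p - TF (f0 Δ) p.2)
        have e3 : a + b ≤ δ + 2 * N / δ := by
          have : 2*δ*(a+b) ≤ 2*(δ * (δ + 2*N/δ)) := by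
            have : δ * (δ + 2*N/δ) = δ^2 + 2*N := by field_simp
            rw [this]
            nlinarith [sq_nonneg (δ-(a+b)), sq_nonneg (a-b)]
          nlinarith
        have e4 := mln (hp.trans (mln e3 hM0)) (inv_nonneg.2 hp0.le)
        refine e4.trans (le_of_eq (by ring))
      refine key.trans ?_
      rw [integral_add (ir.const_mul _) (iq.const_mul _), integral_const_mul, integral_const_mul, er']
      have e5 : M*δ*(2*π*log 2) ≤ ε/2 := by
        have : M*δ*(2*π*log 2) = ε/2 * (A/(A+1)) := by rw [hδ, hA]; field_simp
        rw [this]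
        have : A/(A+1) ≤ 1 := by rw [div_le_one la]; linarith
        nlinarith
      have e6 : 2*M/δ * QQ (fun p => X3) (Xt0 e q qr k) (f0 Δ) σ ≤ ε/2 := by
        refine (mln hs pv).trans ?_
        have : 2*M/δ * (ε*δ/(4*(M+1))) = ε/2 * (M/(M+1)) := by field_simp; ring
        rw [this]
        have : M/(M+1) ≤ 1 := by rw [div_le_one la]; linarith
        nlinarith
      unfold QQ at e6
      linarith
  simp only [mul_sub] at main
  rw [integral_sub ui i3] at main
  linarith

theorem TF_bd (f : WW) : ∃ K, 0 ≤ K ∧ ∀ t, ‖TF f t‖ ≤ K := ⟨√(8*n2 f), Real.sqrt_nonneg _, fun t =>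
  Real.le_sqrt_of_sq_le ((sq_le_n2 _).trans (XF_n2 f t).2)⟩

theorem H_lip {G1 G2 : WW → ℝ} (c1 : Cb G1) (c2 : Cb G2) {K : ℝ} (hK : ∀ x w, ‖fderiv ℝ G2 x - fderiv ℝ G2 w‖ ≤ K * ‖x - w‖) (f : WW) :
    ∃ M, 0 ≤ M ∧ ∀ X T t, |G1 X * fderiv ℝ G2 X T - G1 (XF f t) * fderiv ℝ G2 (XF f t) (TF f t)| ≤ M * (‖X - XF f t‖ + ‖T - TF f t‖) := by
  obtain ⟨M1, m1⟩ := c1.b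
  obtain ⟨D1, d1⟩ := c1.d
  obtain ⟨D2, d2⟩ := c2.d
  obtain ⟨B, B0, hB⟩ := TF_bd f
  have M10 : 0 ≤ M1 := (abs_nonneg _).trans (m1 0)
  have D10 : 0 ≤ D1 := (norm_nonneg _).trans (d1 0)
  have D20 : 0 ≤ D2 := (norm_nonneg _).trans (d2 0)
  refine ⟨M1*D2 + D1*D2*B + M1 * |K| * B, by positivity, fun X T t => ?_⟩
  have l1 : |G1 X - G1 (XF f t)| ≤ D1 * ‖X - XF f t‖ := by
    have := convex_univ.norm_image_sub_le_of_norm_fderiv_le (𝕜 := ℝ) (f := G1) (fun x _ => c1.c.differentiable one_ne_zero x) (fun x _ => d1 x) (Set.mem_univ (XF f t)) (Set.mem_univ X)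
    exact this
  have hb := hB t
  set W := XF f t
  set S := TF f t
  have ex : G1 X * fderiv ℝ G2 X T - G1 W * fderiv ℝ G2 W S = G1 X * fderiv ℝ G2 X (T - S) + (G1 X - G1 W) * fderiv ℝ G2 X S + G1 W * (fderiv ℝ G2 X - fderiv ℝ G2 W) S := by
    rw [map_sub, _root_.sub_apply]; ring
  rw [ex]
  have t1 : |G1 X * fderiv ℝ G2 X (T - S)| ≤ M1 * (D2 * ‖T - S‖) := by
    rw [abs_mul]
    exact mul_le_mul (m1 X) ((fderiv ℝ G2 X).le_of_opNorm_le (d2 X) _) (abs_nonneg _) M10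
  have t2 : |(G1 X - G1 W) * fderiv ℝ G2 X S| ≤ (D1 * ‖X - W‖) * (D2 * B) := by
    rw [abs_mul]
    exact mul_le_mul l1 (((fderiv ℝ G2 X).le_of_opNorm_le (d2 X) _).trans (by gcongr)) (abs_nonneg _) pv
  have t3 : |G1 W * (fderiv ℝ G2 X - fderiv ℝ G2 W) S| ≤ M1 * ((|K| * ‖X - W‖) * B) := by
    rw [abs_mul]
    refine mul_le_mul (m1 W) ?_ (abs_nonneg _) M10
    refine ((fderiv ℝ G2 X - fderiv ℝ G2 W).le_of_opNorm_le ((hK X W).trans (mul_le_mul_of_nonneg_right (le_abs_self K) no)) S).trans ?_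
    gcongr
  have := abs_add_three (G1 X * fderiv ℝ G2 X (T - S)) ((G1 X - G1 W) * fderiv ℝ G2 X S) (G1 W * (fderiv ℝ G2 X - fderiv ℝ G2 W) S)
  have n1 := norm_nonneg (X - W)
  have n2 := norm_nonneg (T - S)
  have p1 := mul_nonneg (mul_nonneg M10 D20) n1
  have p2 := mul_nonneg (mul_nonneg (mul_nonneg D10 D20) B0) n2
  have p3 := mul_nonneg (mul_nonneg (mul_nonneg M10 (abs_nonneg K)) B0) n2
  linarith

def Nc (i : Fin 3) (x : E3 × E3) : ℝ := crs x.1 x.2 i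

theorem Nc_cd (i : Fin 3) : ContDiff ℝ 2 (Nc i) := by
  have : ContDiff ℝ 2 (fun x : E3 × E3 => pr i (crsL x.1 x.2)) := (pr i).contDiff.comp (ContDiff.clm_apply (crsL.contDiff.comp contDiff_fst) contDiff_snd)
  exact this

/-- second factor -/
def Gb (i : Fin 3) (x : WW) : ℝ := chi (pL x) * Nc i (pL x)
theorem Gb_cb (i : Fin 3) : Cb (Gb i) := cut_cb ((Nc_cd i).of_le nrm0)
theorem Gb_lip (i : Fin 3) : ∃ K : ℝ, ∀ x w, ‖fderiv ℝ (Gb i) x - fderiv ℝ (Gb i) w‖ ≤ K * ‖x - w‖ := by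
  let g : E3 × E3 → ℝ := fun x => chi x * Nc i x
  have cg : ContDiff ℝ 2 g := chi.contDiff.mul (Nc_cd i)
  have hs : HasCompactSupport g := chi.hasCompactSupport.mul_right
  have c1 : ContDiff ℝ 1 (fderiv ℝ g) := cg.fderiv_right (m := 1) nrm0
  obtain ⟨C, hC⟩ := c1.lipschitzWith_of_hasCompactSupport (hs.fderiv ℝ) one_ne_zero
  have e : ∀ x, fderiv ℝ (Gb i) x = (fderiv ℝ g (pL x)).comp pL := fun x => by
    have := fderiv_fun_comp (g := g) x (cg.differentiable nrm0 _) pL.differentiableAt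
    rw [pL.fderiv] at this; exact this
  refine ⟨C * ‖pL‖ * ‖pL‖, fun x w => ?_⟩
  rw [e, e, ← ContinuousLinearMap.sub_comp]
  refine (ContinuousLinearMap.opNorm_comp_le _ _).trans ?_
  have := hC.dist_le_mul (pL x) (pL w)
  rw [dist_eq_norm, dist_eq_norm, ← map_sub] at this
  have := this.trans (mln (pL.le_opNorm (x - w)) C.2)
  calc _ ≤ (C * (‖pL‖ * ‖x-w‖)) * ‖pL‖ := by gcongr
    _ = _ := by ring
end

section
variable {Δ : ℝ} {y : ℕ → YY} {e q z er qr k : Fe}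

def bmp : ContDiffBump (0 : ℝ × E3) := ⟨1, 2, by norm_num, by norm_num⟩
def fa (Δ : ℝ) (m : ℕ) (i : Fin 3) (x : E3 × E3) : ℝ := x.1 i * bmp (m1R • (x.1 2 - dD, x.2))
def Ga (Δ : ℝ) (m : ℕ) (i : Fin 3) (x : WW) : ℝ := chi (pL x) * fa Δ m i (Psi x)

theorem fa_cd (m : ℕ) (i : Fin 3) : ContDiff ℝ 1 (fa Δ m i) := by
  unfold fa
  have a : ∀ i : Fin 3, ContDiff ℝ 1 (fun x : E3 × E3 => x.1 i) := fun i => (pr i).contDiff.comp contDiff_fst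
  exact (a i).mul (bmp.contDiff.comp ((((a 2).sub contDiff_const).prodMk contDiff_snd).const_smul m1R))

theorem Ga_cb (m : ℕ) (i : Fin 3) : Cb (Ga Δ m i) := by
  have c : ContDiff ℝ 1 (Ga Δ m i) := (chi.contDiff.comp pL.contDiff).mul ((fa_cd m i).comp (Psi_cd.of_le nrm0))
  have hs : HasCompactSupport (Ga Δ m i) := by
    refine HasCompactSupport.intro (isCompact_closedBall 0 3) fun x hx => ?_
    rw [mem_closedBall_zero_iff, not_le] at hx
    have hn : ‖x‖ = max ‖x.1‖ (max ‖x.2.1‖ ‖x.2.2‖) := rfl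
    unfold Ga
    by_cases h3 : 3 ≤ ‖pL x‖
    · rw [chi.zero_of_le_dist (by rw [dist_zero_right]; exact h3), zero_mul]
    · have hp : ‖pL x‖ = max ‖x.1‖ ‖x.2.1‖ := rfl
      rw [hp, not_le, max_lt_iff] at h3
      have h4 : 3 < ‖x.2.2‖ := by
        rw [hn, lt_max_iff, lt_max_iff] at hx
        rcases hx with h | h | h
        · linarith [h3.1]
        · linarith [h3.2]
        · exact h
      have : bmp (m1R • ((Psi x).1 2 - dD, (Psi x).2)) = 0 := by
        refine bmp.zero_of_le_dist ?_
        rw [dist_zero_right, norm_smul, rnn pv]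
        have h5 : ‖x.2.2‖ ≤ ‖((Psi x).1 2 - dD, (Psi x).2)‖ := le_max_right _ _
        have : zR ≤ m := by positivity
        show (2:ℝ) ≤ _
        nlinarith
      unfold fa
      rw [this]; simp
  exact Cb.of c hs (.id ℝ WW)

theorem Ga_near {e q z : E3} (he : ‖e‖^2 = 1) (hq : ‖q‖^2 = 1 - Δ^2) (m : ℕ) (i : Fin 3) : Ga Δ m i =ᶠ[𝓝 (e,q,z)] fun x => fa Δ m i (Psi x) := by
  filter_upwards [chi_near (z := z) he hq] with x hx
  simp [Ga, hx]
theorem Gb_near {e q z : E3} (he : ‖e‖^2 = 1) (hq : ‖q‖^2 = 1 - Δ^2) (i : Fin 3) : Gb i =ᶠ[𝓝 (e,q,z)] fun x => (Psi x).1 i := by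
  filter_upwards [chi_near (z := z) he hq] with x hx
  rw [Gb, hx, one_mul]; rfl

def pf (i : Fin 3) : E3 × E3 →L[ℝ] ℝ := (pr i).comp (.fst ℝ E3 E3)

theorem Psi_c (i : Fin 3) (x v : WW) : fderiv ℝ (fun x => (Psi x).1 i) x v = (crs v.1 x.2.1 + crs x.1 v.2.1) i := by
  have : HasFDerivAt (fun x => pf i (Psi x)) ((pf i).comp (fderiv ℝ Psi x)) x := (pf i).hasFDerivAt.comp x ((Psi_cd.differentiable nrm0) x).hasFDerivAt
  have h2 : fderiv ℝ (fun x => (Psi x).1 i) x = (pf i).comp (fderiv ℝ Psi x) := this.fderiv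
  rw [h2, ContinuousLinearMap.comp_apply, Psi_fd]; rfl

theorem Gb_fd {e q z : E3} (he : ‖e‖^2 = 1) (hq : ‖q‖^2 = 1 - Δ^2) (i : Fin 3) (v : WW) : fderiv ℝ (Gb i) (e,q,z) v = (crs v.1 q + crs e v.2.1) i := by
  rw [(Gb_near he hq i).fderiv_eq, Psi_c]

/-- cone integrand -/
def uc (Δ : ℝ) (i j : Fin 3) (t : ℝ) : ℝ := crs (eF (f0 Δ) t) (qF (f0 Δ) t) i * (crs (qF (f0 Δ) t) (qF (f0 Δ) t) + crs (eF (f0 Δ) t) ((f0 Δ).1 - eF (f0 Δ) t)) j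

theorem uc_cont (i j : Fin 3) : Continuous (uc Δ i j) := by
  have h : ∀ (i : Fin 3) {a b : ℝ → E3}, Continuous a → Continuous b → Continuous fun t => crs (a t) (b t) i := fun i a b ha hb =>
    (pr i).continuous.comp ((crsL.continuous.comp ha).clm_apply hb)
  have h1 : Continuous (eF (f0 Δ)) := by unfold eF; fun_prop
  have h2 : Continuous (qF (f0 Δ)) := by unfold qF; fun_prop
  unfold uc
  exact (h i h1 h2).mul ((h j h2 h2).add (h j h1 fp))

theorem f0_n (h1 : Δ^2 < 1) (t : ℝ) : ‖eF (f0 Δ) t‖^2 = 1 ∧ ‖qF (f0 Δ) t‖^2 = 1-Δ^2 ∧ crs (eF (f0 Δ) t) (qF (f0 Δ) t) 2 = 1-Δ^2 ∧ uc Δ 0 1 t - uc Δ 1 0 t = Δ^2*dD := by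
  have hs : √dD^2 = 1-Δ^2 := Real.sq_sqrt la
  have sc := Real.sin_sq_add_cos_sq t
  set c := √dD with hc
  set C := cos t with hC
  set S := sin t with hS
  have e0 : (eF (f0 Δ) t) 0 = c * C := by simp [eF, f0, ← hc, ← hC, ← hS]; ring
  have e1 : (eF (f0 Δ) t) 1 = c * S := by simp [eF, f0, ← hc, ← hC, ← hS]; ring
  have e2 : (eF (f0 Δ) t) 2 = Δ := by simp [eF, f0]
  have q0 : (qF (f0 Δ) t) 0 = - (c * S) := by simp [qF, f0, ← hc, ← hC, ← hS]; ring
  have q1 : (qF (f0 Δ) t) 1 = c * C := by simp [qF, f0, ← hc, ← hC, ← hS]; ring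
  have q2 : (qF (f0 Δ) t) 2 = 0 := by simp [qF, f0]
  have a0 : (f0 Δ).1 0 = 0 := by simp [f0]
  have a1 : (f0 Δ).1 1 = 0 := by simp [f0]
  have a2 : (f0 Δ).1 2 = Δ := by simp [f0]
  refine ⟨?_, ?_, ?_, ?_⟩
  · rw [nsq3, Fin.sum_univ_three, e0, e1, e2]; linear_combination c^2 * sc + hs
  · rw [nsq3, Fin.sum_univ_three, q0, q1, q2]; linear_combination c^2 * sc + hs
  · simp [crs, e0, e1, e2, q0, q1, q2]; linear_combination c^2 * sc + hs
  · simp [uc, crs_self]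
    simp [crs, e0, e1, e2, q0, q1, q2, a0, a1, a2]
    linear_combination Δ^2 * c^2 * sc + Δ^2 * hs

def Nt (e q qr k : Fe) (p : Q2) : E3 := crs T3.1 (q p) + crs (e p) T3.2.1
/-- bump factor -/
def bf (Δ : ℝ) (e q z : Fe) (m : ℕ) (p : Q2) : ℝ := bmp (m1R • (crs (e p) (q p) 2 - dD, z p))

theorem NL.deg (h : NL Δ y e q z er qr k) (m : ℕ) (i j : Fin 3) :
    ∫ p, p.1^3 * (bf Δ e q z m p * cN) ∂nu = ∫ p : Q2, p.1^3 * uc Δ i j p.2 ∂nu := by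
  obtain ⟨K, hK⟩ := Gb_lip j
  obtain ⟨M, M0, hM⟩ := H_lip (Ga_cb (Δ := Δ) m i) (Gb_cb j) hK (f0 Δ)
  obtain ⟨i1, c1⟩ := h.toLim.cons h.p1 (Ga_cb m i) (Gb_cb j) ((fa_cd m i).differentiable one_ne_zero) (f2 := fun x => x.1 j) (pf j).differentiable
    (fun e q z he hq => Ga_near he hq m i) (fun e q z he hq => Gb_near he hq j)
  have t := (h.tr (uc_cont i j) i1 c1 M0 (.of_forall fun p => by
    refine le_trans (le_of_eq ?_) (hM X3 T3 p.2)
    congr 2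
    obtain ⟨a1, a2, a3, -⟩ := f0_n h.p1 p.2
    unfold XF TF
    rw [(Ga_near a1 a2 m i).self_of_nhds, Gb_fd a1 a2]
    simp only [fa, Psi, a3, uc, sub_self]
    rw [show (m1R • (zR, (0:E3))) = 0 by simp, bmp.one_of_mem_closedBall (by simp [bmp]), mul_one])).2
  rw [← t]
  refine integral_congr_ae ?_
  filter_upwards [h.ce, h.cq] with p h1 h2
  rw [(Ga_near h1 h2 m i).self_of_nhds, Gb_fd h1 h2]
  simp only [fa, Psi, bf, Nt]; ring

theorem Nt_int (h : Lm) (i j : Fin 3) : Integrable (fun p => p.1^3 * cN) nu ∧ AEStronglyMeasurable (fun p => (crs (e p) (q p) 2, z p)) nu := by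
  obtain ⟨m, M, _, hM⟩ := ((Gb_cb i).hf h).m0
  have w := (((Gb_cb j).hf h).wt.m.integrable nrm0).bdd_mul (c := M) m hM
  constructor
  · have := w.bdd_mul (c := 1) (f := fun p : Q2 => p.1) (Measurable.aestronglyMeasurable fp) ((ae_restrict_iff' oM).2 (.of_forall fun p hp => by
      rw [rnn hp.1.1.le]; exact hp.1.2.le))
    refine this.congr ?_
    filter_upwards [h.ce, h.cq] with p h1 h2
    rw [Gb_fd h1 h2, (Gb_near h1 h2 i).self_of_nhds, smul_eq_mul]
    simp only [Psi, Nt]; ring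
  · have z1 : AEStronglyMeasurable z nu := h.mX.snd.snd
    have e1 : AEStronglyMeasurable (fun p => (e p, q p)) nu := h.mX.fst.prodMk h.mX.snd.fst
    exact ((Nc_cd 2).continuous.comp_aestronglyMeasurable e1).prodMk z1
end

section
variable {Δ : ℝ} {y : ℕ → YY} {e q z er qr k : Fe}

open Classical in
def ind (Δ : ℝ) (e q z : Fe) (p : Q2) : ℝ := if (crs (e p) (q p) 2 - dD, z p) = (0 : ℝ × E3) then 1 else 0

theorem bmp_lim (v : ℝ × E3) (hv : v ≠ 0) : ∀ᶠ m : ℕ in atTop, bmp (m1R • v) = 0 := by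
  obtain ⟨n, hn⟩ := exists_nat_gt (2/‖v‖)
  have hv' : 0 < ‖v‖ := norm_pos_iff.2 hv
  filter_upwards [eventually_ge_atTop n] with m hm
  refine bmp.zero_of_le_dist ?_
  rw [dist_zero_right, norm_smul, rnn pv]
  rw [div_lt_iff₀ hv'] at hn
  have : (n:ℝ) ≤ m := by exact_mod_cast hm
  show (2:ℝ) ≤ _
  nlinarith

theorem NL.degl (h : NL Δ y e q z er qr k) (i j : Fin 3) :
    Integrable (fun p => p.1^3 * (ind Δ e q z p * cN)) nu ∧
    ∫ p, p.1^3 * (ind Δ e q z p * cN) ∂nu = ∫ p : Q2, p.1^3 * uc Δ i j p.2 ∂nu := by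
  obtain ⟨i1, m1⟩ := Nt_int h.toLim i j
  have fm : ∀ m, AEStronglyMeasurable (fun p => p.1^3 * (bf Δ e q z m p * cN)) nu := fun m => by
    have hc : Continuous (fun x : ℝ × E3 => bmp (m1R • (x.1 - dD, x.2))) := bmp.continuous.comp fp
    refine ((hc.comp_aestronglyMeasurable m1).mul i1.1).congr (.of_forall fun p => ?_)
    simp only [Pi.mul_apply, bf]; ring
  have bd : ∀ m, ∀ᵐ p ∂nu, ‖p.1^3 * (bf Δ e q z m p * cN)‖ ≤ ‖p.1^3 * cN‖ := fun m => .of_forall fun p => by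
    have b1 : ‖bf Δ e q z m p‖ ≤ 1 := by
      unfold bf; rw [rnn bmp.nonneg]; exact bmp.le_one
    rw [mul_left_comm, norm_mul]
    exact mul_le_of_le_one_left no b1
  have lm : ∀ᵐ p ∂nu, Tendsto (fun m => p.1^3 * (bf Δ e q z m p * cN)) atTop (𝓝 (p.1^3 * (ind Δ e q z p * cN))) := .of_forall fun p => by
    refine tendsto_const_nhds.mul (Tendsto.mul_const _ ?_)
    refine tendsto_nhds_of_eventually_eq ?_
    unfold ind bf
    by_cases hv : (crs (e p) (q p) 2 - dD, z p) = (0 : ℝ × E3)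
    · rw [if_pos hv, hv]
      exact .of_forall fun m => by rw [smul_zero, bmp.one_of_mem_closedBall (by simp [bmp])]
    · rw [if_neg hv]; exact bmp_lim _ hv
  have T := tendsto_integral_of_dominated_convergence _ fm i1.norm bd lm
  have m0 := aestronglyMeasurable_of_tendsto_ae atTop fm lm
  refine ⟨i1.norm.mono' m0 ?_, ?_⟩
  · filter_upwards [lm, ae_all_iff.2 bd] with p hp hb
    exact le_of_tendsto hp.norm (.of_forall hb)
  · simp only [h.deg] at T
    exact (tendsto_nhds_unique T tendsto_const_nhds)

def L1c (i : Fin 3) : WW →L[ℝ] ℝ := (pr i).comp L2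
def L2c (i : Fin 3) : WW →L[ℝ] ℝ := (pr i).comp L3

theorem NL.pt (h : NL Δ y e q z er qr k) : ∀ᵐ p ∂nu,
    ind Δ e q z p * (crs (e p) (q p) 0 * Nt e q qr k p 1 - crs (e p) (q p) 1 * Nt e q qr k p 0) ≤ Δ^2*dD ∧
    (ind Δ e q z p * (crs (e p) (q p) 0 * Nt e q qr k p 1 - crs (e p) (q p) 1 * Nt e q qr k p 0) = Δ^2*dD → z p = 0 ∧ er p = 0 ∧ qr p = 0) := by
  have p1 := h.p1
  have p0 := h.p0
  have cp : 0 < Δ^2*dD := mul_pos pv la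
  have lz := ae_all_iff.2 fun i : Fin 3 => h.toLim.lev (g := fun x => L2c i x) (L2c i).contDiff
  have lq := h.toLim.lev (g := fun x => L1c 2 x) (L1c 2).contDiff
  have ln := h.toLim.lev (g := fun x => (Psi x).1 2 - dD) (((pf 2).contDiff.comp (Psi_cd.of_le nrm0)).sub contDiff_const)
  filter_upwards [lz, lq, ln, h.toLim.alg p1, h.toLim.orth, h.ce, h.cq, h.ceq] with p lz lq ln ha ho he hq heq
  by_cases hv : (crs (e p) (q p) 2 - dD, z p) = (0 : ℝ × E3)
  swap
  · simp only [ind, if_neg hv, zero_mul]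
    exact ⟨cp.le, fun h => absurd h cp.ne⟩
  obtain ⟨v1, v2⟩ := Prod.mk_eq_zero.1 hv
  obtain ⟨a, b, ν, h1, h2, h3, h4⟩ := ha
  have r0 : 0 < p.1 := ho.1
  obtain ⟨n1, n2, n3, n4, n5⟩ := crs_n he hq heq
  have qz : qr p = 0 := by
    ext i
    have := (lz i (by simp [L2c, L3, v2])).2
    rw [ContinuousLinearMap.fderiv] at this
    have h' : -(p.1^2 * qr p i) = 0 := this
    have : qr p i = 0 := by
      rcases mul_eq_zero.1 (neg_eq_zero.1 h') with h | h
      · exact absurd h pv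
      · exact h
    simpa using this
  have N0 : crs (e p) (q p) ≠ 0 := fun h0 => by rw [h0] at n1; simp at n1; linarith
  have b0 : b = 0 := by
    rw [qz] at h3; exact (smul_eq_zero.1 h3.symm).resolve_right N0
  have Ne : Nt e q qr k p = -(ν • q p) := by
    unfold Nt
    simp only [Xt0, h4, qz, smul_zero, add_zero, crs_self, zero_add]
    rw [← crsL_apply, map_add, map_smul, map_smul, crsL_apply, crsL_apply, crs_self, n5]; simp
  have nq : ν * q p 2 = 0 := by
    have := (ln v1).2
    rw [fderiv_sub_const, Psi_c] at this
    have h' : Nt e q qr k p 2 = 0 := this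
    rw [Ne] at h'; simpa using h'
  have W : crs (e p) (q p) 0 * Nt e q qr k p 1 - crs (e p) (q p) 1 * Nt e q qr k p 0 = ν * (dD * e p 2) := by
    have := congrArg (fun v : E3 => v 2) n4
    simp only [PiLp.smul_apply, smul_eq_mul] at this
    have h' : crs (e p) (q p) 0 * q p 1 - crs (e p) (q p) 1 * q p 0 = -dD * e p 2 := this
    rw [Ne]; simp only [PiLp.neg_apply, PiLp.smul_apply, smul_eq_mul]
    linear_combination (-ν) * h'
  simp only [ind, if_pos hv, one_mul, W]
  by_cases hn : ν = 0
  · rw [hn, zero_mul]; exact ⟨cp.le, fun h => absurd h cp.ne⟩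
  have q2 : q p 2 = 0 := (mul_eq_zero.1 nq).resolve_left hn
  have ve : ν = e p 2 := by
    have := (lq (by show q p 2 = 0; exact q2)).2
    rw [ContinuousLinearMap.fderiv] at this
    have h' : (p.1 • k p - e p) 2 = 0 := this
    rw [h4] at h'
    simp only [PiLp.add_apply, PiLp.smul_apply, smul_eq_mul] at h'
    have : dD * (ν - e p 2) = 0 := by linear_combination h' - ν * v1
    have := (mul_eq_zero.1 this).resolve_left la
    linarith
  have e2 : e p 2^2 = Δ^2 := by
    have := congrArg (fun v : E3 => v 2) n4
    simp only [PiLp.smul_apply, smul_eq_mul] at this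
    have h' : crs (e p) (q p) 0 * q p 1 - crs (e p) (q p) 1 * q p 0 = -dD * e p 2 := this
    rw [nsq3, Fin.sum_univ_three] at n1 hq
    rw [inn3, Fin.sum_univ_three, q2] at n3
    rw [q2] at hq
    set x := crs (e p) (q p) 0
    set w := crs (e p) (q p) 1
    have v1' : crs (e p) (q p) 2 = 1-Δ^2 := by linarith
    rw [v1'] at n1
    have : dD^2 * (e p 2^2 - Δ^2) = 0 := by
      have e1 : (x*q p 1 - w*q p 0)^2 = (dD * e p 2)^2 := by rw [h']; ring
      have e3 : (x*q p 0 + w*q p 1) = 0 := by linarith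
      have e4 : (x*q p 1 - w*q p 0)^2 + (x*q p 0 + w*q p 1)^2 = (x^2+w^2)*(q p 0^2+q p 1^2) := by ring
      have e5 : x^2+w^2 = dD - dD^2 := by linarith
      have e6 : q p 0^2 + q p 1^2 = 1-Δ^2 := by linarith
      rw [e1, e3, e5, e6] at e4
      linear_combination e4
    have := (mul_eq_zero.1 this).resolve_left (by have : 0 < 1-Δ^2 := by linarith
                                                  positivity)
    linarith
  have Wv : ν * (dD * e p 2) = Δ^2*dD := by rw [ve]; linear_combination dD * e2
  refine ⟨Wv.le, fun _ => ⟨v2, ?_, qz⟩⟩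
  rw [b0] at h1
  have : a = 0 := (mul_eq_zero.1 (show a * ν = 0 by rw [h1]; ring)).resolve_right hn
  rw [h2, this, zero_smul]

theorem NL.flat (h : NL Δ y e q z er qr k) : ∀ᵐ p ∂nu, z p = 0 ∧ er p = 0 ∧ qr p = 0 := by
  obtain ⟨i1, e1⟩ := h.degl 0 1
  obtain ⟨i2, e2⟩ := h.degl 1 0
  have ic : Integrable (fun p : Q2 => p.1^3 * (Δ^2*dD)) nu := cont_Om fp 0 1
  have j1 : Integrable (fun p : Q2 => p.1^3 * uc Δ 0 1 p.2) nu := cont_Om ((continuous_fst.pow 3).mul ((uc_cont 0 1).comp continuous_snd)) 0 1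
  have j2 : Integrable (fun p : Q2 => p.1^3 * uc Δ 1 0 p.2) nu := cont_Om ((continuous_fst.pow 3).mul ((uc_cont 1 0).comp continuous_snd)) 0 1
  let W : Fs := fun p => ind Δ e q z p * (crs (e p) (q p) 0 * Nt e q qr k p 1 - crs (e p) (q p) 1 * Nt e q qr k p 0)
  have iW : Integrable (fun p => p.1^3 * W p) nu := (i1.sub' i2).congr (.of_forall fun p => by simp only [W]; ring)
  have eW : ∫ p, p.1^3 * W p ∂nu = ∫ p : Q2, p.1^3 * (Δ^2*dD) ∂nu := by
    have a1 := integral_sub i1 i2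
    rw [e1, e2, ← integral_sub j1 j2] at a1
    refine Eq.trans ?_ (a1.trans ?_)
    · congr 1; ext p; simp only [W]; ring
    · congr 1; ext p
      rw [← mul_sub, (f0_n h.p1 p.2).2.2.2]
  have pt := h.pt
  have pos : ∀ᵐ p ∂nu, 0 < p.1 := (ae_restrict_iff' oM).2 (.of_forall fun p hp => hp.1.1)
  have z0 : ∫ p, (p.1^3 * (Δ^2*dD) - p.1^3 * W p) ∂nu = 0 := by rw [integral_sub ic iW, eW, sub_self]
  have nn : 0 ≤ᵐ[nu] fun p => (p.1^3 * (Δ^2*dD) - p.1^3 * W p) := by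
    filter_upwards [pt, pos] with p hp hp0
    have := mln hp.1 (pow_pos hp0 3).le
    simp only [Pi.zero_apply, W]; linarith
  have := (integral_eq_zero_iff_of_nonneg_ae nn (ic.sub' iW)).1 z0
  filter_upwards [this, pt, pos] with p hp h2 hp0
  refine h2.2 ?_
  simp only [Pi.zero_apply] at hp
  rw [← mul_sub] at hp
  have := (mul_eq_zero.1 hp).resolve_left (pow_pos hp0 3).ne'
  simp only [W] at this
  linarith
end

section
variable {Δ : ℝ} {y : ℕ → YY} {e q z er qr k : Fe}

theorem NL.lin (h : NL Δ y e q z er qr k) (L : E3 × E3 →L[ℝ] ℝ) {g g' : ℝ → ℝ} (hg : ∀ t, HasDerivAt g (g' t) t) (hg' : Continuous g') (hp : g π = g (-π)) {B : ℝ} (hB : ∀ t, |g t| ≤ B) :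
    Integrable (fun p => p.1^3 * (L (e p, q p) * g p.2)) nu ∧ ∫ p, p.1^3 * (L (e p, q p) * g p.2) ∂nu = ∫ p : Q2, p.1^3 * (L (eF (f0 Δ) p.2, qF (f0 Δ) p.2) * g p.2) ∂nu := by
  have cg : Continuous g := continuous_iff_continuousAt.2 fun t => (hg t).continuousAt
  have B0 : 0 ≤ B := (abs_nonneg _).trans (hB 0)
  have H := (cut_cb (g := fun x => L x) L.contDiff).hf h.toLim
  have cv : ∀ᵐ p ∂nu, chi (pL X3) * L (pL X3) = L (e p, q p) ∧ fderiv ℝ (fun x => chi (pL x) * L (pL x)) X3 R3 = 0 := by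
    filter_upwards [h.ce, h.cq, h.flat] with p h1 h2 h3
    obtain ⟨a1, a2⟩ := cut_val (g := fun x => L x) (z := z p) h1 h2
    refine ⟨a1, ?_⟩
    rw [a2, show (fun x => L (pL x)) = (L.comp pL) from rfl, ContinuousLinearMap.fderiv]
    simp only [Xr0, h3.2.1, h3.2.2, ContinuousLinearMap.comp_apply, pL_apply]
    exact L.map_zero
  refine h.tr (u := fun p => L (e p, q p) * g p.2) (u0 := fun t => L (eF (f0 Δ) t, qF (f0 Δ) t) * g t) ?_ ?_ (fun σ s0 s1 => ?_) (M := ‖L‖ * B) pv (.of_forall fun p => ?_)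
  · have h1 : Continuous (eF (f0 Δ)) := by unfold eF; fun_prop
    have h2 : Continuous (qF (f0 Δ)) := by unfold qF; fun_prop
    fun_prop
  · obtain ⟨m, M, _, hM⟩ := H.m0
    have i1 : Integrable (fun p : Q2 => p.1^2 * g p.2) nu := cont_Om fp 0 1
    refine (i1.bdd_mul (c := M) m hM).congr ?_
    filter_upwards [cv] with p hp
    simp only [hp.1]; ring
  · have t := Ef_ts s0 s1 hg hg' hp
    have Q := H.IBP_r t
    have z1 : ∫ p : Q2, (p.1^2 * (Ef σ p.1 * g p.2)) * (p.1^2 * fderiv ℝ (fun x => chi (pL x) * L (pL x)) X3 R3) ∂nu = 0 := by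
      rw [integral_eq_zero_of_ae]
      filter_upwards [cv] with p hp
      rw [hp.2]; simp
    rw [z1, add_zero] at Q
    rw [← Q]
    refine integral_congr_ae ?_
    filter_upwards [cv, ae_restrict_mem (Om_meas 0 1)] with p hp hp'
    have r0 : 0 < p.1 := hp'.1.1
    have E := Ef_deriv (σ := σ) r0
    have E' : deriv (Pf σ) p.1 - 4*p.1^3 = p.1^2 * (4*p.1*Ef σ p.1 + p.1^2 * deriv (Ef σ) p.1) := by rw [E]; field_simp
    rw [hp.1, E']; ring
  · have a1 : L (e p, q p) * g p.2 - L (eF (f0 Δ) p.2, qF (f0 Δ) p.2) * g p.2 = L (pL (X3 - XF (f0 Δ) p.2)) * g p.2 := by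
      rw [← sub_mul, ← map_sub]; rfl
    rw [a1, abs_mul]
    have a2 : ‖pL (X3 - XF (f0 Δ) p.2)‖ ≤ ‖X3 - XF (f0 Δ) p.2‖ := by
      rw [pL_apply]
      exact max_le (le_max_left _ _) ((le_max_left _ _).trans (le_max_right _ _))
    have a3 : |L (pL (X3 - XF (f0 Δ) p.2))| ≤ ‖L‖ * ‖X3 - XF (f0 Δ) p.2‖ := (L.le_opNorm _).trans (by gcongr)
    have a4 := mul_le_mul a3 (hB p.2) (abs_nonneg _) pv
    have a5 := mul_nonneg (mul_nonneg (norm_nonneg L) B0) (norm_nonneg (Xt0 e q qr k p - TF (f0 Δ) p.2))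
    linarith

theorem eF_d (f : WW) (i : Fin 3) (t : ℝ) : HasDerivAt (fun t => eF f t i) (qF f t i) t ∧ HasDerivAt (fun t => qF f t i) ((f.1 - eF f t) i) t := by
  simp only [eF, qF, PiLp.add_apply, PiLp.sub_apply, PiLp.smul_apply, smul_eq_mul]
  constructor
  · exact ((((Real.hasDerivAt_cos t).mul_const (f.2.1 i)).const_add (f.1 i)).fun_add ((Real.hasDerivAt_sin t).mul_const (f.2.2 i))).congr_deriv (by ring)
  · exact (((Real.hasDerivAt_cos t).mul_const (f.2.2 i)).fun_sub ((Real.hasDerivAt_sin t).mul_const (f.2.1 i))).congr_deriv (by ring)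

theorem eF_b (f : WW) (i : Fin 3) (t : ℝ) : |eF f t i| ≤ √(8*n2 f) ∧ |qF f t i| ≤ √(8*n2 f) := by
  have := (XF_n2 f t).1
  simp only [n2, XF, norm_zero] at this
  have a := nsq3 (eF f t)
  have b := nsq3 (qF f t)
  have c : ∀ v : E3, (v i)^2 ≤ ∑ i, v i^2 := fun v => Finset.single_le_sum (f := fun i => v i^2) (fun i _ => sq_nonneg _) (Finset.mem_univ i)
  have c1 := c (eF f t)
  have c2 := c (qF f t)
  constructor <;> refine Real.le_sqrt_of_sq_le ?_ <;> rw [sq_abs] <;> simp only [n2] <;> nlinarith [sq_nonneg ‖eF f t‖, sq_nonneg ‖qF f t‖]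

theorem NL.rig (h : NL Δ y e q z er qr k) : ∀ᵐ p ∂nu, e p = eF (f0 Δ) p.2 ∧ q p = qF (f0 Δ) p.2 := by
  let f := f0 Δ
  have ce : Continuous (eF f) := by unfold eF; fun_prop
  have cq : Continuous (qF f) := by unfold qF; fun_prop
  have A := fun i : Fin 3 => h.lin ((pr i).comp (.fst ℝ E3 E3)) (g := fun t => eF f t i) (fun t => (eF_d f i t).1) fp (by simp [eF]) (fun t => (eF_b f i t).1)
  have B := fun i : Fin 3 => h.lin ((pr i).comp (.snd ℝ E3 E3)) (g := fun t => qF f t i) (fun t => (eF_d f i t).2) fp (by simp [qF]) (fun t => (eF_b f i t).2)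
  let S : Fs := fun p => p.1^3 * (2*(inner ℝ (e p) (eF f p.2) + inner ℝ (q p) (qF f p.2)))
  let S0 : Fs := fun p => p.1^3 * (2*(inner ℝ (eF f p.2) (eF f p.2) + inner ℝ (qF f p.2) (qF f p.2)))
  let T : Fs := fun p => 2 * ∑ i : Fin 3, (p.1^3 * (((pr i).comp (.fst ℝ E3 E3)) (e p, q p) * eF f p.2 i) + p.1^3 * (((pr i).comp (.snd ℝ E3 E3)) (e p, q p) * qF f p.2 i))
  let T0 : Fs := fun p => 2 * ∑ i : Fin 3, (p.1^3 * (((pr i).comp (.fst ℝ E3 E3)) (eF f p.2, qF f p.2) * eF f p.2 i) + p.1^3 * (((pr i).comp (.snd ℝ E3 E3)) (eF f p.2, qF f p.2) * qF f p.2 i))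
  have ST : S = T := by
    ext p; simp only [S, T, inn3, Fin.sum_univ_three, ContinuousLinearMap.comp_apply, ContinuousLinearMap.coe_fst', ContinuousLinearMap.coe_snd', pr]; simp; ring
  have ST0 : S0 = T0 := by
    ext p; simp only [S0, T0, inn3, Fin.sum_univ_three, ContinuousLinearMap.comp_apply, ContinuousLinearMap.coe_fst', ContinuousLinearMap.coe_snd', pr]; simp; ring
  have iS : Integrable S nu := by
    rw [ST]; exact (integrable_finsetSum _ fun i _ => (A i).1.add (B i).1).const_mul 2
  have c1 : ∀ i : Fin 3, Integrable (fun p : Q2 => p.1^3 * (((pr i).comp (.fst ℝ E3 E3)) (eF f p.2, qF f p.2) * eF f p.2 i)) nu := fun i => cont_Om fp 0 1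
  have c2 : ∀ i : Fin 3, Integrable (fun p : Q2 => p.1^3 * (((pr i).comp (.snd ℝ E3 E3)) (eF f p.2, qF f p.2) * qF f p.2 i)) nu := fun i => cont_Om fp 0 1
  have iS0 : Integrable S0 nu := by
    rw [ST0]; exact (integrable_finsetSum _ fun i _ => (c1 i).add (c2 i)).const_mul 2
  have eS : ∫ p, S p ∂nu = ∫ p, S0 p ∂nu := by
    rw [ST, ST0]; simp only [T, T0]
    rw [integral_const_mul, integral_const_mul, integral_finsetSum _ fun i _ => (A i).1.fun_add (B i).1, integral_finsetSum _ fun i _ => (c1 i).fun_add (c2 i)]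
    congr 1
    refine Finset.sum_congr rfl fun i _ => ?_
    rw [integral_add (A i).1 (B i).1, integral_add (c1 i) (c2 i), (A i).2, (B i).2]
  have pt : ∀ᵐ p ∂nu, S0 p - S p = p.1^3 * (‖e p - eF f p.2‖^2 + ‖q p - qF f p.2‖^2) := by
    filter_upwards [h.ce, h.cq] with p h1 h2
    obtain ⟨a1, a2, -, -⟩ := f0_n h.p1 p.2
    simp only [S0, S]
    rw [norm_sub_sq_real, norm_sub_sq_real, h1, h2, ris, ris, a1, a2]
    ring
  have z0 : ∫ p, (S0 p - S p) ∂nu = 0 := by rw [integral_sub iS0 iS, eS, sub_self]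
  have pos : ∀ᵐ p ∂nu, 0 < p.1 := (ae_restrict_iff' oM).2 (.of_forall fun p hp => hp.1.1)
  have nn : 0 ≤ᵐ[nu] fun p => S0 p - S p := by
    filter_upwards [pt, pos] with p hp hp0
    rw [hp, Pi.zero_apply]; positivity
  have := (integral_eq_zero_iff_of_nonneg_ae nn (iS0.sub' iS)).1 z0
  filter_upwards [this, pt, pos] with p hp h2 hp0
  rw [h2, Pi.zero_apply] at hp
  have h3 := (mul_eq_zero.1 hp).resolve_left (pow_pos hp0 3).ne'
  have a := sq_nonneg ‖e p - eF f p.2‖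
  have b := sq_nonneg ‖q p - qF f p.2‖
  constructor
  · have : ‖e p - eF f p.2‖^2 = 0 := by linarith
    exact sub_eq_zero.1 (norm_eq_zero.1 (pow_eq_zero_iff two_ne_zero |>.1 this))
  · have : ‖q p - qF f p.2‖^2 = 0 := by linarith
    exact sub_eq_zero.1 (norm_eq_zero.1 (pow_eq_zero_iff two_ne_zero |>.1 this))

theorem Lim.fin (h : Lm) (p0 : 0 < Δ) (p1 : Δ^2 < 1) {C : ℝ} {t : ℕ → ℝ} (ht : Tendsto t atTop (𝓝 0)) (hB : ∀ n, Bd Δ C (t n) (y n)) :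
    ∃ R : E3 ≃ₗᵢ[ℝ] E3, ∀ᵐ p ∂nu, R (e p) = e0 Δ p.2 ∧ R (q p) = q0 Δ p.2 ∧ z p = 0 := by
  obtain ⟨R, hR⟩ := h.nl p0 p1 ht hB
  refine ⟨R, ?_⟩
  filter_upwards [hR.rig, hR.flat] with p h1 h2
  refine ⟨h1.1.trans (f0_eF p.2).1, h1.2.trans (f0_eF p.2).2, ?_⟩
  exact (R.map_eq_zero_iff).1 h2.1
end

/-- weighted distance of the frame of `y` (rotated by `R`) to the frame of the cone -/
def SR (Δ : ℝ) (y : YY) (R : E3 ≃ₗᵢ[ℝ] E3) : ℝ :=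
  ∫ p, p.1^6 * RS ∂nu

theorem e0_cont (Δ : ℝ) : Continuous (e0 Δ) := continuous_iff_continuousAt.2 fun t => (e0_deriv Δ t).continuousAt
theorem q0_cont (Δ : ℝ) : Continuous (q0 Δ) := by
  unfold q0
  refine (PiLp.continuous_toLp 2 _).comp (continuous_pi fun i => ?_)
  fin_cases i <;> simp <;> fun_prop

theorem SR_cont {y : YY} (hy : CDy) (Δ : ℝ) (R : E3 ≃ₗᵢ[ℝ] E3) :
    Continuous fun p : Q2 => p.1^6 * RS := by
  obtain ⟨h1,h2,h3,h4,h5,h6⟩ := cont_fields hy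
  have h7 := (z_pc1 hy).c
  have a1 := e0_cont Δ
  have a2 := q0_cont Δ
  have a3 := R.continuous
  fun_prop

theorem SR_nonneg (Δ : ℝ) (y : YY) (R : E3 ≃ₗᵢ[ℝ] E3) : 0 ≤ SR Δ y R :=
  integral_nonneg fun p => by
    have : 0 ≤ p.1^6 := by positivity
    positivity

theorem G2_nonneg (Δ : ℝ) (y : YY) (p : Q2) : 0 ≤ G2 Δ y p := by
  unfold G2; positivity

theorem SR_sub {Δ C : ℝ} (p0 : 0 < Δ) (p1 : Δ^2 < 1) {h : ℕ → ℝ} {y : ℕ → YY} (ht : Tendsto h atTop (𝓝 0)) (hy : ∀ n, ContDiff ℝ 2 (y n)) (hB : ∀ n, Bd Δ C (h n) (y n)) :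
    ∃ φ : ℕ → ℕ, ∃ R : E3 ≃ₗᵢ[ℝ] E3, Tendsto φ atTop atTop ∧ Tendsto (fun n => SR Δ (y (φ n)) R) atTop (𝓝 0) := by
  obtain ⟨φ, hφ, e, q, z, er, qr, k, L, T⟩ := lim_ex ht hy hB
  obtain ⟨R, hR⟩ := L.fin p0 p1 (ht.comp hφ.tendsto_atTop) (fun n => hB (φ n))
  refine ⟨φ, R, hφ.tendsto_atTop, squeeze_zero (fun n => SR_nonneg _ _ _) (fun n => ?_) T⟩
  have cS := SR_cont (hy (φ n)) Δ R
  have cG := G2_cont (hy (φ n)) Δ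
  have i1 : Integrable (fun p : Q2 => p.1^6 * (‖R (ef (y (φ n)) p) - e0 Δ p.2‖^2 + ‖R (qf (y (φ n)) p) - q0 Δ p.2‖^2 + ‖zf (y (φ n)) p‖^2)) nu := cont_Om cS 0 1
  have i2 : Integrable (fun p : Q2 => p.1 * G2 Δ (y (φ n)) p) nu := cont_Om fp 0 1
  have eq : ∫ p, (((‖p.1^3 • (ef (y (φ n)) p - e p)‖^2 + ‖p.1^3 • (qf (y (φ n)) p - q p)‖^2) + ‖p.1^3 • (zf (y (φ n)) p - z p)‖^2) + p.1 * G2 Δ (y (φ n)) p) ∂nu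
      = ∫ p, (p.1^6 * (‖R (ef (y (φ n)) p) - e0 Δ p.2‖^2 + ‖R (qf (y (φ n)) p) - q0 Δ p.2‖^2 + ‖zf (y (φ n)) p‖^2) + p.1 * G2 Δ (y (φ n)) p) ∂nu := by
    refine integral_congr_ae ?_
    filter_upwards [hR] with p hp
    obtain ⟨a, b, c⟩ := hp
    rw [← a, ← b, c, ← map_sub, ← map_sub, R.norm_map, R.norm_map, norm_smul, norm_smul, norm_smul, sub_zero, mul_pow, mul_pow, mul_pow, Real.norm_eq_abs, sq_abs]
    ring
  rw [eq, integral_add i1 i2, SR]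
  have : 0 ≤ ∫ p, p.1 * G2 Δ (y (φ n)) p ∂nu := by
    refine setIntegral_nonneg oM fun p hp => mul_nonneg hp.1.1.le (G2_nonneg _ _ _)
  linarith

theorem SR_all {Δ C : ℝ} (p0 : 0 < Δ) (p1 : Δ^2 < 1) {h : ℕ → ℝ} {y : ℕ → YY} (ht : Tendsto h atTop (𝓝 0)) (hy : ∀ n, ContDiff ℝ 2 (y n)) (hB : ∀ n, Bd Δ C (h n) (y n)) :
    ∃ R : ℕ → (E3 ≃ₗᵢ[ℝ] E3), Tendsto (fun n => SR Δ (y n) (R n)) atTop (𝓝 0) := by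
  have bb : ∀ n, BddBelow (Set.range fun R => SR Δ (y n) R) := fun n => ⟨0, by rintro _ ⟨R, rfl⟩; exact SR_nonneg _ _ _⟩
  have hne : Nonempty (E3 ≃ₗᵢ[ℝ] E3) := ⟨LinearIsometryEquiv.refl ℝ E3⟩
  have ch : ∀ n : ℕ, ∃ R, SR Δ (y n) R < (⨅ R, SR Δ (y n) R) + 1/((n:ℝ)+1) := fun n =>
    exists_lt_of_ciInf_lt (lt_add_of_pos_right _ pv)
  choose R hR using ch
  refine ⟨R, tendsto_of_subseq_tendsto fun ns hns => ?_⟩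
  obtain ⟨φ, Q, hφ, T⟩ := SR_sub p0 p1 (ht.comp hns) (fun n => hy (ns n)) (fun n => hB (ns n))
  refine ⟨φ, squeeze_zero (fun n => SR_nonneg _ _ _) (fun n => ?_) (g := fun n => SR Δ (y (ns (φ n))) Q + 1/(((ns (φ n) : ℕ) : ℝ)+1)) ?_⟩
  · exact (hR _).le.trans (add_le_add_left (ciInf_le (bb _) Q) _)
  · simpa using T.add ((tendsto_one_div_add_atTop_nhds_zero_nat (𝕜 := ℝ)).comp (hns.comp hφ))

/-- consequences on annuli -/
theorem ann {Δ C h ρ : ℝ} {y : YY} (hy : CDy) (hB : Bd Δ C h y) (R : E3 ≃ₗᵢ[ℝ] E3) (r0 : 0 < ρ) (r1 : ρ < 1) :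
    ∫ x in ball (0 : E2) 1 \ ball 0 ρ, hessNormSq (Ry y R 0) x ≤ 2 * (ρ^2)⁻¹ * C ∧
    ∫ x in ball (0 : E2) 1 \ ball 0 ρ, ‖Ry y R 0 x - coneMap Δ x‖^2 ≤ 2 * (ρ^5)⁻¹ * SR Δ y R ∧
    ∫ x in ball (0 : E2) 1 \ ball 0 ρ, frob2 (Dmat (Ry y R 0) x - Dmat (coneMap Δ) x) ≤ (ρ^5)⁻¹ * SR Δ y R := by
  have hRy := Ry_cd hy R 0
  obtain ⟨h1,h2,h3,h4,h5,h6⟩ := cont_fields hy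
  have h7 := (z_pc1 hy).c
  have a1 := e0_cont Δ
  have a2 := q0_cont Δ
  have a3 := R.continuous
  have cS := SR_cont hy Δ R
  -- general comparison
  have cmp : ∀ (F G : Fs) (c : ℝ), Continuous F → Continuous G → 0 ≤ c → (∀ p ∈ Om ρ 1, F p ≤ c * G p) → (∀ p ∈ Om 0 1, 0 ≤ G p) →
      ∫ p in Om ρ 1, F p ≤ c * ∫ p in Om 0 1, G p := fun F G c hF hG hc hp hn => by
    calc ∫ p in Om ρ 1, F p ≤ ∫ p in Om ρ 1, c * G p := setIntegral_mono_on (cont_Om hF _ _) cof oM hp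
      _ = c * ∫ p in Om ρ 1, G p := integral_const_mul _ _
      _ ≤ _ := mln (setIntegral_mono_set (cont_Om hG _ _) ((ae_restrict_iff' oM).2 (.of_forall hn)) (Om_mono r0.le le_rfl).eventuallyLE) hc
  have w5 : ∀ p ∈ Om ρ 1, 0 < p.1 ∧ p.1 ≤ (ρ^5)⁻¹ * p.1^6 ∧ p.1 < 1 := fun p hp => by
    have q0 : 0 < p.1 := r0.trans hp.1.1
    refine ⟨q0, ?_, hp.1.2⟩
    rw [← div_eq_inv_mul, le_div_iff₀ pv, show p.1^6 = p.1 * p.1^5 by ring]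
    exact mln (pow_le_pow_left₀ r0.le hp.1.1.le 5) q0.le
  refine ⟨?_, ?_, ?_⟩
  · rw [hess_int_polar hRy r0.le]
    have cH := HH_cont hRy
    refine (cmp _ (fun p => p.1^3 * (‖erf y p‖^2 + ‖qrf y p‖^2 + ‖kf y p‖^2)) (2 * (ρ^2)⁻¹) fp fp pv (fun p hp => ?_) (fun p hp => ?_)).trans
      (mln hB.d3 pv)
    · have q0 : 0 < p.1 := r0.trans hp.1.1
      have w : p.1 ≤ (ρ^2)⁻¹ * p.1^3 := by
        rw [← div_eq_inv_mul, le_div_iff₀ pv, show p.1^3 = p.1 * p.1^2 by ring]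
        exact mln (pow_le_pow_left₀ r0.le hp.1.1.le 2) q0.le
      rw [Ry_HH hy, HH]
      calc p.1 * (‖erf y p‖ ^ 2 + 2 * ‖qrf y p‖ ^ 2 + ‖kf y p‖ ^ 2) ≤ ((ρ^2)⁻¹ * p.1^3) * (2 * (‖erf y p‖^2 + ‖qrf y p‖^2 + ‖kf y p‖^2)) :=
            mul_le_mul w (by nlinarith [sq_nonneg ‖erf y p‖, sq_nonneg ‖kf y p‖]) pv pv
        _ = _ := by ring
    · have := hp.1.1
      positivity
  · rw [y_int_polar _ Δ r0.le]
    have e1 : ∀ p, Yf (Ry y R 0) p - p.1 • e0 Δ p.2 = R (zf y p) + p.1 • (R (ef y p) - e0 Δ p.2) := fun p => by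
      simp only [Yf, Ry, zf, map_sub, map_smul, smul_sub, add_zero]; abel
    simp only [e1]
    refine cmp _ _ _ fp cS pv (fun p hp => ?_) (fun p hp => by have := hp.1.1; positivity)
    obtain ⟨q0, w, q1⟩ := w5 p hp
    have := sq_add_le (R (zf y p)) (p.1 • (R (ef y p) - e0 Δ p.2))
    rw [norm_smul, R.norm_map, mul_pow, Real.norm_eq_abs, sq_abs] at this
    have l : p.1^2 ≤ 1 := pow_le_one₀ q0.le q1.le
    have l2 := mul_le_mul_of_nonneg_right l (sq_nonneg ‖R (ef y p) - e0 Δ p.2‖)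
    have l3 := sq_nonneg ‖R (qf y p) - _root_.q0 Δ p.2‖
    refine (mul_le_mul w (c := ‖R (zf y p) + p.1 • (R (ef y p) - e0 Δ p.2)‖^2) (d := 2 * (‖R (ef y p) - e0 Δ p.2‖^2 + ‖R (qf y p) - _root_.q0 Δ p.2‖^2 + ‖zf y p‖^2)) la pv pv).trans (le_of_eq ?_)
    ring
  · rw [D_int_polar hRy Δ r0.le]
    simp only [Ry_e hy, Ry_q hy]
    refine cmp _ _ _ fp cS pv (fun p hp => ?_) (fun p hp => by have := hp.1.1; positivity)
    obtain ⟨q0, w, q1⟩ := w5 p hp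
    refine (mul_le_mul w (c := ‖R (ef y p) - e0 Δ p.2‖^2 + ‖R (qf y p) - _root_.q0 Δ p.2‖^2) (d := ‖R (ef y p) - e0 Δ p.2‖^2 + ‖R (qf y p) - _root_.q0 Δ p.2‖^2 + ‖zf y p‖^2) (by linarith [sq_nonneg ‖zf y p‖]) pv pv).trans (le_of_eq ?_)
    ring

theorem energy_shift {y : YY} (hy : CDy) (h Δ : ℝ) (R : E3 ≃ₗᵢ[ℝ] E3) (b : E3) : energy h Δ (Ry y R b) = energy h Δ y := by
  rw [energy_polar hy, energy_polar (Ry_cd hy R b)]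
  simp only [Ry_HH hy, Ry_G2 hy]

/-- almost-minimizers converge, up to Euclidean motions, weakly in
`W^{2,2}(B₁ ∖ B_ρ; ℝ³)` to the cone, for every `0 < ρ < 1`. -/
theorem stmt_18 (Δ : ℝ) (hΔ0 : 0 < Δ) (hΔ1 : Δ < 1) (C₂ : ℝ) (hC₂ : 0 < C₂)
    (h : ℕ → ℝ) (hpos : ∀ n, 0 < h n) (hto0 : Tendsto h atTop (𝓝 0))
    (y : ℕ → E2 → E3) (hy : ∀ n, ContDiff ℝ 2 (y n))
    (hbound : ∀ n, energy (h n) Δ (y n) ≤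
      2 * π * Δ ^ 2 * (h n) ^ 2 * (Real.log (1 / h n) + C₂)) :
    ∃ (R : ℕ → (E3 ≃ₗᵢ[ℝ] E3)) (b : ℕ → E3),
      ∀ ρ ∈ Set.Ioo (0 : ℝ) 1,
        (∃ M : ℝ, ∀ᶠ n in atTop,
          ∫ x in ball (0 : E2) 1 \ ball 0 ρ,
            hessNormSq (fun z => R n (y n z) + b n) x ≤ M) ∧
        Tendsto (fun n => ∫ x in ball (0 : E2) 1 \ ball 0 ρ,
            ‖(R n (y n x) + b n) - coneMap Δ x‖ ^ 2) atTop (𝓝 0) ∧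
        Tendsto (fun n => ∫ x in ball (0 : E2) 1 \ ball 0 ρ,
            frob2 (Dmat (fun z => R n (y n z) + b n) x - Dmat (coneMap Δ) x))
          atTop (𝓝 0) := by
  obtain ⟨C, hC, mk⟩ := Bd_mk Δ C₂ hC₂
  obtain ⟨N, hN⟩ := eventually_atTop.1 (hto0.eventually (ge_mem_nhds (zero_lt_one)))
  set v : ℕ → YY := fun n => Ry (y (n+N)) (LinearIsometryEquiv.refl ℝ E3) (-(y (n+N) 0)) with hv
  have hvc : ∀ n, ContDiff ℝ 2 (v n) := fun n => Ry_cd (hy _) _ _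
  have hB : ∀ n, Bd Δ C (h (n+N)) (v n) := fun n => by
    refine mk _ _ (hpos _) (hN _ (Nat.le_add_left _ _)) (hvc n) (by simp [hv, Ry]) ?_
    rw [hv, energy_shift (hy _)]
    exact hbound _
  obtain ⟨Q, hQ⟩ := SR_all hΔ0 (by nlinarith) ((tendsto_add_atTop_iff_nat N).2 hto0) hvc hB
  refine ⟨fun n => Q (n - N), fun n => -(Q (n-N) (y n 0)), fun ρ hρ => ?_⟩
  have key := fun n => ann (hvc n) (hB n) (Q n) hρ.1 hρ.2
  have e : ∀ n, Ry (v n) (Q n) 0 = fun z => Q (n + N - N) (y (n+N) z) + -(Q (n+N-N) (y (n+N) 0)) := fun n => by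
    funext z
    simp [hv, Ry, Nat.add_sub_cancel, sub_eq_add_neg]
  refine ⟨⟨2 * (ρ^2)⁻¹ * C, eventually_atTop.2 ⟨N, fun n hn => ?_⟩⟩, ?_, ?_⟩
  · obtain ⟨m, rfl⟩ := Nat.exists_eq_add_of_le' hn
    have := (key m).1
    rw [e] at this
    exact this
  · refine (tendsto_add_atTop_iff_nat N).1 (squeeze_zero (fun n => integral_nonneg fun x => by positivity) (fun n => ?_) (by simpa using hQ.const_mul (2 * (ρ^5)⁻¹)))
    have := (key n).2.1
    rw [e] at this
    exact this
  · refine (tendsto_add_atTop_iff_nat N).1 (squeeze_zero (fun n => integral_nonneg fun x => ?_) (fun n => ?_) (by simpa using hQ.const_mul ((ρ^5)⁻¹)))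
    · exact Finset.sum_nonneg fun i _ => Finset.sum_nonneg fun j _ => sq_nonneg _
    have := (key n).2.2
    rw [e] at this
    exact this
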